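/- Let F be an algebraically closed field of characteristic 0. If θ is an automorphism of finite order of the simple Lie algebra 𝔢₈ of type E₈ over F such that the fixed subalgebra 𝔢₈^θ is semisimple, then the order of θ is at most 6. -/

import Mathlib

open LieAlgebra

/-- The group of automorphisms of a Lie algebra, realized as the subgroup of the group
of linear automorphisms consisting of those preserving the bracket. -/
def lieAut (R L : Type*) [CommRing R] [LieRing L] [LieAlgebra R L] :
    Subgroup (L ≃ₗ[R] L) where
  carrier := {e | ∀ x y : L, e ⁅x, y⁆ = ⁅e x, e y⁆}
  one_mem' := fun _ _ => rfl
  mul_mem' := by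
    intro f g hf hg x y
    show f (g ⁅x, y⁆) = _
    rw [hg]
    exact hf _ _
  inv_mem' := by
    intro f hf x y
    apply f.injective
    show f (f.symm ⁅x, y⁆) = f ⁅f.symm x, f.symm y⁆
    rw [hf (f.symm x) (f.symm y), f.apply_symm_apply, f.apply_symm_apply, f.apply_symm_apply]

/-- The subalgebra of fixed points of an automorphism of a Lie algebra. -/
def fixedSubalgebra {R L : Type*} [CommRing R] [LieRing L] [LieAlgebra R L]
    (θ : lieAut R L) : LieSubalgebra R L where
  carrier := {x | (θ : L ≃ₗ[R] L) x = x}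
  add_mem' := by
    intro a b ha hb
    simp only [Set.mem_setOf_eq] at *
    rw [map_add, ha, hb]
  zero_mem' := map_zero _
  smul_mem' := by
    intro c a ha
    simp only [Set.mem_setOf_eq] at *
    rw [map_smul, ha]
  lie_mem' := by
    intro a b ha hb
    simp only [Set.mem_setOf_eq] at *
    rw [θ.2 a b, ha, hb]

/-- A maximal finite abelian subgroup: a finite abelian subgroup which is maximal among
all abelian subgroups. -/
def IsMaximalFiniteAbelian {G : Type*} [Group G] (Q : Subgroup G) : Prop :=
  Finite Q ∧ (∀ a b, a ∈ Q → b ∈ Q → a * b = b * a) ∧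
    ∀ Q' : Subgroup G, (∀ a b, a ∈ Q' → b ∈ Q' → a * b = b * a) → Q ≤ Q' → Q' = Q

/-- Two subgroups are conjugate. -/
def SubgroupIsConj {G : Type*} [Group G] (Q₁ Q₂ : Subgroup G) : Prop :=
  ∃ g : G, Q₂ = Q₁.map (MulAut.conj g).toMonoidHom

namespace E8L

/-- The quadratic form of `E₈`. -/
def q (n : Fin 8 → ℤ) : ℤ :=
  2 * (n 0 ^ 2 + n 1 ^ 2 + n 2 ^ 2 + n 3 ^ 2 + n 4 ^ 2 + n 5 ^ 2 + n 6 ^ 2 + n 7 ^ 2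
    - n 0 * n 2 - n 2 * n 3 - n 1 * n 3 - n 3 * n 4 - n 4 * n 5 - n 5 * n 6 - n 6 * n 7)

/-- Pairing with the simple roots. -/
def pr (n : Fin 8 → ℤ) (i : Fin 8) : ℤ := ∑ j, n j * CartanMatrix.E₈ j i

lemma pr0 (n : Fin 8 → ℤ) : pr n 0 = 2 * n 0 - n 2 := by
  simp [pr, Fin.sum_univ_eight, CartanMatrix.E₈]; ring
lemma pr1 (n : Fin 8 → ℤ) : pr n 1 = 2 * n 1 - n 3 := by
  simp [pr, Fin.sum_univ_eight, CartanMatrix.E₈]; ring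
lemma pr2 (n : Fin 8 → ℤ) : pr n 2 = 2 * n 2 - n 0 - n 3 := by
  simp [pr, Fin.sum_univ_eight, CartanMatrix.E₈]; ring
lemma pr3 (n : Fin 8 → ℤ) : pr n 3 = 2 * n 3 - n 1 - n 2 - n 4 := by
  simp [pr, Fin.sum_univ_eight, CartanMatrix.E₈]; ring
lemma pr4 (n : Fin 8 → ℤ) : pr n 4 = 2 * n 4 - n 3 - n 5 := by
  simp [pr, Fin.sum_univ_eight, CartanMatrix.E₈]; ring
lemma pr5 (n : Fin 8 → ℤ) : pr n 5 = 2 * n 5 - n 4 - n 6 := by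
  simp [pr, Fin.sum_univ_eight, CartanMatrix.E₈]; ring
lemma pr6 (n : Fin 8 → ℤ) : pr n 6 = 2 * n 6 - n 5 - n 7 := by
  simp [pr, Fin.sum_univ_eight, CartanMatrix.E₈]; ring
lemma pr7 (n : Fin 8 → ℤ) : pr n 7 = 2 * n 7 - n 6 := by
  simp [pr, Fin.sum_univ_eight, CartanMatrix.E₈]; ring

lemma forall8 {P : Fin 8 → Prop} : (∀ i, P i) ↔
    P 0 ∧ P 1 ∧ P 2 ∧ P 3 ∧ P 4 ∧ P 5 ∧ P 6 ∧ P 7 := by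
  constructor
  · intro h; exact ⟨h 0, h 1, h 2, h 3, h 4, h 5, h 6, h 7⟩
  · rintro ⟨h0, h1, h2, h3, h4, h5, h6, h7⟩ i
    fin_cases i <;> assumption

lemma pr_add (n k : Fin 8 → ℤ) (i : Fin 8) : pr (n + k) i = pr n i + pr k i := by
  simp [pr, add_mul, Finset.sum_add_distrib]
lemma pr_sub (n k : Fin 8 → ℤ) (i : Fin 8) : pr (n - k) i = pr n i - pr k i := by
  simp [pr, sub_mul, Finset.sum_sub_distrib]
lemma pr_neg (n : Fin 8 → ℤ) (i : Fin 8) : pr (-n) i = - pr n i := by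
  simp [pr, Finset.sum_neg_distrib]
lemma pr_smul (c : ℤ) (n : Fin 8 → ℤ) (i : Fin 8) : pr (c • n) i = c * pr n i := by
  simp [pr, Finset.mul_sum, mul_assoc]
lemma pr_zero (i : Fin 8) : pr 0 i = 0 := by simp [pr]
lemma pr_single (j i : Fin 8) : pr (Pi.single j 1) i = CartanMatrix.E₈ j i := by
  simp [pr, Pi.single_apply]
lemma E_symm (i j : Fin 8) : CartanMatrix.E₈ i j = CartanMatrix.E₈ j i :=
  (congrFun (congrFun CartanMatrix.E₈_isSymm i) j).symm
lemma E_diag (i : Fin 8) : CartanMatrix.E₈ i i = 2 := by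
  revert i; decide

/-- The bilinear form. -/
def bil (n k : Fin 8 → ℤ) : ℤ := ∑ i, k i * pr n i

lemma bil_self (n : Fin 8 → ℤ) : bil n n = q n := by
  simp only [bil, Fin.sum_univ_eight, pr0, pr1, pr2, pr3, pr4, pr5, pr6, pr7, q]; ring
lemma bil_comm (n k : Fin 8 → ℤ) : bil n k = bil k n := by
  simp only [bil, Fin.sum_univ_eight, pr0, pr1, pr2, pr3, pr4, pr5, pr6, pr7]; ring
lemma bil_single (n : Fin 8 → ℤ) (i : Fin 8) : bil n (Pi.single i 1) = pr n i := by
  simp [bil, Pi.single_apply]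
lemma q_add_smul (n k : Fin 8 → ℤ) (c : ℤ) : q (n + c • k) = q n + 2 * c * bil n k + c ^ 2 * q k := by
  simp only [bil, Fin.sum_univ_eight, pr0, pr1, pr2, pr3, pr4, pr5, pr6, pr7, q, Pi.add_apply,
    Pi.smul_apply, smul_eq_mul]; ring
lemma q_neg (n : Fin 8 → ℤ) : q (-n) = q n := by simp [q]
lemma q_zero : q 0 = 0 := by simp [q]
lemma q_single (i : Fin 8) : q (Pi.single i 1) = 2 := by
  rw [← bil_self, bil_single, pr_single, E_diag]

lemma q_sos (n : Fin 8 → ℤ) : 60 * q n = 30 * (2 * n 7 - n 6) ^ 2 + 10 * (3 * n 6 - 2 * n 5) ^ 2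
    + 5 * (4 * n 5 - 3 * n 4) ^ 2 + 3 * (5 * n 4 - 4 * n 3) ^ 2 + 30 * (2 * n 0 - n 2) ^ 2
    + 10 * (3 * n 2 - 2 * n 3) ^ 2 + 30 * (2 * n 1 - n 3) ^ 2 + 2 * n 3 ^ 2 := by
  simp only [q]; ring

lemma q_nonneg (n : Fin 8 → ℤ) : 0 ≤ q n := by
  have := q_sos n
  have : 0 ≤ 60 * q n := by rw [this]; positivity
  omega

lemma q_eq_zero {n : Fin 8 → ℤ} (h : q n = 0) : n = 0 := by
  have := q_sos n
  rw [h, mul_zero] at this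
  have h3 : n 3 ^ 2 = 0 := by nlinarith [sq_nonneg (2 * n 7 - n 6), sq_nonneg (3 * n 6 - 2 * n 5), sq_nonneg (4 * n 5 - 3 * n 4), sq_nonneg (5 * n 4 - 4 * n 3), sq_nonneg (2 * n 0 - n 2), sq_nonneg (3 * n 2 - 2 * n 3), sq_nonneg (2 * n 1 - n 3), sq_nonneg (n 3)]
  have s1 : (2 * n 7 - n 6) ^ 2 = 0 := by nlinarith [sq_nonneg (2 * n 7 - n 6), sq_nonneg (3 * n 6 - 2 * n 5), sq_nonneg (4 * n 5 - 3 * n 4), sq_nonneg (5 * n 4 - 4 * n 3), sq_nonneg (2 * n 0 - n 2), sq_nonneg (3 * n 2 - 2 * n 3), sq_nonneg (2 * n 1 - n 3), sq_nonneg (n 3)]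
  have s2 : (3 * n 6 - 2 * n 5) ^ 2 = 0 := by nlinarith [sq_nonneg (2 * n 7 - n 6), sq_nonneg (3 * n 6 - 2 * n 5), sq_nonneg (4 * n 5 - 3 * n 4), sq_nonneg (5 * n 4 - 4 * n 3), sq_nonneg (2 * n 0 - n 2), sq_nonneg (3 * n 2 - 2 * n 3), sq_nonneg (2 * n 1 - n 3), sq_nonneg (n 3)]
  have s3 : (4 * n 5 - 3 * n 4) ^ 2 = 0 := by nlinarith [sq_nonneg (2 * n 7 - n 6), sq_nonneg (3 * n 6 - 2 * n 5), sq_nonneg (4 * n 5 - 3 * n 4), sq_nonneg (5 * n 4 - 4 * n 3), sq_nonneg (2 * n 0 - n 2), sq_nonneg (3 * n 2 - 2 * n 3), sq_nonneg (2 * n 1 - n 3), sq_nonneg (n 3)]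
  have s4 : (5 * n 4 - 4 * n 3) ^ 2 = 0 := by nlinarith [sq_nonneg (2 * n 7 - n 6), sq_nonneg (3 * n 6 - 2 * n 5), sq_nonneg (4 * n 5 - 3 * n 4), sq_nonneg (5 * n 4 - 4 * n 3), sq_nonneg (2 * n 0 - n 2), sq_nonneg (3 * n 2 - 2 * n 3), sq_nonneg (2 * n 1 - n 3), sq_nonneg (n 3)]
  have s5 : (2 * n 0 - n 2) ^ 2 = 0 := by nlinarith [sq_nonneg (2 * n 7 - n 6), sq_nonneg (3 * n 6 - 2 * n 5), sq_nonneg (4 * n 5 - 3 * n 4), sq_nonneg (5 * n 4 - 4 * n 3), sq_nonneg (2 * n 0 - n 2), sq_nonneg (3 * n 2 - 2 * n 3), sq_nonneg (2 * n 1 - n 3), sq_nonneg (n 3)]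
  have s6 : (3 * n 2 - 2 * n 3) ^ 2 = 0 := by nlinarith [sq_nonneg (2 * n 7 - n 6), sq_nonneg (3 * n 6 - 2 * n 5), sq_nonneg (4 * n 5 - 3 * n 4), sq_nonneg (5 * n 4 - 4 * n 3), sq_nonneg (2 * n 0 - n 2), sq_nonneg (3 * n 2 - 2 * n 3), sq_nonneg (2 * n 1 - n 3), sq_nonneg (n 3)]
  have s7 : (2 * n 1 - n 3) ^ 2 = 0 := by nlinarith [sq_nonneg (2 * n 7 - n 6), sq_nonneg (3 * n 6 - 2 * n 5), sq_nonneg (4 * n 5 - 3 * n 4), sq_nonneg (5 * n 4 - 4 * n 3), sq_nonneg (2 * n 0 - n 2), sq_nonneg (3 * n 2 - 2 * n 3), sq_nonneg (2 * n 1 - n 3), sq_nonneg (n 3)]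
  rw [sq_eq_zero_iff] at *
  have : ∀ i, n i = 0 := by
    rw [forall8]; refine ⟨?_, ?_, ?_, ?_, ?_, ?_, ?_, ?_⟩ <;> omega
  exact funext this

lemma q_pos {n : Fin 8 → ℤ} (h : n ≠ 0) : 0 < q n :=
  lt_of_le_of_ne (q_nonneg n) (fun h' => h (q_eq_zero h'.symm))

lemma q_even (n : Fin 8 → ℤ) : ∃ k, q n = 2 * k := ⟨_, rfl⟩

/-- A nonzero nonnegative vector pairs positively with a simple root in its support. -/
lemma exists_pr_pos {n : Fin 8 → ℤ} (hn : n ≠ 0) (h0 : 0 ≤ n) : ∃ i, 0 < n i ∧ 0 < pr n i := by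
  by_contra! hc
  have h1 := q_pos hn
  rw [← bil_self, bil] at h1
  have : ∑ i, n i * pr n i ≤ 0 := by
    refine Finset.sum_nonpos fun i _ => ?_
    rcases (h0 i).lt_or_eq with h | h
    · exact mul_nonpos_of_nonneg_of_nonpos h.le (hc i h)
    · simp [← h]
  omega

/-- Roots are positive or negative. -/
lemma root_sign {n : Fin 8 → ℤ} (hn : q n = 2) : 0 ≤ n ∨ n ≤ 0 := by
  have e : n = n⁺ + (-1 : ℤ) • n⁻ := by
    rw [neg_one_smul, ← sub_eq_add_neg, posPart_sub_negPart]
  have h1 : q n = q n⁺ - 2 * bil n⁺ n⁻ + q n⁻ := by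
    conv_lhs => rw [e]
    rw [q_add_smul]; ring
  have h2 : bil n⁺ n⁻ ≤ 0 := by
    have e1 : ∀ i, n⁺ i * n⁻ i = 0 := by
      intro i
      simp only [Pi.posPart_apply, Pi.negPart_apply, posPart_def, negPart_def]
      rcases le_total (n i) 0 with h | h <;> simp [h]
    have e2 : ∀ i, 0 ≤ n⁺ i := fun i => (posPart_nonneg n) i
    have e3 : ∀ i, 0 ≤ n⁻ i := fun i => (negPart_nonneg n) i
    generalize n⁺ = a at *
    generalize n⁻ = b at *
    have e4 : ∀ i j, 0 ≤ a i * b j := fun i j => mul_nonneg (e2 i) (e3 j)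
    simp only [bil, Fin.sum_univ_eight, pr0, pr1, pr2, pr3, pr4, pr5, pr6, pr7]
    nlinarith [e1 0, e1 1, e1 2, e1 3, e1 4, e1 5, e1 6, e1 7, e4 0 2, e4 2 0, e4 2 3, e4 3 2,
      e4 1 3, e4 3 1, e4 3 4, e4 4 3, e4 4 5, e4 5 4, e4 5 6, e4 6 5, e4 6 7, e4 7 6]
  by_contra! hc
  have h3 : n⁺ ≠ 0 := fun h => hc.2 (posPart_eq_zero.1 h)
  have h4 : n⁻ ≠ 0 := fun h => hc.1 (negPart_eq_zero.1 h)
  have h5 := q_pos h3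
  have h6 := q_pos h4
  obtain ⟨a, ha⟩ := q_even n⁺
  obtain ⟨b, hb⟩ := q_even n⁻
  omega

lemma root_ne_zero {n : Fin 8 → ℤ} (hn : q n = 2) : n ≠ 0 := by
  rintro rfl; rw [q_zero] at hn; omega

lemma bil_sub_le {n k : Fin 8 → ℤ} (hn : q n = 2) (hk : q k = 2) (hne : n ≠ k) : bil n k ≤ 1 := by
  have := q_add_smul n k (-1)
  have h2 : n + (-1 : ℤ) • k ≠ 0 := by
    rw [neg_one_smul, ← sub_eq_add_neg]; exact sub_ne_zero.2 hne
  have := q_pos h2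
  obtain ⟨a, ha⟩ := q_even (n + (-1 : ℤ) • k)
  omega

lemma q_reflect {k n : Fin 8 → ℤ} (hn : q n = 2) : q (k - bil k n • n) = q k := by
  rw [sub_eq_add_neg, ← neg_smul, q_add_smul, hn]; ring

/-- A positive root that is not simple remains a root after subtracting some simple root. -/
lemma root_sub {n : Fin 8 → ℤ} (hn : q n = 2) (h0 : 0 ≤ n) (hs : ∀ i, n ≠ Pi.single i 1) :
    ∃ i, q (n - Pi.single i 1) = 2 ∧ 0 ≤ n - Pi.single i 1 ∧ pr n i = 1 := by
  obtain ⟨i, hi, hp⟩ := exists_pr_pos (root_ne_zero hn) h0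
  have h1 := bil_sub_le hn (q_single i) (hs i)
  rw [bil_single] at h1
  have h2 : pr n i = 1 := by omega
  refine ⟨i, ?_, ?_, h2⟩
  · have := q_add_smul n (Pi.single i 1) (-1)
    rw [bil_single, q_single, neg_one_smul, ← sub_eq_add_neg] at this
    omega
  · intro j
    by_cases hj : j = i
    · subst hj; simp; omega
    · simpa [hj] using h0 j

/-- highest root -/
def mvec : Fin 8 → ℤ := ![2, 3, 4, 6, 5, 4, 3, 2]

lemma pr_inv (n : Fin 8 → ℤ) :
    n 0 = 4 * pr n 0 + 5 * pr n 1 + 7 * pr n 2 + 10 * pr n 3 + 8 * pr n 4 + 6 * pr n 5 + 4 * pr n 6 + 2 * pr n 7 ∧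
    n 1 = 5 * pr n 0 + 8 * pr n 1 + 10 * pr n 2 + 15 * pr n 3 + 12 * pr n 4 + 9 * pr n 5 + 6 * pr n 6 + 3 * pr n 7 ∧
    n 2 = 7 * pr n 0 + 10 * pr n 1 + 14 * pr n 2 + 20 * pr n 3 + 16 * pr n 4 + 12 * pr n 5 + 8 * pr n 6 + 4 * pr n 7 ∧
    n 3 = 10 * pr n 0 + 15 * pr n 1 + 20 * pr n 2 + 30 * pr n 3 + 24 * pr n 4 + 18 * pr n 5 + 12 * pr n 6 + 6 * pr n 7 ∧
    n 4 = 8 * pr n 0 + 12 * pr n 1 + 16 * pr n 2 + 24 * pr n 3 + 20 * pr n 4 + 15 * pr n 5 + 10 * pr n 6 + 5 * pr n 7 ∧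
    n 5 = 6 * pr n 0 + 9 * pr n 1 + 12 * pr n 2 + 18 * pr n 3 + 15 * pr n 4 + 12 * pr n 5 + 8 * pr n 6 + 4 * pr n 7 ∧
    n 6 = 4 * pr n 0 + 6 * pr n 1 + 8 * pr n 2 + 12 * pr n 3 + 10 * pr n 4 + 8 * pr n 5 + 6 * pr n 6 + 3 * pr n 7 ∧
    n 7 = 2 * pr n 0 + 3 * pr n 1 + 4 * pr n 2 + 6 * pr n 3 + 5 * pr n 4 + 4 * pr n 5 + 3 * pr n 6 + 2 * pr n 7 := by
  simp only [pr0, pr1, pr2, pr3, pr4, pr5, pr6, pr7]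
  refine ⟨?_, ?_, ?_, ?_, ?_, ?_, ?_, ?_⟩ <;> ring

lemma pr_surj (x : Fin 8 → ℤ) : ∃ y, ∀ i, pr y i = x i := by
  refine ⟨![4 * x 0 + 5 * x 1 + 7 * x 2 + 10 * x 3 + 8 * x 4 + 6 * x 5 + 4 * x 6 + 2 * x 7,
    5 * x 0 + 8 * x 1 + 10 * x 2 + 15 * x 3 + 12 * x 4 + 9 * x 5 + 6 * x 6 + 3 * x 7,
    7 * x 0 + 10 * x 1 + 14 * x 2 + 20 * x 3 + 16 * x 4 + 12 * x 5 + 8 * x 6 + 4 * x 7,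
    10 * x 0 + 15 * x 1 + 20 * x 2 + 30 * x 3 + 24 * x 4 + 18 * x 5 + 12 * x 6 + 6 * x 7,
    8 * x 0 + 12 * x 1 + 16 * x 2 + 24 * x 3 + 20 * x 4 + 15 * x 5 + 10 * x 6 + 5 * x 7,
    6 * x 0 + 9 * x 1 + 12 * x 2 + 18 * x 3 + 15 * x 4 + 12 * x 5 + 8 * x 6 + 4 * x 7,
    4 * x 0 + 6 * x 1 + 8 * x 2 + 12 * x 3 + 10 * x 4 + 8 * x 5 + 6 * x 6 + 3 * x 7,
    2 * x 0 + 3 * x 1 + 4 * x 2 + 6 * x 3 + 5 * x 4 + 4 * x 5 + 3 * x 6 + 2 * x 7], ?_⟩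
  rw [forall8]
  simp only [pr0, pr1, pr2, pr3, pr4, pr5, pr6, pr7]
  refine ⟨?_, ?_, ?_, ?_, ?_, ?_, ?_, ?_⟩ <;> simp <;> ring

/-- A dominant root is the highest root. -/
lemma dominant_root {n : Fin 8 → ℤ} (hn : q n = 2) (hd : ∀ i, 0 ≤ pr n i) : n = mvec := by
  obtain ⟨a0, a1, a2, a3, a4, a5, a6, a7⟩ := pr_inv n
  have hb := bil_self n
  rw [hn, bil, Fin.sum_univ_eight] at hb
  have d := hd
  rw [forall8] at d
  obtain ⟨d0, d1, d2, d3, d4, d5, d6, d7⟩ := d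
  generalize pr n 0 = p0 at *
  generalize pr n 1 = p1 at *
  generalize pr n 2 = p2 at *
  generalize pr n 3 = p3 at *
  generalize pr n 4 = p4 at *
  generalize pr n 5 = p5 at *
  generalize pr n 6 = p6 at *
  generalize pr n 7 = p7 at *
  have m0 : 0 ≤ n 0 * p0 := mul_nonneg (by omega) d0
  have m1 : 0 ≤ n 1 * p1 := mul_nonneg (by omega) d1
  have m2 : 0 ≤ n 2 * p2 := mul_nonneg (by omega) d2
  have m3 : 0 ≤ n 3 * p3 := mul_nonneg (by omega) d3
  have m4 : 0 ≤ n 4 * p4 := mul_nonneg (by omega) d4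
  have m5 : 0 ≤ n 5 * p5 := mul_nonneg (by omega) d5
  have m6 : 0 ≤ n 6 * p6 := mul_nonneg (by omega) d6
  have m7 : 0 ≤ n 7 * p7 := mul_nonneg (by omega) d7
  have key : ∀ p k : ℤ, 0 ≤ p → 3 * p ≤ k → k * p ≤ 2 → p = 0 := fun p k hp h1 h2 => by nlinarith
  have z0 : p0 = 0 := key _ (n 0) d0 (by omega) (by omega)
  have z1 : p1 = 0 := key _ (n 1) d1 (by omega) (by omega)
  have z2 : p2 = 0 := key _ (n 2) d2 (by omega) (by omega)
  have z3 : p3 = 0 := key _ (n 3) d3 (by omega) (by omega)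
  have z4 : p4 = 0 := key _ (n 4) d4 (by omega) (by omega)
  have z5 : p5 = 0 := key _ (n 5) d5 (by omega) (by omega)
  have z6 : p6 = 0 := key _ (n 6) d6 (by omega) (by omega)
  subst z0 z1 z2 z3 z4 z5 z6
  have z7 : p7 = 1 := by
    have : n 7 * p7 = 2 := by omega
    rw [a7] at this
    nlinarith
  subst z7
  have : ∀ i, n i = mvec i := by
    rw [forall8]
    refine ⟨?_, ?_, ?_, ?_, ?_, ?_, ?_, ?_⟩ <;> simp [mvec] <;> omega
  exact funext this

lemma mvec_pos (i : Fin 8) : 0 < mvec i := by revert i; decide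
lemma mvec_le (i : Fin 8) : mvec i ≤ 6 := by revert i; decide
lemma q_mvec : q mvec = 2 := by decide
lemma pr_mvec (i : Fin 8) : pr mvec i = if i = 7 then 1 else 0 := by
  revert i; rw [forall8]
  simp only [pr0, pr1, pr2, pr3, pr4, pr5, pr6, pr7]
  decide

/-- the half sum of positive roots -/
def rho : Fin 8 → ℤ := ![46, 68, 91, 135, 110, 84, 57, 29]
lemma pr_rho (i : Fin 8) : pr rho i = 1 := by
  revert i; rw [forall8]
  simp only [pr0, pr1, pr2, pr3, pr4, pr5, pr6, pr7]
  decide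
lemma q_rho : q rho = 620 := by decide

lemma bil_rho (n : Fin 8 → ℤ) : bil n rho = ∑ i, n i := by
  rw [bil_comm, bil]; simp [pr_rho]

lemma height_le {n : Fin 8 → ℤ} (hn : q n = 2) : ∑ i, n i ≤ 100 := by
  have := q_nonneg (rho + (-18 : ℤ) • n)
  rw [q_add_smul, bil_comm, bil_rho, q_rho, hn] at this
  omega

lemma root_le {n : Fin 8 → ℤ} (hn : q n = 2) : n ≤ mvec := by
  obtain ⟨k, hk⟩ : ∃ k : ℕ, (100 - ∑ i, n i).toNat = k := ⟨_, rfl⟩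
  induction k using Nat.strong_induction_on generalizing n with
  | _ k ih =>
  by_cases hd : ∀ i, 0 ≤ pr n i
  · exact (dominant_root hn hd).le
  push Not at hd
  obtain ⟨i, hi⟩ := hd
  have hr := q_reflect (k := n) (q_single i)
  rw [bil_single, hn] at hr
  have hs : ∑ j, (n - pr n i • Pi.single i 1 : Fin 8 → ℤ) j = ∑ j, n j - pr n i := by
    simp [Finset.sum_sub_distrib, Pi.single_apply]
  have h1 := height_le hr
  refine le_trans ?_ (ih _ ?_ hr rfl)
  · intro j
    by_cases hj : j = i
    · subst hj; simp; omega
    · simp [hj]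
  · rw [← hk, hs]; rw [hs] at h1; omega

lemma root_bound {n : Fin 8 → ℤ} (hn : q n = 2) (i : Fin 8) : -6 ≤ n i ∧ n i ≤ 6 := by
  have h1 := (root_le hn i).trans (mvec_le i)
  have h2 := (root_le ((q_neg n).trans hn) i).trans (mvec_le i)
  simp at h2
  constructor <;> omega

lemma finite_roots : {n : Fin 8 → ℤ | q n = 2}.Finite := by
  refine (Set.Finite.pi' (t := fun _ : Fin 8 => Set.Icc (-6 : ℤ) 6) fun _ => Set.finite_Icc _ _).subset ?_
  intro n hn i
  exact root_bound hn i

/-- Induction principle towards the alcove. -/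
lemma alcove_aux (m : ℤ) (hm : 1 ≤ m) (P : (Fin 8 → ℤ) → Prop)
    (h1 : ∀ x i, x i < 0 → P (fun j => x j - x i * CartanMatrix.E₈ i j) → P x)
    (h2 : ∀ x, m < ∑ i, mvec i * x i →
      P (fun j => x j - ((∑ i, mvec i * x i) - m) * pr mvec j) → P x)
    (h3 : ∀ x, (∀ i, 0 ≤ x i) → ∑ i, mvec i * x i ≤ m → P x) (x : Fin 8 → ℤ) : P x := by
  obtain ⟨y, hy⟩ := pr_surj x
  obtain ⟨k, hk⟩ : ∃ k : ℕ, (30 * q y - 2 * ∑ i, y i + 21).toNat = k := ⟨_, rfl⟩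
  induction k using Nat.strong_induction_on generalizing x y with
  | _ k ih =>
  have hM : ∀ y : Fin 8 → ℤ, 0 ≤ 30 * q y - 2 * ∑ i, y i + 21 := by
    intro y
    have := q_nonneg (rho + (-30 : ℤ) • y)
    rw [q_add_smul, bil_comm, bil_rho, q_rho] at this
    omega
  by_cases c1 : ∃ i, x i < 0
  · obtain ⟨i, hi⟩ := c1
    refine h1 x i hi (ih _ ?_ _ (y - x i • Pi.single i 1) ?_ rfl)
    · have e1 : q (y - x i • Pi.single i 1) = q y := by
        rw [← hy i, ← bil_single, q_reflect (q_single i)]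
      have hs : ∑ j, (y - x i • Pi.single i 1 : Fin 8 → ℤ) j = ∑ j, y j - x i := by
        simp [Finset.sum_sub_distrib, Pi.single_apply]
      have := hM (y - x i • Pi.single i 1)
      rw [e1, hs] at *
      omega
    · intro j
      rw [pr_sub, pr_smul, pr_single, hy]
  · by_cases c2 : m < ∑ i, mvec i * x i
    · obtain ⟨d, hd⟩ : ∃ d, d = (∑ i, mvec i * x i) - m := ⟨_, rfl⟩
      refine h2 x c2 (ih _ ?_ _ (y + (-d) • mvec) ?_ rfl)
      · have e0 : bil y mvec = d + m := by
          rw [hd, bil]; simp [hy]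
        have e1 : q (y + (-d) • mvec) = q y - 2 * (d * m) := by
          rw [q_add_smul, e0, q_mvec]; ring
        have e2 : ∑ i, mvec i = 29 := by decide
        have hs : ∑ j, (y + (-d) • mvec : Fin 8 → ℤ) j = ∑ j, y j - 29 * d := by
          simp [Finset.sum_add_distrib, ← Finset.mul_sum, e2]; ring
        have := hM (y + (-d) • mvec)
        rw [e1, hs] at *
        have : 0 < d := by omega
        have : d ≤ d * m := by nlinarith
        omega
      · intro j
        rw [pr_add, pr_smul, hy, hd]; ring
    · exact h3 x (by push Not at c1; exact c1) (by omega)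

/-- Induction principle towards the dominant chamber. -/
lemma chamber_aux (P : (Fin 8 → ℤ) → Prop)
    (h1 : ∀ x i, x i < 0 → P (fun j => x j - x i * CartanMatrix.E₈ i j) → P x)
    (h3 : ∀ x, (∀ i, 0 ≤ x i) → P x) (x : Fin 8 → ℤ) : P x := by
  obtain ⟨y, hy⟩ := pr_surj x
  obtain ⟨k, hk⟩ : ∃ k : ℕ, (30 * q y - 2 * ∑ i, y i + 21).toNat = k := ⟨_, rfl⟩
  induction k using Nat.strong_induction_on generalizing x y with
  | _ k ih =>
  have hM : ∀ y : Fin 8 → ℤ, 0 ≤ 30 * q y - 2 * ∑ i, y i + 21 := by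
    intro y
    have := q_nonneg (rho + (-30 : ℤ) • y)
    rw [q_add_smul, bil_comm, bil_rho, q_rho] at this
    omega
  by_cases c1 : ∃ i, x i < 0
  · obtain ⟨i, hi⟩ := c1
    refine h1 x i hi (ih _ ?_ _ (y - x i • Pi.single i 1) ?_ rfl)
    · have e1 : q (y - x i • Pi.single i 1) = q y := by
        rw [← hy i, ← bil_single, q_reflect (q_single i)]
      have hs : ∑ j, (y - x i • Pi.single i 1 : Fin 8 → ℤ) j = ∑ j, y j - x i := by
        simp [Finset.sum_sub_distrib, Pi.single_apply]
      have := hM (y - x i • Pi.single i 1)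
      rw [e1, hs] at *
      omega
    · intro j
      rw [pr_sub, pr_smul, pr_single, hy]
  · exact h3 x (by push Not at c1; exact c1)

/-- adjacency in the diagram -/
def adj (i j : Fin 8) : Bool := decide (CartanMatrix.E₈ i j = -1)

lemma nbr : ∀ a b : Fin 8, adj a b = true → a ≠ 3 →
    b = ![2, 3, 0, 0, 3, 4, 5, 6] a ∨ b = ![2, 3, 3, 0, 5, 6, 7, 6] a := by decide
lemma nbr3 : ∀ b : Fin 8, adj 3 b = true → b = 1 ∨ b = 2 ∨ b = 4 := by decide
lemma diag1 (a b : Fin 8) (h1 : adj a b = true) (c) (h2 : adj a c = true) (h3 : b ≠ c) (d)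
    (h4 : adj a d = true) (h5 : b ≠ d) (h6 : c ≠ d) : a = 3 := by
  by_contra h
  have e1 := nbr a b h1 h
  have e2 := nbr a c h2 h
  have e3 := nbr a d h4 h
  rcases e1 with e1 | e1 <;> rcases e2 with e2 | e2 <;> rcases e3 with e3 | e3 <;> subst e1 <;>
    simp_all
lemma diag2 (b : Fin 8) (h1 : adj 3 b = true) (c) (h2 : adj b c = true) (h3 : c ≠ 3) (d)
    (h4 : adj c d = true) (h5 : d ≠ b) (e) (h6 : adj d e = true) (h7 : e ≠ c) :
    b = 4 ∧ c = 5 ∧ d = 6 ∧ e = 7 := by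
  rcases nbr3 b h1 with rfl | rfl | rfl
  · exact absurd (nbr _ _ h2 (by decide)) (by simp [h3])
  · have hc : c = 0 := by simpa [h3] using nbr _ _ h2 (by decide)
    subst hc
    exact absurd (nbr _ _ h4 (by decide)) (by simp [h5])
  · have hc : c = 5 := by simpa [h3] using nbr _ _ h2 (by decide)
    subst hc
    have hd : d = 6 := by simpa [h5] using nbr _ _ h4 (by decide)
    subst hd
    have he : e = 7 := by simpa [h7] using nbr _ _ h6 (by decide)
    exact ⟨rfl, rfl, rfl, he⟩
lemma diag3 : ∀ b : Fin 8, adj 3 b = true → b ≠ 4 → ∀ c, adj b c = true → c ≠ 3 → b = 2 ∧ c = 0 := by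
  decide
lemma diag4 : ∀ b : Fin 8, adj 3 b = true → b ≠ 4 → b ≠ 2 → b = 1 := by
  decide

lemma diagram_rigid (s : Fin 8 → Fin 8) (hs : Function.Injective s)
    (ha : ∀ i j, adj i j = true → adj (s i) (s j) = true) (i : Fin 8) : s i = i := by
  have h3 : s 3 = 3 := diag1 (s 3) (s 1) (ha _ _ (by decide)) (s 2) (ha _ _ (by decide))
    (hs.ne (by decide)) (s 4) (ha _ _ (by decide)) (hs.ne (by decide)) (hs.ne (by decide))
  obtain ⟨h4, h5, h6, h7⟩ := diag2 (s 4) (h3 ▸ ha 3 4 (by decide)) (s 5) (ha _ _ (by decide))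
    (h3 ▸ hs.ne (by decide)) (s 6) (ha _ _ (by decide)) (hs.ne (by decide)) (s 7)
    (ha _ _ (by decide)) (hs.ne (by decide))
  have n24 : s 2 ≠ 4 := fun h => absurd (hs (h.trans h4.symm)) (by decide)
  have n03 : s 0 ≠ 3 := fun h => absurd (hs (h.trans h3.symm)) (by decide)
  obtain ⟨h2, h0⟩ := diag3 (s 2) (h3 ▸ ha 3 2 (by decide)) n24 (s 0) (ha _ _ (by decide)) n03
  have n14 : s 1 ≠ 4 := fun h => absurd (hs (h.trans h4.symm)) (by decide)
  have n12 : s 1 ≠ 2 := fun h => absurd (hs (h.trans h2.symm)) (by decide)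
  have h1 := diag4 (s 1) (h3 ▸ ha 3 1 (by decide)) n14 n12
  revert i
  rw [forall8]
  exact ⟨h0, h1, h2, h3, h4, h5, h6, h7⟩
end E8L

namespace Krek
set_option linter.unusedSectionVars false
set_option linter.unusedVariables false
variable {F L : Type*} [Field F] [LieRing L] [LieAlgebra F L] {m : ℕ} [NeZero m]

/-- A cyclically graded family with central degree zero. -/
structure Good (W : ZMod m → Submodule F L) : Prop where
  lie : ∀ i j x y, x ∈ W i → y ∈ W j → ⁅x, y⁆ ∈ W (i + j)
  zero : ∀ i x y, x ∈ W 0 → y ∈ W i → ⁅x, y⁆ = 0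

/-- The derived family. -/
def D (W : ZMod m → Submodule F L) (k : ZMod m) : Submodule F L :=
  Submodule.span F {z | ∃ i j x y, i + j = k ∧ x ∈ W i ∧ y ∈ W j ∧ z = ⁅x, y⁆}

lemma D_le {W : ZMod m → Submodule F L} (h : Good W) (k : ZMod m) : D W k ≤ W k := by
  rw [D, Submodule.span_le]
  rintro _ ⟨i, j, x, y, rfl, hx, hy, rfl⟩
  exact h.lie _ _ _ _ hx hy

lemma D_lie {W : ZMod m → Submodule F L} {i j : ZMod m} {x y : L} (hx : x ∈ W i) (hy : y ∈ W j) :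
    ⁅x, y⁆ ∈ D W (i + j) :=
  Submodule.subset_span ⟨i, j, x, y, rfl, hx, hy, rfl⟩

lemma D_good {W : ZMod m → Submodule F L} (h : Good W) : Good (D W) where
  lie i j x y hx hy := D_lie (D_le h _ hx) (D_le h _ hy)
  zero i x y hx hy := h.zero i x y (D_le h _ hx) (D_le h _ hy)

/-- iterated derived families -/
def DD (r : ℕ) (W : ZMod m → Submodule F L) : ZMod m → Submodule F L := D^[r] W

lemma DD_good {W : ZMod m → Submodule F L} (h : Good W) (r : ℕ) : Good (DD r W) := by
  induction r with
  | zero => exact h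
  | succ r ih => rw [DD, Function.iterate_succ_apply']; exact D_good ih

lemma DD_le {W : ZMod m → Submodule F L} (h : Good W) (r : ℕ) (k : ZMod m) : DD r W k ≤ W k := by
  induction r with
  | zero => exact le_rfl
  | succ r ih =>
    rw [DD, Function.iterate_succ_apply']; exact (D_le (DD_good h r) k).trans ih

/-- Graded subalgebra generated by the pieces in degrees at least `k`. -/
inductive SG (W : ZMod m → Submodule F L) (k : ℕ) : ZMod m → L → Prop
  | gen (i x) : k ≤ i.val → x ∈ W i → SG W k i x
  | zero (i) : SG W k i 0
  | add (i x y) : SG W k i x → SG W k i y → SG W k i (x + y)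
  | smul (i) (c : F) (x) : SG W k i x → SG W k i (c • x)
  | lie (i j x y) : SG W k i x → SG W k j y → SG W k (i + j) ⁅x, y⁆

lemma SG_le {W : ZMod m → Submodule F L} (h : Good W) {k i x} (hx : SG W k i x) : x ∈ W i := by
  induction hx with
  | gen i x _ hx => exact hx
  | zero i => exact zero_mem _
  | add i x y _ _ hx hy => exact add_mem hx hy
  | smul i c x _ hx => exact Submodule.smul_mem _ c hx
  | lie i j x y _ _ hx hy => exact h.lie _ _ _ _ hx hy

lemma SG_top {W : ZMod m → Submodule F L} {i x} (hx : SG W m i x) : x = 0 := by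
  induction hx with
  | gen i x h hx => exact absurd (ZMod.val_lt i) (by omega)
  | zero i => rfl
  | add i x y _ _ hx hy => simp [hx, hy]
  | smul i c x _ hx => simp [hx]
  | lie i j x y _ _ hx hy => simp [hx]

lemma SG_mono {W W' : ZMod m → Submodule F L} {k k' : ℕ}
    (hW : ∀ i : ZMod m, k ≤ i.val → ∀ x ∈ W i, SG W' k' i x) {i x} (hx : SG W k i x) :
    SG W' k' i x := by
  induction hx with
  | gen i x h hx => exact hW _ h _ hx
  | zero i => exact .zero _
  | add i x y _ _ hx hy => exact .add _ _ _ hx hy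
  | smul i c x _ hx => exact .smul _ _ _ hx
  | lie i j x y _ _ hx hy => exact .lie _ _ _ _ hx hy

lemma val_cases {k i j : ZMod m} (h : i + j = k) (hi : i ≠ 0) (hj : j ≠ 0) :
    (k.val < i.val ∧ k.val < j.val) ∨ (i.val < k.val ∧ j.val < k.val) := by
  have h1 := ZMod.val_lt i
  have h2 := ZMod.val_lt j
  have h3 : i.val ≠ 0 := by rwa [Ne, ZMod.val_eq_zero]
  have h4 : j.val ≠ 0 := by rwa [Ne, ZMod.val_eq_zero]
  have h5 := ZMod.val_add i j
  rw [h] at h5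
  by_cases hlt : i.val + j.val < m
  · rw [Nat.mod_eq_of_lt hlt] at h5; right; omega
  · rw [Nat.mod_eq_sub_mod (by omega), Nat.mod_eq_of_lt (by omega)] at h5; left; omega

lemma key {W : ZMod m → Submodule F L} (h : Good W) {k : ZMod m} {i x}
    (hx : SG W k.val i x) (j : ZMod m) (y : L) (hy : y ∈ W j)
    (hy' : j = k → SG W (k.val + 1) j y) :
    ⁅x, y⁆ ∈ W (i + j) ∧ (i + j = k → SG W (k.val + 1) (i + j) ⁅x, y⁆) := by
  induction hx generalizing j y with
  | gen i x hi hx =>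
    refine ⟨h.lie _ _ _ _ hx hy, fun e => ?_⟩
    by_cases j0 : j = 0
    · subst j0
      rw [← lie_skew, h.zero _ _ _ hy hx, neg_zero]; exact .zero _
    by_cases i0 : i = 0
    · subst i0
      rw [h.zero _ _ _ hx hy]; exact .zero _
    rcases val_cases e i0 j0 with h1 | h1
    · exact .lie _ _ _ _ (.gen _ _ h1.1 hx) (.gen _ _ h1.2 hy)
    · omega
  | zero i => simp; exact fun _ => .zero _
  | add i x x' _ _ hx hx' =>
    rw [add_lie]
    exact ⟨add_mem (hx _ _ hy hy').1 (hx' _ _ hy hy').1, fun e =>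
      .add _ _ _ ((hx _ _ hy hy').2 e) ((hx' _ _ hy hy').2 e)⟩
  | smul i c x _ hx =>
    rw [smul_lie]
    exact ⟨Submodule.smul_mem _ _ (hx _ _ hy hy').1, fun e => .smul _ _ _ ((hx _ _ hy hy').2 e)⟩
  | lie i i' x x' _ _ hx hx' =>
    have a := hx' _ _ hy hy'
    have b := hx _ _ hy hy'
    have a' := hx _ _ a.1 a.2
    have b' := hx' _ _ b.1 b.2
    have e1 : i + i' + j = i + (i' + j) := by ring
    have e2 : i + i' + j = i' + (i + j) := by ring
    rw [lie_lie]
    refine ⟨sub_mem (by rw [e1]; exact a'.1) (by rw [e2]; exact b'.1), fun e => ?_⟩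
    rw [sub_eq_add_neg, ← neg_one_smul F]
    refine .add _ _ _ ?_ (.smul _ _ _ ?_)
    · rw [e1] at e ⊢; exact a'.2 e
    · rw [e2] at e ⊢; exact b'.2 e

lemma step {W : ZMod m → Submodule F L} (h : Good W) {k : ZMod m} (M : ZMod m → Submodule F L)
    (hMW : ∀ i, M i ≤ W i) (hM : ∀ i, i ≠ 0 → ∀ x ∈ M i, SG W k.val i x) :
    ∀ x ∈ D M k, SG W (k.val + 1) k x := by
  intro x hx
  rw [D] at hx
  induction hx using Submodule.span_induction with
  | zero => exact .zero _
  | add x y _ _ hx hy => exact .add _ _ _ hx hy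
  | smul c x _ hx => exact .smul _ _ _ hx
  | mem x hx =>
    obtain ⟨i, j, x, y, e, hx, hy, rfl⟩ := hx
    by_cases j0 : j = 0
    · subst j0
      rw [← lie_skew, h.zero _ _ _ (hMW _ hy) (hMW _ hx), neg_zero]; exact .zero _
    by_cases i0 : i = 0
    · subst i0
      rw [h.zero _ _ _ (hMW _ hx) (hMW _ hy)]; exact .zero _
    rcases val_cases e i0 j0 with h1 | h1
    · rw [← e] at h1 ⊢
      exact .lie _ _ _ _ (.gen _ _ h1.1 (hMW _ hx)) (.gen _ _ h1.2 (hMW _ hy))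
    · have := (key h (hM i i0 x hx) j y (hMW _ hy) (by rintro rfl; omega)).2 e
      rwa [e] at this

lemma main (k : ℕ) (hk : k < m) : ∃ r, ∀ W : ZMod m → Submodule F L, Good W →
    ∀ i, i ≠ 0 → ∀ x ∈ DD r W i, SG W (k + 1) i x := by
  induction k with
  | zero =>
    refine ⟨0, fun W _ i hi x hx => .gen _ _ ?_ hx⟩
    have : i.val ≠ 0 := by rwa [Ne, ZMod.val_eq_zero]
    omega
  | succ k ih =>
    obtain ⟨r, hr⟩ := ih (by omega)
    refine ⟨r + (1 + r), fun W hW i hi x hx => ?_⟩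
    have hx' : x ∈ DD r (D (DD r W)) i := by
      rw [DD, Function.iterate_add_apply, Function.iterate_add_apply] at hx
      exact hx
    have hN : Good (D (DD r W)) := D_good (DD_good hW r)
    refine SG_mono ?_ (hr _ hN i hi x hx')
    intro j hj y hy
    have hkv : ((k + 1 : ℕ) : ZMod m).val = k + 1 := ZMod.val_natCast_of_lt hk
    rcases hj.lt_or_eq with hj | hj
    · exact .gen _ _ hj ((D_le (DD_good hW r) _).trans (DD_le hW r _) hy)
    · have e : j = ((k + 1 : ℕ) : ZMod m) := ZMod.val_injective m (by rw [hkv, hj])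
      subst e
      have := step hW (k := ((k + 1 : ℕ) : ZMod m)) (DD r W) (DD_le hW r)
        (by rw [hkv]; exact hr W hW) y hy
      rwa [hkv] at this

lemma derived_le {W : ZMod m → Submodule F L} (hW : Good W) (htop : ⨆ i, W i = ⊤) (r : ℕ) :
    (LieAlgebra.derivedSeries F L r).toSubmodule ≤ ⨆ i, DD r W i := by
  induction r with
  | zero => exact htop ▸ le_top
  | succ r ih =>
    rw [LieAlgebra.derivedSeries_def, LieAlgebra.derivedSeriesOfIdeal_succ,
      LieSubmodule.lieIdeal_oper_eq_linear_span', Submodule.span_le]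
    rintro _ ⟨x, hx, y, hy, rfl⟩
    replace hx := ih hx
    replace hy := ih hy
    rw [DD, Function.iterate_succ_apply']
    show ⁅x, y⁆ ∈ ⨆ i, D (DD r W) i
    induction hx using Submodule.iSup_induction' with
    | zero => simp
    | add a b _ _ ha hb => rw [add_lie]; exact add_mem ha hb
    | mem i x hx =>
      induction hy using Submodule.iSup_induction' with
      | zero => simp
      | add a b _ _ ha hb => rw [lie_add]; exact add_mem ha hb
      | mem j y hy => exact Submodule.mem_iSup_of_mem _ (D_lie hx hy)

theorem solvable {W : ZMod m → Submodule F L} (hW : Good W) (htop : ⨆ i, W i = ⊤) :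
    LieAlgebra.IsSolvable L := by
  obtain ⟨r, hr⟩ := main (F := F) (L := L) (m := m) (m - 1) (by have := NeZero.pos m; omega)
  have hm : m - 1 + 1 = m := by have := NeZero.pos m; omega
  rw [hm] at hr
  have h1 : ∀ i, i ≠ 0 → DD r W i = ⊥ := fun i hi => by
    rw [eq_bot_iff]; intro x hx
    exact SG_top (hr W hW i hi x hx)
  have h2 : ∀ i, DD (r + 1) W i = ⊥ := by
    intro i
    rw [DD, Function.iterate_succ_apply', D, Submodule.span_eq_bot]
    rintro _ ⟨i, j, x, y, -, hx, hy, rfl⟩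
    by_cases i0 : i = 0
    · subst i0; exact (DD_good hW r).zero _ _ _ hx hy
    · have : x = 0 := by
        have : x ∈ DD r W i := hx
        rwa [h1 i i0] at this
      simp [this]
  rw [LieAlgebra.isSolvable_iff F]
  refine ⟨r + 1, ?_⟩
  have := derived_le hW htop (r + 1)
  rw [← LieSubmodule.toSubmodule_eq_bot, eq_bot_iff]
  simpa [h2] using this

end Krek

namespace E8L
set_option linter.unusedSectionVars false
set_option linter.unusedVariables false
open LieAlgebra

section sl2
variable {F L : Type*} [Field F] [CharZero F] [LieRing L] [LieAlgebra F L] {h e f : L}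

/-- iterate of `ad f` -/
def itl (f : L) (n : ℕ) (v : L) : L := (fun x => ⁅f, x⁆)^[n] v

lemma itl_zero (f v : L) : itl f 0 v = v := rfl
lemma itl_succ (f v : L) (n : ℕ) : itl f (n + 1) v = ⁅f, itl f n v⁆ := by
  rw [itl, Function.iterate_succ_apply']; rfl
lemma itl_succ' (f v : L) (n : ℕ) : itl f (n + 1) v = itl f n ⁅f, v⁆ := by
  rw [itl, Function.iterate_succ_apply]; rfl
lemma itl_eq (f v : L) (n : ℕ) : itl f n v = ((LieAlgebra.ad F L f) ^ n) v := by
  induction n with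
  | zero => rfl
  | succ n ih => rw [itl_succ, pow_succ', Module.End.mul_apply, ← ih]; rfl
lemma itl_smul (f v : L) (n : ℕ) (c : F) : itl f n (c • v) = c • itl f n v := by
  rw [itl_eq (F := F), itl_eq (F := F), map_smul]
lemma itl_sub (f v w : L) (n : ℕ) : itl f n (v - w) = itl f n v - itl f n w := by
  induction n with
  | zero => rfl
  | succ n ih => rw [itl_succ, itl_succ, itl_succ, ih, lie_sub]
lemma itl_null (f : L) (n : ℕ) : itl f n 0 = 0 := by
  induction n with
  | zero => rfl
  | succ n ih => rw [itl_succ, ih, lie_zero]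

lemma sl2_wt (t : IsSl2Triple h e f) {v : L} {k : F} (hv : ⁅h, v⁆ = k • v) (n : ℕ) :
    ⁅h, itl f n v⁆ = (k - 2 * n) • itl f n v := by
  induction n with
  | zero => simpa [itl_zero] using hv
  | succ n ih =>
    rw [itl_succ, leibniz_lie, ih, t.lie_lie_smul_f F, neg_lie, smul_lie, lie_smul, ← neg_smul,
      ← add_smul]
    congr 1; push_cast; ring

lemma sl2_comm (t : IsSl2Triple h e f) {v : L} {k : F} (hv : ⁅h, v⁆ = k • v) (n : ℕ) :
    ⁅e, itl f (n + 1) v⁆ = itl f (n + 1) ⁅e, v⁆ + ((n + 1) * (k - n) : F) • itl f n v := by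
  induction n with
  | zero =>
    rw [itl_succ, itl_zero, itl_succ, itl_zero, leibniz_lie, t.lie_e_f, hv]
    simp [add_comm]
  | succ n ih =>
    rw [itl_succ, leibniz_lie, ih, t.lie_e_f, lie_add, ← itl_succ, lie_smul, ← itl_succ,
      sl2_wt t hv, add_left_comm, ← add_smul]
    congr 2; push_cast; ring

lemma sl2_inj (t : IsSl2Triple h e f) (N : ℕ) {v : L} {k : ℕ} (hv : ⁅h, v⁆ = (k : F) • v)
    (he : itl e N v = 0) (hf : itl f k v = 0) : v = 0 := by
  induction N generalizing v k with
  | zero => exact he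
  | succ N ih =>
    have h0 : ⁅e, v⁆ = 0 := by
      refine ih (k := k + 2) ?_ (by rw [← itl_succ', he]) ?_
      · rw [leibniz_lie, hv, t.lie_h_e_smul F, smul_lie, lie_smul, ← add_smul]
        congr 1; push_cast; ring
      · have := sl2_comm t hv (k + 1)
        rw [itl_succ, itl_succ f v k, hf] at this
        simpa using this.symm
    have h1 : ∀ j, j ≤ k → itl f (k - j) v = 0 := by
      intro j
      induction j with
      | zero => intro _; exact hf
      | succ j ihj =>
        intro hj
        have e1 : k - j = k - (j + 1) + 1 := by omega
        have := sl2_comm t hv (k - (j + 1))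
        rw [← e1, ihj (by omega), h0, itl_null, lie_zero, zero_add] at this
        refine (smul_eq_zero.1 this.symm).resolve_left ?_
        have : (k : F) - ((k - (j + 1) : ℕ) : F) = ((j + 1 : ℕ) : F) := by
          rw [Nat.cast_sub hj]; ring
        rw [this]
        exact mul_ne_zero (Nat.cast_add_one_ne_zero _) (Nat.cast_ne_zero.2 (Nat.succ_ne_zero j))
    simpa [itl_zero] using h1 k le_rfl
end sl2

section wt
variable {F L : Type*} [Field F] [CharZero F] [LieRing L] [LieAlgebra F L]
  {H : LieSubalgebra F L} (b : LieAlgebra.Basis (Fin 8) H)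

/-- weight spaces -/
def wt (n : Fin 8 → ℤ) : Submodule F L where
  carrier := {x | ∀ j, ⁅b.h j, x⁆ = ((pr n j : ℤ) : F) • x}
  add_mem' := by intro x y hx hy j; rw [lie_add, hx j, hy j, smul_add]
  zero_mem' := by intro j; simp
  smul_mem' := by intro c x hx j; rw [lie_smul, hx j, smul_comm]

lemma mem_wt {n : Fin 8 → ℤ} {x : L} : x ∈ wt b n ↔ ∀ j, ⁅b.h j, x⁆ = ((pr n j : ℤ) : F) • x :=
  Iff.rfl

lemma wt_lie {n k : Fin 8 → ℤ} {x y : L} (hx : x ∈ wt b n) (hy : y ∈ wt b k) :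
    ⁅x, y⁆ ∈ wt b (n + k) := by
  intro j
  rw [leibniz_lie, hx j, hy j, smul_lie, lie_smul, ← add_smul, pr_add, Int.cast_add]

lemma pr_inj {n k : Fin 8 → ℤ} (h : ∀ i, pr n i = pr k i) : n = k := by
  rw [← sub_eq_zero]
  apply q_eq_zero
  rw [← bil_self, bil]
  exact Finset.sum_eq_zero fun i _ => by rw [pr_sub, h, sub_self, mul_zero]

lemma wt_indep : iSupIndep (wt b) := by
  have h1 := Module.End.independent_iInf_maxGenEigenspace_of_forall_mapsTo
    (fun j => (LieAlgebra.ad F L (b.h j) : Module.End F L)) (fun i j φ => by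
      apply Module.End.mapsTo_maxGenEigenspace_of_comm
      show Commute _ _
      refine LinearMap.ext fun x => ?_
      show ⁅b.h j, ⁅b.h i, x⁆⁆ = ⁅b.h i, ⁅b.h j, x⁆⁆
      rw [leibniz_lie, b.lie_h_h, zero_lie, zero_add])
  have h2 := h1.comp (f := fun n : Fin 8 → ℤ => fun j => ((pr n j : ℤ) : F)) (by
    intro n k e
    refine pr_inj fun i => ?_
    have := congrFun e i
    simpa using this)
  refine h2.mono ?_
  intro n x hx
  rw [Function.comp_apply, Submodule.mem_iInf]
  intro j
  refine Module.End.mem_maxGenEigenspace _ _ _ |>.2 ⟨1, ?_⟩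
  simp [hx j]

variable (hA : b.A = CartanMatrix.E₈)
include hA

lemma e_mem (i : Fin 8) : b.e i ∈ wt b (Pi.single i 1) := by
  intro j
  rw [b.lie_h_e, hA, pr_single, Int.cast_smul_eq_zsmul]
lemma f_mem (i : Fin 8) : b.f i ∈ wt b (-Pi.single i 1) := by
  intro j
  rw [b.lie_h_f, hA, pr_neg, pr_single, Int.cast_smul_eq_zsmul]

lemma wt_symm (n : Fin 8 → ℤ) : wt b.symm n = wt b (-n) := by
  ext x
  simp only [mem_wt, pr_neg]
  refine forall_congr' fun j => ?_
  show ⁅-b.h j, x⁆ = _ ↔ _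
  rw [neg_lie, neg_eq_iff_eq_neg, Int.cast_neg, neg_smul]


end wt
section wt2
variable {F L : Type*} [Field F] [CharZero F] [LieRing L] [LieAlgebra F L]
  {H : LieSubalgebra F L} (b : LieAlgebra.Basis (Fin 8) H)
/-- nonnegative with support of size at least two -/
def big (n : Fin 8 → ℤ) : Prop := 0 ≤ n ∧ ∃ i j, i ≠ j ∧ 0 < n i ∧ 0 < n j

lemma big_add {n k : Fin 8 → ℤ} (hn : big n) (hk : 0 ≤ k) : big (n + k) := by
  obtain ⟨h0, i, j, hij, hi, hj⟩ := hn
  refine ⟨add_nonneg h0 hk, i, j, hij, ?_, ?_⟩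
  · have := hk i; simp at this ⊢; omega
  · have := hk j; simp at this ⊢; omega

lemma single_nonneg (i : Fin 8) : (0 : Fin 8 → ℤ) ≤ Pi.single i 1 := by
  intro j; by_cases h : j = i
  · subst h; simp
  · simp [h]

lemma big_single {i j : Fin 8} (h : i ≠ j) : big (Pi.single i 1 + Pi.single j 1) := by
  refine ⟨add_nonneg (single_nonneg i) (single_nonneg j), i, j, h, ?_, ?_⟩
  · simp [h]
  · simp [h.symm]

/-- upper part -/
def up : Submodule F L := Submodule.span F (Set.range b.e) ⊔ ⨆ n : {n // big n}, wt b n.1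

lemma wt_le_up {n : Fin 8 → ℤ} (hn : big n) : wt b n ≤ up b :=
  le_trans (le_iSup (fun n : {n // big n} => wt b n.1) ⟨n, hn⟩) le_sup_right

lemma e_mem_up (i : Fin 8) : b.e i ∈ up b :=
  Submodule.mem_sup_left (Submodule.subset_span ⟨i, rfl⟩)

lemma up_induction {p : L → Prop} (he : ∀ i, p (b.e i)) (hw : ∀ n, big n → ∀ x ∈ wt b n, p x)
    (h0 : p 0) (ha : ∀ x y, p x → p y → p (x + y)) (hs : ∀ (c : F) x, p x → p (c • x))
    {x : L} (hx : x ∈ up b) : p x := by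
  obtain ⟨y, hy, z, hz, rfl⟩ := Submodule.mem_sup.1 hx
  clear hx
  refine ha _ _ ?_ ?_
  · induction hy using Submodule.span_induction with
    | mem _ h => obtain ⟨i, rfl⟩ := h; exact he i
    | zero => exact h0
    | add x y _ _ hx hy => exact ha _ _ hx hy
    | smul c x _ hx => exact hs _ _ hx
  · induction hz using Submodule.iSup_induction' with
    | mem i x hx => exact hw _ i.2 _ hx
    | zero => exact h0
    | add x y _ _ hx hy => exact ha _ _ hx hy

lemma up_lie (hA : b.A = CartanMatrix.E₈) {x y : L} (hx : x ∈ up b) (hy : y ∈ up b) :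
    ⁅x, y⁆ ∈ up b := by
  refine up_induction b (p := fun x => ⁅x, y⁆ ∈ up b) ?_ ?_ ?_ ?_ ?_ hx
  · intro i
    refine up_induction b (p := fun y => ⁅b.e i, y⁆ ∈ up b) ?_ ?_ ?_ ?_ ?_ hy
    · intro j
      by_cases hij : i = j
      · subst hij; simp
      · exact wt_le_up b (big_single hij) (wt_lie b (e_mem b hA i) (e_mem b hA j))
    · intro n hn y hy
      have := wt_lie b (e_mem b hA i) hy
      rw [add_comm] at this
      exact wt_le_up b (big_add hn (single_nonneg i)) this
    · simp
    · intro x y hx hy; rw [lie_add]; exact add_mem hx hy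
    · intro c x hx; rw [lie_smul]; exact Submodule.smul_mem _ _ hx
  · intro n hn x hx
    refine up_induction b (p := fun y => ⁅x, y⁆ ∈ up b) ?_ ?_ ?_ ?_ ?_ hy
    · intro i
      exact wt_le_up b (big_add hn (single_nonneg i)) (wt_lie b hx (e_mem b hA i))
    · intro k hk y hy
      exact wt_le_up b (big_add hn hk.1) (wt_lie b hx hy)
    · simp
    · intro x y hx hy; rw [lie_add]; exact add_mem hx hy
    · intro c x hx; rw [lie_smul]; exact Submodule.smul_mem _ _ hx
  · simp
  · intro x y hx hy; rw [add_lie]; exact add_mem hx hy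
  · intro c x hx; rw [smul_lie]; exact Submodule.smul_mem _ _ hx

lemma borel_le (hA : b.A = CartanMatrix.E₈) {x : L}
    (hx : x ∈ LieSubalgebra.lieSpan F L (Set.range b.e)) : x ∈ up b := by
  induction hx using LieSubalgebra.lieSpan_induction with
  | mem _ h => obtain ⟨i, rfl⟩ := h; exact e_mem_up b i
  | zero => exact zero_mem _
  | add _ _ _ _ hx hy => exact add_mem hx hy
  | smul c _ _ hx => exact Submodule.smul_mem _ _ hx
  | lie _ _ _ _ hx hy => exact up_lie b hA hx hy

open Classical in
/-- candidate for the weight spaces -/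
noncomputable def V (n : Fin 8 → ℤ) : Submodule F L :=
  (if n = 0 then H.toSubmodule else ⊥) ⊔ Submodule.span F {x | ∃ i, n = Pi.single i 1 ∧ x = b.e i}
  ⊔ Submodule.span F {x | ∃ i, n = -Pi.single i 1 ∧ x = b.f i} ⊔
  (if big n ∨ big (-n) then wt b n else ⊥)

lemma H_le : H.toSubmodule ≤ wt b 0 := by
  rw [b.coe_cartan_eq_span, Submodule.span_le]
  rintro _ ⟨i, rfl⟩ j
  rw [b.lie_h_h, pr_zero]; simp

lemma V_le (hA : b.A = CartanMatrix.E₈) (n : Fin 8 → ℤ) : V b n ≤ wt b n := by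
  unfold V
  refine sup_le (sup_le (sup_le ?_ ?_) ?_) ?_
  · split_ifs with h
    · subst h; exact H_le b
    · exact bot_le
  · rw [Submodule.span_le]
    rintro _ ⟨i, rfl, rfl⟩
    exact e_mem b hA i
  · rw [Submodule.span_le]
    rintro _ ⟨i, rfl, rfl⟩
    exact f_mem b hA i
  · split_ifs with h
    · exact le_rfl
    · exact bot_le

lemma up_le_V : up b ≤ ⨆ n, V b n := by
  refine sup_le ?_ (iSup_le ?_)
  · rw [Submodule.span_le]
    rintro _ ⟨i, rfl⟩
    refine Submodule.mem_iSup_of_mem (Pi.single i 1) ?_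
    exact Submodule.mem_sup_left (Submodule.mem_sup_left (Submodule.mem_sup_right
      (Submodule.subset_span ⟨i, rfl, rfl⟩)))
  · rintro ⟨n, hn⟩
    refine le_trans ?_ (le_iSup _ n)
    unfold V
    rw [if_pos (Or.inl hn)]
    exact le_sup_right

lemma up_symm_le_V (hA : b.A = CartanMatrix.E₈) : up b.symm ≤ ⨆ n, V b n := by
  refine sup_le ?_ (iSup_le ?_)
  · rw [Submodule.span_le]
    rintro _ ⟨i, rfl⟩
    refine Submodule.mem_iSup_of_mem (-Pi.single i 1) ?_
    exact Submodule.mem_sup_left (Submodule.mem_sup_right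
      (Submodule.subset_span ⟨i, rfl, rfl⟩))
  · rintro ⟨n, hn⟩
    refine le_trans ?_ (le_iSup _ (-n))
    unfold V
    rw [wt_symm b hA, if_pos (Or.inr (by rwa [neg_neg]))]
    exact le_sup_right

lemma iSup_V (hA : b.A = CartanMatrix.E₈) : ⨆ n, V b n = ⊤ := by
  have h := b.iSup_cartan_borelLower_borelUpper_eq_top
  have h' : H.toLieSubmodule ⊔ b.borelLower ⊔ b.borelUpper = ⊤ := by simpa [iSup_fin_three] using h
  rw [eq_top_iff]
  intro x _
  have hx : x ∈ H.toLieSubmodule ⊔ b.borelLower ⊔ b.borelUpper := by rw [h']; trivial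
  obtain ⟨y, hy, z, hz, rfl⟩ := (LieSubmodule.mem_sup _ _ _).1 hx
  obtain ⟨u, hu, w, hw, rfl⟩ := (LieSubmodule.mem_sup _ _ _).1 hy
  refine add_mem (add_mem ?_ ?_) ?_
  · refine Submodule.mem_iSup_of_mem 0 ?_
    refine Submodule.mem_sup_left (Submodule.mem_sup_left (Submodule.mem_sup_left ?_))
    rw [if_pos rfl]
    exact hu
  · exact up_symm_le_V b hA (borel_le b.symm hA hw)
  · exact up_le_V b (borel_le b hA hz)

lemma V_eq (hA : b.A = CartanMatrix.E₈) (n : Fin 8 → ℤ) : wt b n = V b n :=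
  (congrFun (((wt_indep b).le_iff_eq_of_iSup_eq_top (iSup_V b hA)).1 (V_le b hA)) n).symm

lemma iSup_wt (hA : b.A = CartanMatrix.E₈) : ⨆ n, wt b n = ⊤ := by
  simp_rw [V_eq b hA, iSup_V b hA]

lemma wt_zero (hA : b.A = CartanMatrix.E₈) : wt b 0 = H.toSubmodule := by
  rw [V_eq b hA]
  have h1 : ¬ big 0 := fun h => by obtain ⟨_, i, _, _, h, _⟩ := h; simp at h
  have h2 : ∀ i : Fin 8, (0 : Fin 8 → ℤ) ≠ Pi.single i 1 := fun i h => by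
    have := congrFun h i; simp at this
  have h3 : ∀ i : Fin 8, (0 : Fin 8 → ℤ) ≠ -Pi.single i 1 := fun i h => by
    have := congrFun h i; simp at this
  simp [V, h1, h2, h3]

/-- a nonzero weight is big up to sign, or simple up to sign -/
lemma wt_cases (hA : b.A = CartanMatrix.E₈) {n : Fin 8 → ℤ} (hn : n ≠ 0) (h : wt b n ≠ ⊥) :
    big n ∨ big (-n) ∨ ∃ i, n = Pi.single i 1 ∨ n = -Pi.single i 1 := by
  by_contra! hc
  apply h
  rw [V_eq b hA]
  simp [V, hc.1, hc.2.1, hn, fun i => (hc.2.2 i).1, fun i => (hc.2.2 i).2]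

lemma wt_single (hA : b.A = CartanMatrix.E₈) (i : Fin 8) :
    wt b (Pi.single i 1) = Submodule.span F {b.e i} := by
  rw [V_eq b hA]
  have h1 : ¬ big (Pi.single i 1) := fun h => by
    obtain ⟨_, j, k, hjk, hj, hk⟩ := h
    have e1 : j = i := by by_contra h; simp [h] at hj
    have e2 : k = i := by by_contra h; simp [h] at hk
    exact hjk (e1.trans e2.symm)
  have h2 : ¬ big (-Pi.single i 1) := fun h => by
    have := h.1 i; simp at this
  have h0 : (Pi.single i 1 : Fin 8 → ℤ) ≠ 0 := by simp
  have h3 : ∀ j : Fin 8, (Pi.single i 1 : Fin 8 → ℤ) ≠ -Pi.single j 1 := fun j h => by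
    have h' := congrFun h i
    have := single_nonneg j i
    simp at h' this; omega
  have h4 : {x | ∃ j, (Pi.single i 1 : Fin 8 → ℤ) = Pi.single j 1 ∧ x = b.e j} = {b.e i} := by
    ext x
    constructor
    · rintro ⟨j, hj, rfl⟩
      have : i = j := by
        by_contra hij
        have := congrFun hj i
        simp [hij] at this
      rw [this]; rfl
    · rintro rfl; exact ⟨i, rfl, rfl⟩
  rw [V, h4]
  simp [h1, h2, h3]
end wt2
end E8L

namespace E8L
set_option linter.unusedSectionVars false
set_option linter.unusedVariables false
open LieAlgebra

section wt3
variable {F L : Type*} [Field F] [CharZero F] [LieRing L] [LieAlgebra F L]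
  {H : LieSubalgebra F L} (b : LieAlgebra.Basis (Fin 8) H)

lemma itl_wt {n k : Fin 8 → ℤ} {x v : L} (hx : x ∈ wt b k) (hv : v ∈ wt b n) (N : ℕ) :
    itl x N v ∈ wt b (n + (N : ℤ) • k) := by
  induction N with
  | zero => simpa [itl_zero] using hv
  | succ N ih =>
    rw [itl_succ]
    have := wt_lie b hx ih
    convert this using 2
    push_cast; rw [add_smul, one_smul]; abel

lemma itl_ideal (N : LieIdeal F L) {u : L} (hu : u ∈ N) (x : L) (k : ℕ) : itl x k u ∈ N := by
  induction k with
  | zero => exact hu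
  | succ k ih => rw [itl_succ]; exact lie_mem_right F L N _ _ ih

lemma ne_bot {p : Submodule F L} : p ≠ ⊥ ↔ ∃ x ∈ p, x ≠ 0 := Submodule.ne_bot_iff p

lemma q_refl_single (n : Fin 8 → ℤ) (i : Fin 8) : q (n - pr n i • Pi.single i 1) = q n := by
  have := q_reflect (k := n) (q_single i)
  rwa [bil_single] at this

lemma sum_refl (n : Fin 8 → ℤ) (i : Fin 8) (c : ℤ) :
    ∑ j, (n - c • (Pi.single i 1 : Fin 8 → ℤ)) j = ∑ j, n j - c := by
  simp [Finset.sum_sub_distrib, Pi.single_apply]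

variable (hA : b.A = CartanMatrix.E₈)
  (hE : ∀ i x, ∃ N, itl (b.e i) N x = 0)
include hA hE

/-- structure of positive weight spaces -/
lemma wt_pos (s : ℕ) : ∀ n : Fin 8 → ℤ, 0 ≤ n → n ≠ 0 → ∑ i, n i ≤ (s : ℤ) → wt b n ≠ ⊥ →
    q n = 2 ∧ (∀ u ∈ wt b n, ∀ v ∈ wt b n, u ≠ 0 → ∃ c : F, v = c • u) ∧
    ∀ N : LieIdeal F L, ∀ u ∈ wt b n, u ≠ 0 → u ∈ N → ∃ i, b.e i ∈ N := by
  induction s with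
  | zero =>
    intro n h0 hn hs
    exact absurd ((Finset.sum_eq_zero_iff_of_nonneg (fun i _ => h0 i)).1
      (le_antisymm (by simpa using hs) (Finset.sum_nonneg fun i _ => h0 i)))
      (fun h => hn (funext fun i => h i (Finset.mem_univ i)))
  | succ s ih =>
    intro n h0 hn hs hw
    rcases wt_cases b hA hn hw with hb | hb | ⟨i, hi | hi⟩
    · obtain ⟨i, hi, hp⟩ := exists_pr_pos hn h0
      obtain ⟨k, hk⟩ : ∃ k : ℕ, pr n i = k := ⟨(pr n i).toNat, by omega⟩
      set n' := n - pr n i • (Pi.single i 1 : Fin 8 → ℤ) with hn'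
      have hmap : ∀ v ∈ wt b n, itl (b.f i) k v ∈ wt b n' := fun v hv => by
        have := itl_wt b (f_mem b hA i) hv k
        rwa [smul_neg, ← sub_eq_add_neg, ← hk] at this
      have hinj : ∀ v ∈ wt b n, itl (b.f i) k v = 0 → v = 0 := fun v hv h => by
        obtain ⟨N, hN⟩ := hE i v
        refine sl2_inj (F := F) (b.sl2 i) N ?_ hN h
        rw [hv i, hk, Int.cast_natCast]
      obtain ⟨j, hji, hj⟩ : ∃ j, j ≠ i ∧ 0 < n j := by
        obtain ⟨_, j, l, hjl, hj, hl⟩ := hb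
        by_cases h : j = i
        · exact ⟨l, fun h' => hjl (h.trans h'.symm), hl⟩
        · exact ⟨j, h, hj⟩
      have hj' : n' j = n j := by simp [hn', hji]
      have hn'0 : n' ≠ 0 := fun h => by rw [h] at hj'; simp at hj'; omega
      have hw' : wt b n' ≠ ⊥ := by
        obtain ⟨v, hv, hv0⟩ := ne_bot.1 hw
        exact ne_bot.2 ⟨_, hmap v hv, fun h => hv0 (hinj v hv h)⟩
      have hpos : 0 ≤ n' := by
        rcases wt_cases b hA hn'0 hw' with h | h | ⟨l, h | h⟩
        · exact h.1
        · have := h.1 j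
          simp only [Pi.zero_apply, Pi.neg_apply] at this
          omega
        · rw [h]; exact single_nonneg l
        · have h1 := congrFun h j
          have := single_nonneg l j
          simp only [Pi.zero_apply, Pi.neg_apply] at this h1
          omega
      obtain ⟨h1, h2, h3⟩ := ih n' hpos hn'0 (by
        rw [hn', sum_refl]; push_cast at hs; omega) hw'
      refine ⟨by rw [← h1, hn', q_refl_single], ?_, fun N u hu hu0 huN =>
        h3 N _ (hmap u hu) (fun h => hu0 (hinj u hu h)) (itl_ideal N huN _ k)⟩
      intro u hu v hv hu0
      obtain ⟨c, hc⟩ := h2 _ (hmap u hu) _ (hmap v hv) (fun h => hu0 (hinj u hu h))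
      refine ⟨c, ?_⟩
      rw [← sub_eq_zero]
      refine hinj _ (sub_mem hv (Submodule.smul_mem _ _ hu)) ?_
      rw [itl_sub, itl_smul, hc, sub_self]
    · obtain ⟨h, i, j, _, hi, _⟩ := hb
      have := h0 i
      simp only [Pi.zero_apply, Pi.neg_apply] at this hi
      omega
    · subst hi
      refine ⟨q_single i, ?_, ?_⟩
      swap
      · rw [wt_single b hA]
        intro N u hu hu0 huN
        obtain ⟨a, rfl⟩ := Submodule.mem_span_singleton.1 hu
        have ha : a ≠ 0 := fun h => hu0 (by rw [h, zero_smul])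
        refine ⟨i, ?_⟩
        have := N.smul_mem a⁻¹ huN
        rwa [smul_smul, inv_mul_cancel₀ ha, one_smul] at this
      rw [wt_single b hA]
      intro u hu v hv hu0
      obtain ⟨a, rfl⟩ := Submodule.mem_span_singleton.1 hu
      obtain ⟨d, rfl⟩ := Submodule.mem_span_singleton.1 hv
      have ha : a ≠ 0 := fun h => hu0 (by rw [h, zero_smul])
      exact ⟨d / a, by rw [smul_smul, div_mul_cancel₀ _ ha]⟩
    · have := h0 i
      rw [hi] at this
      simp at this

omit hE in
lemma wt_ne_bot_pos (hFl : ∀ i x, ∃ N, itl (b.f i) N x = 0) (s : ℕ) : ∀ n : Fin 8 → ℤ, 0 ≤ n →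
    ∑ i, n i ≤ (s : ℤ) → q n = 2 → wt b n ≠ ⊥ := by
  induction s with
  | zero =>
    intro n h0 hs hq
    exact absurd ((Finset.sum_eq_zero_iff_of_nonneg (fun i _ => h0 i)).1
      (le_antisymm (by simpa using hs) (Finset.sum_nonneg fun i _ => h0 i)))
      (fun h => root_ne_zero hq (funext fun i => h i (Finset.mem_univ i)))
  | succ s ih =>
    intro n h0 hs hq
    have hn := root_ne_zero hq
    obtain ⟨i, hi, hp⟩ := exists_pr_pos hn h0
    obtain ⟨k, hk⟩ : ∃ k : ℕ, pr n i = k := ⟨(pr n i).toNat, by omega⟩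
    by_cases hex : ∃ j, j ≠ i ∧ 0 < n j
    · obtain ⟨j, hji, hj⟩ := hex
      set n' := n - pr n i • (Pi.single i 1 : Fin 8 → ℤ) with hn'
      have hj' : n' j = n j := by simp [hn', hji]
      have hq' : q n' = 2 := by rw [hn', q_refl_single, hq]
      have hpos : 0 ≤ n' := by
        rcases root_sign hq' with h | h
        · exact h
        · have := h j
          simp only [Pi.zero_apply] at this
          omega
      obtain ⟨v, hv, hv0⟩ := ne_bot.1 (ih n' hpos (by
        rw [hn', sum_refl]; push_cast at hs; omega) hq')
      refine ne_bot.2 ⟨itl (b.e i) k v, ?_, fun h => hv0 ?_⟩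
      · have := itl_wt b (e_mem b hA i) hv k
        rwa [hn', ← hk, sub_add_cancel] at this
      · obtain ⟨N, hN⟩ := hFl i v
        refine sl2_inj (F := F) (b.sl2 i).symm N ?_ hN h
        rw [neg_lie, hv i, hn', pr_sub, pr_smul, pr_single, E_diag, hk, ← neg_smul]
        congr 1; push_cast; ring
    · push Not at hex
      have : n = n i • (Pi.single i 1 : Fin 8 → ℤ) := by
        funext j
        by_cases h : j = i
        · subst h; simp
        · have h1 := hex j h
          have h2 := h0 j
          simp only [Pi.zero_apply] at h2
          simp [h]; omega
      have h2 : q n = 2 * (n i) ^ 2 := by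
        rw [this]
        have := q_add_smul 0 (Pi.single i 1) (n i)
        rw [q_zero, q_single, zero_add] at this
        rw [this]
        simp [bil, pr_zero]; ring
      have h3 : n i = 1 := by nlinarith
      rw [this, h3, one_smul, wt_single b hA]
      exact ne_bot.2 ⟨_, Submodule.mem_span_singleton_self _, (b.sl2 i).e_ne_zero⟩

variable (hFl : ∀ i x, ∃ N, itl (b.f i) N x = 0)
include hFl

lemma wt_root {n : Fin 8 → ℤ} (hn : n ≠ 0) (hw : wt b n ≠ ⊥) :
    q n = 2 ∧ (∀ u ∈ wt b n, ∀ v ∈ wt b n, u ≠ 0 → ∃ c : F, v = c • u) ∧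
    ∀ N : LieIdeal F L, ∀ u ∈ wt b n, u ≠ 0 → u ∈ N → ∃ i, b.e i ∈ N ∨ b.f i ∈ N := by
  have key : 0 ≤ n ∨ 0 ≤ -n := by
    rcases wt_cases b hA hn hw with h | h | ⟨i, rfl | rfl⟩
    · exact Or.inl h.1
    · exact Or.inr h.1
    · exact Or.inl (single_nonneg i)
    · right; rw [neg_neg]; exact single_nonneg i
  rcases key with h | h
  · obtain ⟨h1, h2, h3⟩ := wt_pos b hA hE (∑ i, n i).toNat n h hn (Int.self_le_toNat _) hw
    exact ⟨h1, h2, fun N u hu hu0 hN => (h3 N u hu hu0 hN).imp fun _ => Or.inl⟩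
  · have e : wt b n = wt b.symm (-n) := by rw [wt_symm b hA, neg_neg]
    rw [e] at hw ⊢
    obtain ⟨h1, h2, h3⟩ := wt_pos b.symm hA hFl (∑ i, (-n) i).toNat (-n) h (by simpa using hn)
      (Int.self_le_toNat _) hw
    rw [q_neg] at h1
    exact ⟨h1, h2, fun N u hu hu0 hN => (h3 N u hu hu0 hN).imp fun _ => Or.inr⟩

lemma wt_ne_bot {n : Fin 8 → ℤ} (hq : q n = 2) : wt b n ≠ ⊥ := by
  rcases root_sign hq with h | h
  · exact wt_ne_bot_pos b hA hFl (∑ i, n i).toNat n h (Int.self_le_toNat _) hq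
  · have e : wt b n = wt b.symm (-n) := by rw [wt_symm b hA, neg_neg]
    rw [e]
    exact wt_ne_bot_pos b.symm hA hE (∑ i, (-n) i).toNat (-n) (by simpa using h)
      (Int.self_le_toNat _) (by rw [q_neg, hq])
end wt3
end E8L

namespace E8L
set_option linter.unusedSectionVars false
set_option linter.unusedVariables false
open LieAlgebra

section serre
variable {F L : Type*} [Field F] [CharZero F] [LieRing L] [LieAlgebra F L]

/-- Serre generators of type E8 -/
structure Serre (F : Type*) {L : Type*} [Field F] [LieRing L] [LieAlgebra F L]
    (h e f : Fin 8 → L) : Prop where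
  hh : ∀ i j, ⁅h i, h j⁆ = 0
  ef : ∀ i, ⁅e i, f i⁆ = h i
  efne : ∀ i j, i ≠ j → ⁅e i, f j⁆ = 0
  he : ∀ i j, ⁅h i, e j⁆ = CartanMatrix.E₈ i j • e j
  hf : ∀ i j, ⁅h i, f j⁆ = -(CartanMatrix.E₈ i j • f j)
  adE : ∀ i j, itl (e i) (-CartanMatrix.E₈ i j).toNat ⁅e i, e j⁆ = 0
  adF : ∀ i j, itl (f i) (-CartanMatrix.E₈ i j).toNat ⁅f i, f j⁆ = 0
  gen : ∀ S : LieSubalgebra F L, (∀ i, h i ∈ S) → (∀ i, e i ∈ S) → (∀ i, f i ∈ S) → S = ⊤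

variable {h e f : Fin 8 → L} (S : Serre F h e f)
include S

lemma Serre.symm : Serre F (-h) f e where
  hh i j := by simp [S.hh]
  ef i := by rw [← lie_skew, S.ef]; rfl
  efne i j hij := by rw [← lie_skew, S.efne _ _ hij.symm, neg_zero]
  he i j := by rw [Pi.neg_apply, neg_lie, S.hf, neg_neg]
  hf i j := by rw [Pi.neg_apply, neg_lie, S.he]
  adE := S.adF
  adF := S.adE
  gen T h1 h2 h3 := S.gen T (fun i => by simpa using h1 i) h3 h2

lemma Serre.step {i j : Fin 8} (hij : CartanMatrix.E₈ i j ≠ 0) (h0 : h i = 0) : h j = 0 := by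
  have h1 := S.he i j
  rw [h0, zero_lie, ← Int.cast_smul_eq_zsmul F] at h1
  have h2 := (smul_eq_zero.1 h1.symm).resolve_left (Int.cast_ne_zero.2 hij)
  rw [← S.ef, h2, zero_lie]

lemma Serre.h_ne [Nontrivial L] (i : Fin 8) : h i ≠ 0 := by
  intro h0
  have a1 := S.step (i := 0) (j := 2) (by decide)
  have a2 := S.step (i := 2) (j := 0) (by decide)
  have a3 := S.step (i := 2) (j := 3) (by decide)
  have a4 := S.step (i := 3) (j := 2) (by decide)
  have a5 := S.step (i := 1) (j := 3) (by decide)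
  have a6 := S.step (i := 3) (j := 1) (by decide)
  have a7 := S.step (i := 3) (j := 4) (by decide)
  have a8 := S.step (i := 4) (j := 3) (by decide)
  have a9 := S.step (i := 4) (j := 5) (by decide)
  have b1 := S.step (i := 5) (j := 4) (by decide)
  have b2 := S.step (i := 5) (j := 6) (by decide)
  have b3 := S.step (i := 6) (j := 5) (by decide)
  have b4 := S.step (i := 6) (j := 7) (by decide)
  have b5 := S.step (i := 7) (j := 6) (by decide)
  have h3 : h 3 = 0 := by
    exact (forall8 (P := fun i => h i = 0 → h 3 = 0)).2 ⟨fun x => a3 (a1 x), a5, a3, id, a8,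
      fun x => a8 (b1 x), fun x => a8 (b1 (b3 x)), fun x => a8 (b1 (b3 (b5 x)))⟩ i h0
  have hall : ∀ i, h i = 0 := by
    exact (forall8 (P := fun i => h i = 0)).2 ⟨a2 (a4 h3), a6 h3, a4 h3, h3, a7 h3,
      a9 (a7 h3), b2 (a9 (a7 h3)), b4 (b2 (a9 (a7 h3)))⟩
  have e0 : ∀ i, e i = 0 := fun i => by
    have h1 := S.he i i
    rw [hall, zero_lie, ← Int.cast_smul_eq_zsmul F, E_diag] at h1
    exact (smul_eq_zero.1 h1.symm).resolve_left (by norm_num)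
  have f0 : ∀ i, f i = 0 := fun i => by
    have h1 := S.hf i i
    rw [hall, zero_lie, ← Int.cast_smul_eq_zsmul F, E_diag, eq_comm, neg_eq_zero] at h1
    exact (smul_eq_zero.1 h1).resolve_left (by norm_num)
  have := S.gen ⊥ (fun i => by rw [hall]; exact zero_mem _) (fun i => by rw [e0]; exact zero_mem _)
    (fun i => by rw [f0]; exact zero_mem _)
  obtain ⟨x, hx⟩ := exists_ne (0 : L)
  have hx' : x ∈ (⊥ : LieSubalgebra F L) := by rw [this]; trivial
  exact hx ((LieSubalgebra.mem_bot x).1 hx')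

lemma Serre.sl2 [Nontrivial L] (i : Fin 8) : IsSl2Triple (h i) (e i) (f i) where
  h_ne_zero := S.h_ne i
  lie_e_f := S.ef i
  lie_h_e_nsmul := by rw [S.he, E_diag]; exact ofNat_zsmul _ 2
  lie_h_f_nsmul := by rw [S.hf, E_diag]; congr 1; exact ofNat_zsmul _ 2

lemma E_det : (CartanMatrix.E₈.map (Int.cast : ℤ → F)).det ≠ 0 := by
  have : (CartanMatrix.E₈.map (Int.cast : ℤ → F)).det = ((CartanMatrix.E₈.det : ℤ) : F) :=
    (RingHom.map_det (Int.castRingHom F) CartanMatrix.E₈).symm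
  rw [this, CartanMatrix.E₈_det]; simp

omit S in
lemma sum_lie' {ι : Type*} (s : Finset ι) (x : ι → L) (y : L) : ⁅∑ i ∈ s, x i, y⁆ = ∑ i ∈ s, ⁅x i, y⁆ := by
  classical
  induction s using Finset.induction_on with
  | empty => simp
  | insert a s ha ih => rw [Finset.sum_insert ha, Finset.sum_insert ha, add_lie, ih]

lemma Serre.faithful [Nontrivial L] (c : Fin 8 → F) (hc : ∀ j, ⁅∑ i, c i • h i, e j⁆ = 0) : c = 0 := by
  refine Matrix.eq_zero_of_vecMul_eq_zero (E_det S) ?_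
  funext j
  have h1 := hc j
  have : ∀ i, ⁅c i • h i, e j⁆ = (c i * (CartanMatrix.E₈ i j : F)) • e j := fun i => by
    rw [smul_lie, S.he, ← Int.cast_smul_eq_zsmul F, smul_smul]
  rw [sum_lie', Finset.sum_congr rfl (fun i _ => this i), ← Finset.sum_smul] at h1
  have := (smul_eq_zero.1 h1).resolve_right (S.sl2 j).e_ne_zero
  simpa [Matrix.vecMul, dotProduct] using this

lemma Serre.nil (i : Fin 8) (x : L) : ∃ N, itl (e i) N x = 0 := by
  have hh : ∀ j, itl (e i) 2 (h j) = 0 := fun j => by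
    rw [itl_succ', itl_succ', itl_zero, ← lie_skew (e i) (h j), S.he]
    simp
  have : LieSubalgebra.engel F (e i) = ⊤ := by
    refine S.gen _ ?_ ?_ ?_
    · intro j
      rw [LieSubalgebra.mem_engel_iff]
      exact ⟨2, by rw [← itl_eq, hh]⟩
    · intro j
      rw [LieSubalgebra.mem_engel_iff]
      exact ⟨_, by rw [← itl_eq, itl_succ', S.adE]⟩
    · intro j
      rw [LieSubalgebra.mem_engel_iff]
      by_cases hij : i = j
      · subst hij
        exact ⟨3, by rw [← itl_eq, itl_succ', S.ef, hh]⟩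
      · exact ⟨1, by rw [← itl_eq, itl_succ', S.efne _ _ hij]; rfl⟩
  have hx : x ∈ LieSubalgebra.engel F (e i) := by rw [this]; trivial
  obtain ⟨N, hN⟩ := (LieSubalgebra.mem_engel_iff F _ _).1 hx
  exact ⟨N, by rw [itl_eq (F := F), hN]⟩

/-- the Lie basis -/
def Serre.basis [Nontrivial L] :
    LieAlgebra.Basis (Fin 8) (LieSubalgebra.lieSpan F L (Set.range h)) where
  A := CartanMatrix.E₈
  h := h
  e := e
  f := f
  cartan_eq_lieSpan := rfl
  span_ef := by
    have he' : ∀ i, e i ∈ LieSubalgebra.lieSpan F L (Set.range e ∪ Set.range f) := fun i =>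
      LieSubalgebra.subset_lieSpan (Or.inl ⟨i, rfl⟩)
    have hf' : ∀ i, f i ∈ LieSubalgebra.lieSpan F L (Set.range e ∪ Set.range f) := fun i =>
      LieSubalgebra.subset_lieSpan (Or.inr ⟨i, rfl⟩)
    refine S.gen _ (fun i => ?_) he' hf'
    rw [← S.ef]
    exact LieSubalgebra.lie_mem _ (he' i) (hf' i)
  linInd := by
    rw [Fintype.linearIndependent_iff]
    intro c hc
    exact congrFun (S.faithful c fun j => by rw [hc, zero_lie])
  nondegen := by
    apply Matrix.nondegenerate_iff_det_ne_zero.2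
    rw [CartanMatrix.E₈_det]; simp
  sl2 := S.sl2
  lie_h_h := S.hh
  lie_h_e i j := by rw [S.he, E_symm]
  lie_h_f i j := by rw [S.hf, E_symm, neg_smul]
  lie_e_f_ne := S.efne

end serre

section e8
variable (F : Type*) [Field F] [CharZero F]

open CartanMatrix in
lemma exists_quot : ∃ p : FreeLieAlgebra F (Generators (Fin 8)) →ₗ⁅F⁆ LieAlgebra.e₈ F,
    Function.Surjective p ∧ ∀ x ∈ Relations.toSet F CartanMatrix.E₈, p x = 0 := by
  let I := CartanMatrix.Relations.toIdeal F CartanMatrix.E₈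
  let p : FreeLieAlgebra F (Generators (Fin 8)) →ₗ⁅F⁆ (FreeLieAlgebra F (Generators (Fin 8)) ⧸ I) :=
    { (LieSubmodule.Quotient.mk' I : _ →ₗ[F] _) with
      map_lie' := fun {x y} => LieSubmodule.Quotient.mk_bracket I x y }
  have hp : Function.Surjective p := LieSubmodule.Quotient.surjective_mk' I
  have hk : ∀ x ∈ Relations.toSet F CartanMatrix.E₈, p x = 0 := fun x hx =>
    (LieSubmodule.Quotient.mk_eq_zero _).2 (LieSubmodule.subset_lieSpan hx)
  exact ⟨p, hp, hk⟩

open CartanMatrix in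
lemma serre_e8 : ∃ h e f : Fin 8 → LieAlgebra.e₈ F, Serre F h e f := by
  obtain ⟨p, hp, hk⟩ := exists_quot F
  have hitl : ∀ x y N, p (itl x N y) = itl (p x) N (p y) := by
    intro x y N
    induction N with
    | zero => rfl
    | succ N ih => rw [itl_succ, itl_succ, p.map_lie, ih]
  refine ⟨fun i => p (.of F (.H i)), fun i => p (.of F (.E i)), fun i => p (.of F (.F i)), ?_⟩
  refine ⟨?_, ?_, ?_, ?_, ?_, ?_, ?_, ?_⟩
  · intro i j
    rw [← p.map_lie]
    exact hk _ (by simp only [Relations.toSet, Set.mem_union]; left; left; left; left; left; exact ⟨(i, j), rfl⟩)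
  · intro i
    have := hk (Relations.EF F (i, i)) (by simp only [Relations.toSet, Set.mem_union]; left; left; left; left; right; exact ⟨(i, i), rfl⟩)
    simp only [Relations.EF, Function.uncurry, if_true, map_sub, sub_eq_zero, p.map_lie] at this
    exact this
  · intro i j hij
    have := hk (Relations.EF F (i, j)) (by simp only [Relations.toSet, Set.mem_union]; left; left; left; left; right; exact ⟨(i, j), rfl⟩)
    simp only [Relations.EF, Function.uncurry, if_neg hij, p.map_lie] at this
    exact this
  · intro i j
    have := hk (Relations.HE F CartanMatrix.E₈ (i, j)) (by simp only [Relations.toSet, Set.mem_union]; left; left; left; right; exact ⟨(i, j), rfl⟩)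
    simp only [Relations.HE, Function.uncurry, map_sub, sub_eq_zero, p.map_lie, map_zsmul] at this
    exact this
  · intro i j
    have := hk (Relations.HF F CartanMatrix.E₈ (i, j)) (by simp only [Relations.toSet, Set.mem_union]; left; left; right; exact ⟨(i, j), rfl⟩)
    simp only [Relations.HF, Function.uncurry, map_add, add_eq_zero_iff_eq_neg, p.map_lie, map_zsmul] at this
    exact this
  · intro i j
    have := hk (Relations.adE F CartanMatrix.E₈ (i, j)) (by simp only [Relations.toSet, Set.mem_union]; left; right; exact ⟨(i, j), rfl⟩)
    simp only [Relations.adE, Function.uncurry, ← itl_eq] at this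
    rw [hitl, p.map_lie] at this
    exact this
  · intro i j
    have := hk (Relations.adF F CartanMatrix.E₈ (i, j)) (by simp only [Relations.toSet, Set.mem_union]; right; exact ⟨(i, j), rfl⟩)
    simp only [Relations.adF, Function.uncurry, ← itl_eq] at this
    rw [hitl, p.map_lie] at this
    exact this
  · intro S h1 h2 h3
    let g : Generators (Fin 8) → S := fun x => match x with
      | .H i => ⟨_, h1 i⟩
      | .E i => ⟨_, h2 i⟩
      | .F i => ⟨_, h3 i⟩
    have : S.incl.comp (FreeLieAlgebra.lift F g) = p := by
      apply FreeLieAlgebra.hom_ext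
      intro x
      rw [LieHom.comp_apply, FreeLieAlgebra.lift_of_apply]
      cases x <;> rfl
    rw [eq_top_iff]
    intro x _
    obtain ⟨y, rfl⟩ := hp x
    have h4 := congrArg (fun φ => φ y) this
    simp only [LieHom.comp_apply] at h4
    rw [← h4]
    exact (FreeLieAlgebra.lift F g y).2
end e8
end E8L

namespace E8L
set_option linter.unusedSectionVars false
set_option linter.unusedVariables false
open LieAlgebra

/-- nonzero weights of a subalgebra on the ambient algebra (genuine eigenvectors) -/
def rts {F L : Type*} [Field F] [LieRing L] [LieAlgebra F L] (H : LieSubalgebra F L) :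
    Set (Module.Dual F H) :=
  {κ | κ ≠ 0 ∧ ∃ x : L, x ≠ 0 ∧ ∀ y : H, ⁅(y : L), x⁆ = κ y • x}

/-- `α` is a base of type E8 for the roots of `H` -/
def IsE8Base {F L : Type*} [Field F] [LieRing L] [LieAlgebra F L] (H : LieSubalgebra F L)
    (α : Fin 8 → Module.Dual F H) : Prop :=
  ∀ κ, κ ∈ rts H ↔ ∃ n : Fin 8 → ℤ, q n = 2 ∧ κ = ∑ i, n i • α i

section jw
variable {F L : Type*} [Field F] [CharZero F] [LieRing L] [LieAlgebra F L]
  {H : LieSubalgebra F L} (b : LieAlgebra.Basis (Fin 8) H) (hA : b.A = CartanMatrix.E₈)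

/-- joint eigenspaces -/
def jw (χ : Fin 8 → F) : Submodule F L where
  carrier := {x | ∀ j, ⁅b.h j, x⁆ = χ j • x}
  add_mem' := by intro x y hx hy j; rw [lie_add, hx j, hy j, smul_add]
  zero_mem' := by intro j; simp
  smul_mem' := by intro c x hx j; rw [lie_smul, hx j, smul_comm]

lemma jw_indep : iSupIndep (jw b) := by
  have h1 := Module.End.independent_iInf_maxGenEigenspace_of_forall_mapsTo
    (fun j => (LieAlgebra.ad F L (b.h j) : Module.End F L)) (fun i j φ => by
      apply Module.End.mapsTo_maxGenEigenspace_of_comm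
      show Commute _ _
      refine LinearMap.ext fun x => ?_
      show ⁅b.h j, ⁅b.h i, x⁆⁆ = ⁅b.h i, ⁅b.h j, x⁆⁆
      rw [leibniz_lie, b.lie_h_h, zero_lie, zero_add])
  refine h1.mono ?_
  intro n x hx
  rw [Submodule.mem_iInf]
  intro j
  refine Module.End.mem_maxGenEigenspace _ _ _ |>.2 ⟨1, ?_⟩
  simp [hx j]

include hA in
lemma eig_wt {χ : Fin 8 → F} {x : L} (hx0 : x ≠ 0) (hx : ∀ j, ⁅b.h j, x⁆ = χ j • x) :
    ∃ n, x ∈ wt b n ∧ ∀ j, χ j = ((pr n j : ℤ) : F) := by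
  by_contra hcon
  have hne : ∀ n : Fin 8 → ℤ, (fun j => ((pr n j : ℤ) : F)) ≠ χ := by
    intro n hn
    subst hn
    exact hcon ⟨n, hx, fun j => rfl⟩
  have h1 := jw_indep b χ
  have h2 : (⨆ n, wt b n) ≤ ⨆ j, ⨆ (_ : j ≠ χ), jw b j := by
    refine iSup_le fun n => ?_
    exact le_iSup₂_of_le (fun j => ((pr n j : ℤ) : F)) (hne n) (le_of_eq (by ext; rfl))
  rw [iSup_wt b hA] at h2
  have h3 := Disjoint.le_bot h1 (x := x) ⟨hx, h2 trivial⟩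
  exact hx0 (by simpa using h3)

lemma h_span (y : H) : ∃ c : Fin 8 → F, (y : L) = ∑ i, c i • b.h i := by
  have : (y : L) ∈ H.toSubmodule := y.2
  rw [b.coe_cartan_eq_span] at this
  obtain ⟨c, hc⟩ := (Submodule.mem_span_range_iff_exists_fun F).1 this
  exact ⟨c, hc.symm⟩

lemma h_span' (y : H) : ∃ c : Fin 8 → F, y = ∑ i, c i • b.h' i := by
  obtain ⟨c, hc⟩ := h_span b y
  refine ⟨c, Subtype.ext ?_⟩
  rw [hc]
  simp [LieAlgebra.Basis.h']

include hA in
lemma base_h (n : Fin 8 → ℤ) (j : Fin 8) :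
    (∑ i, n i • b.baseSupp i) (b.h' j) = ((pr n j : ℤ) : F) := by
  simp [pr, hA]

include hA in
lemma wt_act {n : Fin 8 → ℤ} {x : L} (hx : x ∈ wt b n) (y : H) :
    ⁅(y : L), x⁆ = (∑ i, n i • b.baseSupp i) y • x := by
  obtain ⟨c, hc⟩ := h_span b y
  obtain ⟨c', hc'⟩ := h_span' b y
  rw [hc', map_sum, Finset.sum_smul]
  have : ((∑ i, c' i • b.h' i : H) : L) = ∑ i, c' i • b.h i := by simp [LieAlgebra.Basis.h']
  rw [this, sum_lie']
  refine Finset.sum_congr rfl fun j _ => ?_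
  rw [smul_lie, hx j, map_smul, base_h b hA, smul_smul, smul_eq_mul]

end jw

section fin
variable {F L : Type*} [Field F] [CharZero F] [LieRing L] [LieAlgebra F L]
  {h e f : Fin 8 → L} (S : Serre F h e f) [Nontrivial L]
include S

lemma Serre.wt_root {n : Fin 8 → ℤ} (hn : n ≠ 0) (hw : wt S.basis n ≠ ⊥) :
    q n = 2 ∧ (∀ u ∈ wt S.basis n, ∀ v ∈ wt S.basis n, u ≠ 0 → ∃ c : F, v = c • u) ∧
    ∀ N : LieIdeal F L, ∀ u ∈ wt S.basis n, u ≠ 0 → u ∈ N → ∃ i, e i ∈ N ∨ f i ∈ N :=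
  E8L.wt_root S.basis rfl S.nil S.symm.nil hn hw

lemma Serre.wt_ne {n : Fin 8 → ℤ} (hn : q n = 2) : wt S.basis n ≠ ⊥ :=
  E8L.wt_ne_bot S.basis rfl S.nil S.symm.nil hn

lemma Serre.fin : Module.Finite F L := by
  have hT : ({0} ∪ {n | q n = 2}).Finite := (Set.finite_singleton (0 : Fin 8 → ℤ)).union finite_roots
  have h1 : (⊤ : Submodule F L) = ⨆ n : ({0} ∪ {n | q n = 2} : Set (Fin 8 → ℤ)), wt S.basis n.1 := by
    apply le_antisymm _ le_top
    rw [← iSup_wt S.basis rfl]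
    refine iSup_le fun n => ?_
    by_cases hb : wt S.basis n = ⊥
    · rw [hb]; exact bot_le
    by_cases h0 : n = 0
    · exact le_iSup (fun n : ({0} ∪ {n | q n = 2} : Set (Fin 8 → ℤ)) => wt S.basis n.1) ⟨n, Or.inl h0⟩
    · exact le_iSup (fun n : ({0} ∪ {n | q n = 2} : Set (Fin 8 → ℤ)) => wt S.basis n.1)
        ⟨n, Or.inr (S.wt_root h0 hb).1⟩
  rw [Module.finite_def, h1]
  have := hT.to_subtype
  refine Submodule.fg_iSup _ fun ⟨n, hn⟩ => ?_
  by_cases hb : wt S.basis n = ⊥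
  · show (wt S.basis n).FG
    rw [hb]; exact Submodule.fg_bot
  by_cases h0 : n = 0
  · subst h0
    show (wt S.basis 0).FG
    rw [wt_zero S.basis rfl, S.basis.coe_cartan_eq_span]
    exact Submodule.fg_span (Set.finite_range _)
  · obtain ⟨u, hu, hu0⟩ := (Submodule.ne_bot_iff _).1 hb
    have : wt S.basis n = Submodule.span F {u} := by
      apply le_antisymm
      · intro v hv
        obtain ⟨c, hc⟩ := (S.wt_root h0 hb).2.1 u hu v hv hu0
        rw [hc]
        exact Submodule.smul_mem _ _ (Submodule.mem_span_singleton_self u)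
      · rw [Submodule.span_le]; simpa using hu
    show (wt S.basis n).FG
    rw [this]
    exact Submodule.fg_span (Set.finite_singleton _)

lemma Serre.e_ne (i : Fin 8) : e i ≠ 0 := fun h0 => S.h_ne i (by rw [← S.ef, h0, zero_lie])
lemma Serre.f_ne (i : Fin 8) : f i ≠ 0 := fun h0 => S.h_ne i (by rw [← S.ef, h0, lie_zero])

lemma Serre.killing [IsAlgClosed F] : LieAlgebra.IsKilling F L := by
  haveI := S.fin
  suffices LieAlgebra.HasTrivialRadical F L from inferInstance
  rw [LieAlgebra.hasTrivialRadical_iff_no_abelian_ideals]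
  intro I hI
  by_contra hne
  have hab : ∀ x ∈ I, ∀ y ∈ I, ⁅x, y⁆ = 0 := by
    intro x hx y hy
    have := hI.trivial ⟨x, hx⟩ ⟨y, hy⟩
    exact congrArg Subtype.val this
  have hno : ∀ i, ¬ (e i ∈ I) := by
    intro i hi
    have h1 : h i ∈ I := by rw [← S.ef]; exact lie_mem_left F L I _ _ hi
    have h2 := hab _ h1 _ hi
    rw [S.he, E_diag] at h2
    have : (2:F) • e i = 0 := by rw [← h2, ← Int.cast_smul_eq_zsmul F]; simp
    exact S.e_ne i ((smul_eq_zero.1 this).resolve_left two_ne_zero)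
  have hnf : ∀ i, ¬ (f i ∈ I) := by
    intro i hi
    have h1 : h i ∈ I := by rw [← S.ef]; exact lie_mem_right F L I _ _ hi
    have h2 : ⁅h i, e i⁆ ∈ I := lie_mem_left F L I _ _ h1
    rw [S.he, E_diag] at h2
    apply hno i
    have : e i = (2:F)⁻¹ • ((2:ℤ) • e i) := by
      rw [← Int.cast_smul_eq_zsmul F, smul_smul]; simp
    rw [this]
    exact I.smul_mem _ h2
  let H := LieSubalgebra.lieSpan F L (Set.range h)
  haveI : IsLieAbelian H := S.basis.isLieAbelian_cartan
  haveI : Nontrivial I := (LieSubmodule.nontrivial_iff_ne_bot F L L).2 hne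
  obtain ⟨χ, hχ⟩ := LieModule.exists_nontrivial_weightSpace_of_isSolvable F H I
  obtain ⟨⟨⟨v, hvI⟩, hv⟩, hv0⟩ := exists_ne (0 : LieModule.weightSpace I χ)
  rw [LieModule.mem_weightSpace] at hv
  have hv0 : v ≠ 0 := by
    rintro rfl; exact hv0 rfl
  obtain ⟨n, hn, -⟩ := eig_wt S.basis rfl (χ := fun j => χ (S.basis.h' j)) hv0 (fun j =>
    congrArg Subtype.val (hv (S.basis.h' j)))
  by_cases h0 : n = 0
  · subst h0
    rw [wt_zero S.basis rfl] at hn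
    obtain ⟨c, hc⟩ := h_span S.basis ⟨v, hn⟩
    have hc : v = ∑ i, c i • h i := hc
    have : c = 0 := by
      refine S.faithful c fun j => ?_
      rw [← hc]
      by_contra hj
      apply hno j
      have h3 := S.basis.baseSupp_apply_smul_e j ⟨v, hn⟩
      have h3 : S.basis.baseSupp j ⟨v, hn⟩ • e j = ⁅v, e j⁆ := h3
      have h4 : ⁅v, e j⁆ ∈ I := lie_mem_left F L I _ _ hvI
      have h5 : S.basis.baseSupp j ⟨v, hn⟩ ≠ 0 := by
        intro h5; rw [h5, zero_smul] at h3; exact hj h3.symm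
      rw [← h3] at h4
      have := I.smul_mem (S.basis.baseSupp j ⟨v, hn⟩)⁻¹ h4
      rwa [smul_smul, inv_mul_cancel₀ h5, one_smul] at this
    apply hv0
    rw [hc, this]; simp
  · obtain ⟨i, hi | hi⟩ := (S.wt_root h0 ((Submodule.ne_bot_iff _).2 ⟨v, hn, hv0⟩)).2.2 I v hn hv0 hvI
    · exact hno i hi
    · exact hnf i hi

/-- End of Part I -/
theorem Serre.main [IsAlgClosed F] : Module.Finite F L ∧ LieAlgebra.IsKilling F L ∧
    ∃ H : LieSubalgebra F L, H.IsCartanSubalgebra ∧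
      (∃ α, IsE8Base H α ∧ LinearIndependent F α) ∧ Module.finrank F H = 8 := by
  haveI := S.fin
  refine ⟨S.fin, S.killing, LieSubalgebra.lieSpan F L (Set.range h), S.basis.isCartanSubalgebra,
    ⟨S.basis.baseSupp, ?_, S.basis.linearIndependent_baseSupp⟩, ?_⟩
  · intro κ
    constructor
    · rintro ⟨hκ, x, hx0, hx⟩
      obtain ⟨n, hn, hn'⟩ := eig_wt S.basis rfl (χ := fun j => κ (S.basis.h' j)) hx0
        (fun j => hx (S.basis.h' j))
      have hκn : κ = ∑ i, n i • S.basis.baseSupp i := by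
        refine LinearMap.ext fun y => ?_
        obtain ⟨c, hc⟩ := h_span' S.basis y
        rw [hc, map_sum, map_sum]
        refine Finset.sum_congr rfl fun j _ => ?_
        rw [map_smul, map_smul, base_h S.basis rfl]
        exact congrArg _ (hn' j)
      refine ⟨n, (S.wt_root ?_ ((Submodule.ne_bot_iff _).2 ⟨x, hn, hx0⟩)).1, hκn⟩
      rintro rfl
      exact hκ (by simpa using hκn)
    · rintro ⟨n, hq, rfl⟩
      obtain ⟨x, hx, hx0⟩ := (Submodule.ne_bot_iff _).1 (S.wt_ne hq)
      refine ⟨?_, x, hx0, wt_act S.basis rfl hx⟩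
      intro h0
      have : n = 0 := by
        apply pr_inj
        intro j
        have := base_h S.basis rfl n j
        rw [h0] at this
        rw [pr_zero]
        have h2 : ((pr n j : ℤ) : F) = 0 := this.symm
        exact_mod_cast h2
      subst this
      simp [q_zero] at hq
  · show Module.finrank F (LieSubalgebra.lieSpan F L (Set.range h)).toSubmodule = 8
    rw [S.basis.coe_cartan_eq_span, finrank_span_eq_card S.basis.linInd]
    simp

end fin
end E8L

namespace E8L
set_option linter.unusedSectionVars false
set_option linter.unusedVariables false
open LieAlgebra

section lie
/-- consequence of the theorem of Lie -/
lemma nilp_of_solvable {F Z : Type*} [Field F] [CharZero F] [IsAlgClosed F] [LieRing Z]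
    [LieAlgebra F Z] [LieAlgebra.IsSolvable Z] (d : ℕ) : ∀ (V : Type _) [AddCommGroup V] [Module F V]
    [LieRingModule Z V] [LieModule F Z V] [Module.Finite F V], Module.finrank F V ≤ d → ∀ a b c : Z,
    IsNilpotent (LieModule.toEnd F Z V ⁅a, b⁆ ∘ₗ LieModule.toEnd F Z V c) := by
  induction d with
  | zero =>
    intro V _ _ _ _ _ hd a b c
    have := Module.finrank_zero_iff.1 (Nat.le_zero.1 hd)
    exact ⟨1, LinearMap.ext fun x => Subsingleton.elim _ _⟩
  | succ d ih =>
    intro V _ _ _ _ _ hd a b c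
    rcases subsingleton_or_nontrivial V with hV | hV
    · exact ⟨1, LinearMap.ext fun x => Subsingleton.elim _ _⟩
    obtain ⟨χ, hχ⟩ := LieModule.exists_nontrivial_weightSpace_of_isSolvable F Z V
    obtain ⟨⟨v, hv⟩, hv0⟩ := exists_ne (0 : LieModule.weightSpace V χ)
    rw [LieModule.mem_weightSpace] at hv
    have hv0 : v ≠ 0 := by rintro rfl; exact hv0 rfl
    let N : LieSubmodule F Z V :=
      { Submodule.span F {v} with
        lie_mem := by
          intro x m hm
          obtain ⟨k, rfl⟩ := Submodule.mem_span_singleton.1 hm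
          rw [lie_smul, hv, smul_smul]
          exact Submodule.smul_mem _ _ (Submodule.mem_span_singleton_self v) }
    have hdim : Module.finrank F (V ⧸ N) ≤ d := by
      have h1 := Submodule.finrank_quotient_add_finrank (N : Submodule F V)
      have h2 : Module.finrank F (N : Submodule F V) = 1 := finrank_span_singleton hv0
      have h3 : Module.finrank F (V ⧸ N) = Module.finrank F (V ⧸ (N : Submodule F V)) := rfl
      omega
    obtain ⟨k, hk⟩ := ih (V ⧸ N) hdim a b c
    set T := LieModule.toEnd F Z V ⁅a, b⁆ ∘ₗ LieModule.toEnd F Z V c with hT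
    have hTN : ∀ w ∈ N, T w = 0 := by
      intro w hw
      obtain ⟨r, rfl⟩ := Submodule.mem_span_singleton.1 hw
      have h0 : ⁅⁅a, b⁆, v⁆ = 0 := by
        rw [lie_lie, hv, hv, lie_smul, lie_smul, hv, hv, smul_comm, sub_self]
      rw [hT, map_smul, LinearMap.comp_apply, LieModule.toEnd_apply_apply, LieModule.toEnd_apply_apply, hv, lie_smul, h0, smul_zero, smul_zero]
    have hq : ∀ (j : ℕ) (w : V), ((LieModule.toEnd F Z (V ⧸ N) ⁅a, b⁆ ∘ₗ LieModule.toEnd F Z (V ⧸ N) c) ^ j)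
        (LieSubmodule.Quotient.mk (N := N) w) = LieSubmodule.Quotient.mk (N := N) ((T ^ j) w) := by
      intro j
      induction j with
      | zero => intro w; rfl
      | succ j ihj =>
        intro w
        have := ihj (T w)
        rw [pow_succ, pow_succ]
        exact this
    refine ⟨k + 1, LinearMap.ext fun w => ?_⟩
    rw [pow_succ', Module.End.mul_apply]
    apply hTN
    have := hq k w
    rw [hk] at this
    exact (LieSubmodule.Quotient.mk_eq_zero' ).1 this.symm

end lie

section jordan
variable {F L : Type*} [Field F] [CharZero F] [IsAlgClosed F] [LieRing L] [LieAlgebra F L]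
  [Module.Finite F L] [LieAlgebra.IsKilling F L]

lemma add_pow_kill {V : Type*} [AddCommGroup V] [Module F V] {f g : Module.End F V}
    (hc : Commute f g) {k l : ℕ} {y : V} (hf : (f ^ k) y = 0) (hg : g ^ l = 0) :
    ((f + g) ^ (k + l)) y = 0 := by
  rw [hc.add_pow', LinearMap.sum_apply]
  refine Finset.sum_eq_zero fun ⟨i, j⟩ hij => ?_
  rw [Finset.HasAntidiagonal.mem_antidiagonal] at hij
  have hij : i + j = k + l := hij
  rw [LinearMap.smul_apply]
  show _ • (f ^ i * g ^ j) y = 0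
  by_cases hj : l ≤ j
  · rw [pow_eq_zero_of_le hj hg]; simp
  · obtain ⟨r, rfl⟩ := Nat.exists_eq_add_of_le (show k ≤ i by omega)
    rw [(hc.pow_pow _ _).eq, add_comm k r, pow_add]
    simp [hf]

/-- semisimple part is inner -/
lemma jordan_inner (x : L) : ∃ s : L, (∀ a : F, ∀ y, ∀ k, ((LieAlgebra.ad F L x - algebraMap F (Module.End F L) a) ^ k) y = 0 →
      ⁅s, y⁆ = a • y) ∧ ∀ T : Module.End F L, Commute T (LieAlgebra.ad F L x) → Commute T (LieAlgebra.ad F L s) := by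
  obtain ⟨n, hn, s, hs, hnil, hss, hx⟩ :=
    Module.End.exists_isNilpotent_isSemisimple (f := (LieAlgebra.ad F L x : Module.End F L))
  have hcx : Commute (LieAlgebra.ad F L x : Module.End F L) n :=
    Algebra.commute_of_mem_adjoin_self hn
  have hact : ∀ a : F, ∀ y, ∀ k, ((LieAlgebra.ad F L x - algebraMap F (Module.End F L) a) ^ k) y = 0 →
      s y = a • y := by
    intro a y k hk
    obtain ⟨l, hl⟩ := hnil
    have hc : Commute (LieAlgebra.ad F L x - algebraMap F (Module.End F L) a : Module.End F L) (-n) :=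
      (hcx.sub_left (Algebra.commutes a n)).neg_right
    have h1 := add_pow_kill hc hk (l := l) (by rw [neg_pow, hl, mul_zero])
    have h2 : (LieAlgebra.ad F L x - algebraMap F (Module.End F L) a : Module.End F L) + -n =
      s - algebraMap F (Module.End F L) a := by rw [hx]; abel
    rw [h2] at h1
    have h3 : y ∈ s.maxGenEigenspace a := by
      rw [Module.End.mem_maxGenEigenspace]
      refine ⟨k + l, ?_⟩
      rw [← h1]; rfl
    rw [hss.isFinitelySemisimple.maxGenEigenspace_eq_eigenspace] at h3
    exact Module.End.mem_eigenspace_iff.1 h3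
  have htop : ⨆ a, (LieAlgebra.ad F L x : Module.End F L).maxGenEigenspace a = ⊤ :=
    Module.End.iSup_maxGenEigenspace_eq_top _
  have hact' : ∀ a : F, ∀ y ∈ (LieAlgebra.ad F L x : Module.End F L).maxGenEigenspace a, s y = a • y := by
    intro a y hy
    rw [Module.End.mem_maxGenEigenspace] at hy
    obtain ⟨k, hk⟩ := hy
    exact hact a y k hk
  have hder : ∀ y z, s ⁅y, z⁆ = ⁅y, s z⁆ - ⁅z, s y⁆ := by
    intro y z
    have hy : y ∈ ⨆ a, (LieAlgebra.ad F L x : Module.End F L).maxGenEigenspace a := by rw [htop]; trivial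
    have hz : z ∈ ⨆ a, (LieAlgebra.ad F L x : Module.End F L).maxGenEigenspace a := by rw [htop]; trivial
    induction hy using Submodule.iSup_induction' with
    | zero => simp
    | add u v _ _ hu hv => rw [add_lie, map_add, hu, hv, map_add, add_lie, lie_add]; abel
    | mem a y hy =>
      induction hz using Submodule.iSup_induction' with
      | zero => simp
      | add u v _ _ hu hv => rw [lie_add, map_add, hu, hv, map_add, add_lie, lie_add]; abel
      | mem c z hz =>
        have h4 := LieModule.lie_mem_maxGenEigenspace_toEnd (R := F) (L := L) (M := L) (x := x)
          (χ₁ := a) (χ₂ := c) (y := y) (m := z) hy hz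
        rw [hact' _ _ hy, hact' _ _ hz, hact' _ _ h4, lie_smul, lie_smul, ← lie_skew y z, smul_neg,
          smul_neg, add_smul]
        abel
  let D : LieDerivation F L L := ⟨s, hder⟩
  obtain ⟨s', hs'⟩ := LieDerivation.IsKilling.exists_eq_ad D
  have hs'' : (LieAlgebra.ad F L s' : Module.End F L) = s := by
    ext y
    have := congrArg (fun D => D y) hs'
    simp only [LieDerivation.ad_apply_apply] at this
    exact this
  refine ⟨s', fun a y k hk => ?_, fun T hT => ?_⟩
  · rw [← hact a y k hk, ← hs'']; rfl
  · rw [hs'']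
    exact Algebra.commute_of_mem_adjoin_singleton_of_commute hs hT
end jordan
end E8L

namespace E8L
set_option linter.unusedSectionVars false
set_option linter.unusedVariables false
open LieAlgebra

section stable
variable {F L : Type*} [Field F] [CharZero F] [IsAlgClosed F] [LieRing L] [LieAlgebra F L]
  [Module.Finite F L] [LieAlgebra.IsKilling F L]
  (T : Module.End F L) (hT : ∀ x y, T ⁅x, y⁆ = ⁅T x, T y⁆) {m : ℕ} [NeZero m] (hTm : T ^ m = 1)
  (g0 : LieSubalgebra F L) (hg : ∀ x, x ∈ g0 ↔ T x = x) [LieAlgebra.IsKilling F g0]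
  (t : LieSubalgebra F g0) [t.IsCartanSubalgebra]

include hTm in
lemma T_surj (y : L) : ∃ x, T x = y := by
  obtain ⟨k, hk⟩ := Nat.exists_eq_succ_of_ne_zero (NeZero.ne m)
  refine ⟨(T ^ k) y, ?_⟩
  have := congrArg (fun f : Module.End F L => f y) hTm
  rw [hk, pow_succ'] at this
  exact this

include hT hg
include hTm in
lemma t_ss {x : g0} (hx : x ∈ t) (a : F) (y : L) (k : ℕ)
    (hk : ((LieAlgebra.ad F L (x : L) - algebraMap F (Module.End F L) a) ^ k) y = 0) :
    ⁅(x : L), y⁆ = a • y := by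
  obtain ⟨s, hs, hsc⟩ := jordan_inner (F := F) (x : L)
  have hc : Commute T (LieAlgebra.ad F L (x : L)) := by
    refine LinearMap.ext fun y => ?_
    show T ⁅(x : L), y⁆ = ⁅(x : L), T y⁆
    rw [hT, (hg x).1 x.2]
  have hc2 := hsc T hc
  have hsg : s ∈ g0 := by
    rw [hg]
    apply eq_of_sub_eq_zero
    rw [← LieDerivation.IsKilling.ad_apply_eq_zero_iff F]
    ext y
    obtain ⟨y, rfl⟩ := T_surj T hTm y
    have h1 : T ⁅s, y⁆ = ⁅s, T y⁆ := congrArg (fun f : Module.End F L => f y) hc2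
    simp [← hT, h1, sub_lie]
  have hss := IsKilling.isSemisimple_ad_of_mem_isCartanSubalgebra (H := t) hx
  have hall : ∀ y : g0, ⁅(⟨s, hsg⟩ : g0) - x, y⁆ = 0 := by
    intro y
    have htop : ⨆ a, (LieAlgebra.ad F g0 x : Module.End F g0).maxGenEigenspace a = ⊤ :=
      Module.End.iSup_maxGenEigenspace_eq_top _
    have hy : y ∈ ⨆ a, (LieAlgebra.ad F g0 x : Module.End F g0).maxGenEigenspace a := by
      rw [htop]; trivial
    induction hy using Submodule.iSup_induction' with
    | zero => simp
    | add u v _ _ hu hv => rw [lie_add, hu, hv, add_zero]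
    | mem a y hy =>
      rw [hss.isFinitelySemisimple.maxGenEigenspace_eq_eigenspace, Module.End.mem_eigenspace_iff] at hy
      have hy' : ⁅(x : L), (y : L)⁆ = a • (y : L) := congrArg Subtype.val hy
      have h1 := hs a y 1 (by simp [hy'])
      apply Subtype.ext
      show ⁅s - (x : L), (y : L)⁆ = 0
      rw [sub_lie, h1, hy', sub_self]
  have h0 : (⟨s, hsg⟩ : g0) - x = 0 := by
    rw [← LieDerivation.IsKilling.ad_apply_eq_zero_iff F]
    ext y
    simpa [sub_lie] using congrArg Subtype.val (hall y)
  have h1 : s = x := congrArg Subtype.val (sub_eq_zero.1 h0)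
  rw [← h1]
  exact hs a y k (h1 ▸ hk)

include hTm in
/-- existence of a stable Cartan subalgebra containing a Cartan subalgebra of the fixed points -/
theorem exists_stable : ∃ h : LieSubalgebra F L, h.IsCartanSubalgebra ∧ (∀ x ∈ h, T x ∈ h) ∧
    ∀ y : L, (∀ x ∈ h, T x = x → ⁅x, y⁆ = 0) → y ∈ h := by
  obtain ⟨t, htC⟩ : ∃ t : LieSubalgebra F g0, t.IsCartanSubalgebra := by
    obtain ⟨x0, hx0⟩ := LieAlgebra.exists_isCartanSubalgebra_engel F g0
    exact ⟨_, hx0⟩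
  have : IsLieAbelian t := inferInstance
  let H : LieSubalgebra F L := t.map g0.incl
  have hHt : ∀ y : L, y ∈ H ↔ ∃ x ∈ t, (x : L) = y := fun y => by
    rw [LieSubalgebra.mem_map]; rfl
  have hHab : ∀ x ∈ H, ∀ y ∈ H, ⁅x, y⁆ = 0 := by
    intro x hx y hy
    obtain ⟨x, hx', rfl⟩ := (hHt _).1 hx
    obtain ⟨y, hy', rfl⟩ := (hHt _).1 hy
    have := trivial_lie_zero t t ⟨x, hx'⟩ ⟨y, hy'⟩
    have := congrArg Subtype.val this
    exact congrArg Subtype.val this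
  have : IsLieAbelian H := ⟨fun x y => Subtype.ext (hHab x x.2 y y.2)⟩
  have hss : ∀ x ∈ H, ∀ (a : F) (y : L) (k : ℕ),
      ((LieAlgebra.ad F L (x : L) - algebraMap F (Module.End F L) a) ^ k) y = 0 →
      ⁅(x : L), y⁆ = a • y := by
    intro x hx a y k hk
    obtain ⟨x, hx', rfl⟩ := (hHt _).1 hx
    exact t_ss T hT hTm g0 hg t hx' a y k hk
  have hHT : ∀ x ∈ H, T x = x := by
    intro x hx
    obtain ⟨x, hx, rfl⟩ := (hHt _).1 hx
    exact (hg _).1 x.2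
  let z := LieAlgebra.zeroRootSubalgebra F L H
  have hz : ∀ y, y ∈ z ↔ ∀ x ∈ H, ⁅x, y⁆ = 0 := by
    intro y
    rw [LieAlgebra.mem_zeroRootSubalgebra]
    constructor
    · intro h x hx
      obtain ⟨k, hk⟩ := h ⟨x, hx⟩
      have := hss x hx 0 y k (by rw [map_zero, sub_zero, ← hk]; rfl)
      simpa using this
    · intro h x
      exact ⟨1, by rw [pow_one]; exact h x x.2⟩
  have hzT : ∀ x ∈ z, T x ∈ z := by
    intro x hx
    rw [hz] at hx ⊢
    intro y hy
    rw [← hHT y hy, ← hT, hx y hy, map_zero]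
  have hzfix : ∀ y ∈ z, T y = y → y ∈ H := by
    intro y hy hTy
    have hn : t.normalizer = t := LieSubalgebra.IsCartanSubalgebra.self_normalizing
    rw [hHt]
    refine ⟨⟨y, (hg y).2 hTy⟩, ?_, rfl⟩
    rw [← hn, LieSubalgebra.mem_normalizer_iff]
    intro x hx
    have h1 : ⁅(⟨y, (hg y).2 hTy⟩ : g0), x⁆ = 0 := by
      rw [← lie_skew, neg_eq_zero]
      exact Subtype.ext ((hz y).1 hy x ((hHt _).2 ⟨x, hx, rfl⟩))
    rw [h1]; exact zero_mem _
  -- solvability of z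
  have hsol : LieAlgebra.IsSolvable z := by
    obtain ⟨ζ, hζ⟩ : ∃ ζ : F, IsPrimitiveRoot ζ m := HasEnoughRootsOfUnity.exists_primitiveRoot F m
    let Tz : Module.End F z := T.restrict (p := z.toSubmodule) (q := z.toSubmodule) hzT
    have hTz : ∀ y : z, ((Tz y : z) : L) = T y := fun y => rfl
    have hTzm : Tz ^ m = 1 := by
      ext y
      have h1 : ∀ k, (((Tz ^ k) y : z) : L) = (T ^ k) y := by
        intro k
        induction k with
        | zero => rfl
        | succ k ih => rw [pow_succ', pow_succ', Module.End.mul_apply, Module.End.mul_apply, hTz, ih]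
      rw [h1, hTm]; rfl
    have hTlie : ∀ x y : z, Tz ⁅x, y⁆ = ⁅Tz x, Tz y⁆ := fun x y => Subtype.ext (hT x y)
    have hpow : ∀ i : ZMod m, ∀ j : ZMod m, ζ ^ i.val * ζ ^ j.val = ζ ^ (i + j).val := by
      intro i j
      rw [← pow_add, ZMod.val_add]
      generalize i.val + j.val = r
      rw [hζ.eq_orderOf, pow_mod_orderOf]
    let W : ZMod m → Submodule F z := fun i => Tz.eigenspace (ζ ^ i.val)
    refine Krek.solvable (F := F) (W := W) ⟨?_, ?_⟩ ?_
    · intro i j x y hx hy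
      rw [Module.End.mem_eigenspace_iff] at hx hy ⊢
      rw [hTlie, hx, hy, smul_lie, lie_smul, smul_smul, hpow]
    · intro i x y hx hy
      rw [Module.End.mem_eigenspace_iff, ZMod.val_zero, pow_zero, one_smul] at hx
      have h1 := hzfix x x.2 (congrArg Subtype.val hx)
      exact Subtype.ext ((hz y).1 y.2 x h1)
    · have hsem : Tz.IsSemisimple := by
        refine Module.End.isSemisimple_of_squarefree_aeval_eq_zero (p := Polynomial.X ^ m - 1) ?_ ?_
        · exact (Polynomial.separable_X_pow_sub_C (1 : F) (by simp [NeZero.ne m]) one_ne_zero).squarefree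
        · simp [hTzm]
      have htop : ⨆ a, Tz.maxGenEigenspace a = ⊤ := Module.End.iSup_maxGenEigenspace_eq_top _
      rw [eq_top_iff, ← htop]
      refine iSup_le fun a => ?_
      rw [hsem.isFinitelySemisimple.maxGenEigenspace_eq_eigenspace]
      intro y hy
      by_cases hy0 : y = 0
      · rw [hy0]; exact zero_mem _
      have hy' := Module.End.mem_eigenspace_iff.1 hy
      have h2 : ∀ k, (Tz ^ k) y = a ^ k • y := by
        intro k
        induction k with
        | zero => simp
        | succ k ih => rw [pow_succ', Module.End.mul_apply, ih, map_smul, hy', smul_smul, pow_succ]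
      have h3 : a ^ m = 1 := by
        have := h2 m
        rw [hTzm, Module.End.one_apply] at this
        have h4 : (a ^ m - 1) • y = 0 := by rw [sub_smul, ← this, one_smul, sub_self]
        exact sub_eq_zero.1 ((smul_eq_zero.1 h4).resolve_right hy0)
      obtain ⟨i, him, hi⟩ := hζ.eq_pow_of_pow_eq_one h3
      refine Submodule.mem_iSup_of_mem (i : ZMod m) ?_
      rw [Module.End.mem_eigenspace_iff, ZMod.val_natCast, Nat.mod_eq_of_lt him, hi]
      exact hy'
  -- z is abelian
  have hzab : ∀ a ∈ z, ∀ b ∈ z, ⁅a, b⁆ = 0 := by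
    intro a ha b hb
    have hzz : ∀ c ∈ z, killingForm F L ⁅a, b⁆ c = 0 := by
      intro c hc
      have h1 := nilp_of_solvable (F := F) (Z := z) _ L le_rfl ⟨a, ha⟩ ⟨b, hb⟩ ⟨c, hc⟩
      exact (LinearMap.isNilpotent_trace_of_isNilpotent h1).eq_zero
    have hall : ∀ y, killingForm F L ⁅a, b⁆ y = 0 := by
      intro y
      have hy : y ∈ ⨆ χ : H → F, (LieModule.genWeightSpace L χ).toSubmodule := by
        rw [LieSubmodule.iSup_toSubmodule_eq_top.mpr (LieModule.iSup_genWeightSpace_eq_top F H L)]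
        trivial
      induction hy using Submodule.iSup_induction' with
      | zero => simp
      | add u v _ _ hu hv => rw [map_add, hu, hv, add_zero]
      | mem χ y hy =>
        have hy : y ∈ LieModule.genWeightSpace L χ := hy
        rw [LieModule.mem_genWeightSpace] at hy
        have hy1 : ∀ x : H, ⁅(x : L), y⁆ = χ x • y := by
          intro x
          obtain ⟨k, hk⟩ := hy x
          refine hss x x.2 _ _ k ?_
          rw [Algebra.algebraMap_eq_smul_one, ← hk]; rfl
        by_cases hχ : ∀ x, χ x = 0
        · apply hzz
          rw [hz]
          intro x hx
          rw [hy1 ⟨x, hx⟩, hχ, zero_smul]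
        · push Not at hχ
          obtain ⟨x, hx⟩ := hχ
          have h2 : ⁅⁅a, b⁆, (x : L)⁆ = 0 := by
            rw [← lie_skew, (hz _).1 (z.lie_mem ha hb) x x.2, neg_zero]
          have h3 := LieModule.traceForm_apply_lie_apply F L L ⁅a, b⁆ (x : L) y
          rw [h2, map_zero, LinearMap.zero_apply, hy1, map_smul, smul_eq_mul] at h3
          exact (mul_eq_zero.1 h3.symm).resolve_left hx
    have h1 : ⁅a, b⁆ ∈ LinearMap.ker (killingForm F L) := LinearMap.ext hall
    rw [LieAlgebra.IsKilling.ker_killingForm_eq_bot] at h1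
    exact h1
  refine ⟨z, ⟨?_, LieAlgebra.zeroRootSubalgebra_normalizer_eq_self F L H⟩, hzT, ?_⟩
  · have : IsLieAbelian z := ⟨fun x y => Subtype.ext (hzab x x.2 y y.2)⟩
    infer_instance
  · intro y hy
    rw [hz]
    intro x hx
    exact hy x ((hz x).2 fun x' hx' => hHab _ hx' _ hx) (hHT x hx)

end stable
end E8L

namespace E8L
set_option linter.unusedSectionVars false
set_option linter.unusedVariables false
open LieAlgebra

section gen
variable {F L : Type*} [Field F] [CharZero F] [IsAlgClosed F] [LieRing L] [LieAlgebra F L]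
  [Module.Finite F L] [LieAlgebra.IsKilling F L] (h : LieSubalgebra F L) [h.IsCartanSubalgebra]

lemma mem_rts_iff (κ : Module.Dual F h) : κ ∈ rts h ↔ ∃ χ ∈ h.root, κ = LieModule.Weight.toLinear F h L χ := by
  constructor
  · rintro ⟨h0, x, hx0, hx⟩
    have hmem : x ∈ LieModule.genWeightSpace L (κ : h → F) := by
      rw [LieModule.mem_genWeightSpace]
      intro y
      refine ⟨1, ?_⟩
      have := hx y
      rw [pow_one, LinearMap.sub_apply, LieModule.toEnd_apply_apply]
      show ⁅(y : L), x⁆ - κ y • x = 0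
      rw [this, sub_self]
    have hne : LieModule.genWeightSpace L (κ : h → F) ≠ ⊥ := by
      intro hb
      rw [hb] at hmem
      exact hx0 (by simpa using hmem)
    refine ⟨⟨κ, hne⟩, ?_, ?_⟩
    · rw [LieSubalgebra.root, Finset.mem_filter]
      refine ⟨Finset.mem_univ _, ?_⟩
      intro hz
      apply h0
      ext y
      exact congrFun hz y
    · ext y; rfl
  · rintro ⟨χ, hχ, rfl⟩
    have hz : χ.IsNonZero := by simpa using hχ
    refine ⟨fun h0 => hz ?_, ?_⟩
    · funext y; exact congrArg (fun f : Module.Dual F h => f y) h0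
    · obtain ⟨x, hx, hx0⟩ := χ.exists_ne_zero
      exact ⟨x, hx0, fun y => LieAlgebra.IsKilling.lie_eq_smul_of_mem_rootSpace hx y⟩

lemma root_of_rts {κ : Module.Dual F h} (hκ : κ ∈ rts h) (x : h) :
    (LieAlgebra.ad F L (x : L)).charpoly.IsRoot (κ x) := by
  obtain ⟨_, v, hv0, hv⟩ := hκ
  rw [← Module.End.hasEigenvalue_iff_isRoot_charpoly]
  refine Module.End.hasEigenvalue_of_hasEigenvector (x := v) ⟨?_, hv0⟩
  rw [Module.End.mem_eigenspace_iff]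
  exact hv x

lemma rts_of_root {a : F} (x : h) (ha : (LieAlgebra.ad F L (x : L)).charpoly.IsRoot a) :
    a = 0 ∨ ∃ κ ∈ rts h, κ x = a := by
  rw [← Module.End.hasEigenvalue_iff_isRoot_charpoly] at ha
  by_contra hcon
  push Not at hcon
  obtain ⟨ha0, hcon⟩ := hcon
  obtain ⟨v, hv, hv0⟩ := ha.exists_hasEigenvector
  have h1 := Module.End.independent_maxGenEigenspace (LieAlgebra.ad F L (x : L)) a
  have h2 : (⊤ : Submodule F L) ≤ ⨆ j, ⨆ (_ : j ≠ a),
      (LieAlgebra.ad F L (x : L)).maxGenEigenspace j := by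
    have h3 := LieModule.iSup_genWeightSpace_eq_top' F h L
    rw [← LieSubmodule.iSup_toSubmodule_eq_top] at h3
    rw [← h3]
    refine iSup_le fun χ => ?_
    have hne : χ x ≠ a := by
      by_cases hz : χ.IsZero
      · have : χ x = 0 := congrFun hz x
        rw [this]; exact fun h => ha0 h.symm
      · exact hcon (LieModule.Weight.toLinear F h L χ)
          ((mem_rts_iff h _).2 ⟨χ, by simpa using hz, rfl⟩)
    refine le_iSup₂_of_le (χ x) hne ?_
    intro v hv
    have := (LieModule.mem_genWeightSpace L _ _).1 hv x
    exact (Module.End.mem_maxGenEigenspace _ _ _).2 this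
  have h3 := Disjoint.le_bot h1 (x := v) ⟨?_, h2 trivial⟩
  · exact hv0 (by simpa using h3)
  · refine (Module.End.mem_maxGenEigenspace _ _ _).2 ⟨1, ?_⟩
    rw [Module.End.mem_eigenspace_iff] at hv
    simp only [pow_one, LinearMap.sub_apply, hv]
    simp

/-- ℤ-span of the roots -/
abbrev rl {F L : Type*} [Field F] [LieRing L] [LieAlgebra F L] (h : LieSubalgebra F L) :
    Submodule ℤ (Module.Dual F h) := Submodule.span ℤ (rts h)

lemma rts_eq_range : rts h = Set.range (LieAlgebra.IsKilling.rootSystem h).root := by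
  ext κ
  rw [mem_rts_iff]
  constructor
  · rintro ⟨χ, hχ, rfl⟩
    exact ⟨⟨χ, hχ⟩, rfl⟩
  · rintro ⟨⟨χ, hχ⟩, rfl⟩
    exact ⟨χ, hχ, rfl⟩

lemma finite_rts : (rts h).Finite := by
  rw [rts_eq_range]; exact Set.finite_range _

lemma finrank_rl : Module.finrank ℤ (rl h) = Module.finrank F h := by
  have := (LieAlgebra.IsKilling.rootSystem h).finrank_rootSpanIn_int
  rw [rl, rts_eq_range]
  rw [RootPairing.rootSpan] at this
  rw [this]
  exact Subspace.dual_finrank_eq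

lemma span_rts : Submodule.span F (rts h) = ⊤ := by
  rw [rts_eq_range]
  exact RootPairing.IsRootSystem.span_root_eq_top

lemma rl_finite : Module.Finite ℤ (rl h) :=
  Module.Finite.iff_fg.2 ⟨(finite_rts h).toFinset, by simp⟩

lemma rl_free : Module.Free ℤ (rl h) := by
  have := rl_finite h
  have : IsAddTorsionFree (Module.Dual F h) := .of_isTorsionFree F _
  infer_instance

lemma le_engel (x : h) : h ≤ LieSubalgebra.engel F (x : L) := by
  intro y hy
  rw [LieSubalgebra.mem_engel_iff]
  refine ⟨1, ?_⟩
  have h1 : ⁅x, (⟨y, hy⟩ : h)⁆ = 0 := trivial_lie_zero h h _ _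
  have h2 := congrArg Subtype.val h1
  simpa using h2

lemma engel_eq (x : h) (hx : ∀ κ ∈ rts h, κ x ≠ 0) : LieSubalgebra.engel F (x : L) = h := by
  apply le_antisymm
  · intro v hv
    have hmem : v ∈ h.toSubmodule ⊔ ⨆ j, ⨆ (_ : j ≠ (0:F)),
      (LieAlgebra.ad F L (x : L)).maxGenEigenspace j := by
      have h3 := LieModule.iSup_genWeightSpace_eq_top' F h L
      rw [← LieSubmodule.iSup_toSubmodule_eq_top] at h3
      have : v ∈ (⊤ : Submodule F L) := trivial
      rw [← h3] at this
      revert this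
      apply SetLike.le_def.1 
      refine iSup_le fun χ => ?_
      by_cases hz : χ.IsZero
      · refine le_sup_of_le_left ?_
        have := LieAlgebra.rootSpace_zero_eq F L h
        intro v hv
        have hz : (χ : h → F) = 0 := hz
        have hv : v ∈ LieAlgebra.rootSpace h (χ : h → F) := hv
        rw [hz] at hv
        have h5 : v ∈ h.toLieSubmodule := by rw [← this]; exact hv
        exact h5
      · refine le_sup_of_le_right ?_
        have hne : χ x ≠ 0 := hx (LieModule.Weight.toLinear F h L χ)
          ((mem_rts_iff h _).2 ⟨χ, by simpa using hz, rfl⟩)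
        refine le_iSup₂_of_le (χ x) hne ?_
        intro v hv
        have := (LieModule.mem_genWeightSpace L _ _).1 hv x
        exact (Module.End.mem_maxGenEigenspace _ _ _).2 this
    obtain ⟨u, hu, w, hw, rfl⟩ := Submodule.mem_sup.1 hmem
    have hu' : u ∈ LieSubalgebra.engel F (x : L) := le_engel h x hu
    have hw' : w ∈ LieSubalgebra.engel F (x : L) := by
      have := sub_mem hv hu'
      simpa using this
    have h1 := Module.End.independent_maxGenEigenspace (LieAlgebra.ad F L (x : L)) 0
    have h3 := Disjoint.le_bot h1 (x := w) ⟨?_, hw⟩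
    · have : w = 0 := by simpa using h3
      rw [this, add_zero]; exact hu
    · rw [LieSubalgebra.mem_engel_iff] at hw'
      refine (Module.End.mem_maxGenEigenspace _ _ _).2 ?_
      simpa using hw'
  · exact le_engel h x

end gen
end E8L

namespace E8L
set_option linter.unusedSectionVars false
set_option linter.unusedVariables false
open LieAlgebra

lemma exists_indep (F : Type*) [Field F] [CharZero F] [IsAlgClosed F] (r : ℕ) :
    ∃ c : Fin r → F, LinearIndependent ℤ c := by
  obtain ⟨p, hp, hpp⟩ := Nat.exists_infinite_primes (r + 1)
  have : NeZero p := ⟨hpp.ne_zero⟩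
  obtain ⟨ζ, hζ⟩ := HasEnoughRootsOfUnity.exists_primitiveRoot F p
  have h1 := linearIndependent_pow (K := ℚ) ζ
  have h2 : (minpoly ℚ ζ).natDegree = p - 1 := by
    rw [← Polynomial.cyclotomic_eq_minpoly_rat hζ hpp.pos, Polynomial.natDegree_cyclotomic,
      Nat.totient_prime hpp]
  have h3 : r ≤ (minpoly ℚ ζ).natDegree := by omega
  have h4 := h1.comp (Fin.castLE h3) (Fin.castLE_injective h3)
  exact ⟨_, h4.restrict_scalars (R := ℤ) (by
    intro a b hab
    simpa using hab)⟩

section gen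
variable {F L : Type*} [Field F] [CharZero F] [IsAlgClosed F] [LieRing L] [LieAlgebra F L]
  [Module.Finite F L] [LieAlgebra.IsKilling F L] (h : LieSubalgebra F L) [h.IsCartanSubalgebra]

/-- evaluation at a point, on the root lattice -/
def ev {F L : Type*} [Field F] [LieRing L] [LieAlgebra F L] (h : LieSubalgebra F L) (x : h) :
    rl h →ₗ[ℤ] F :=
  ((Module.Dual.eval F h x).restrictScalars ℤ).comp (rl h).subtype

@[simp] lemma ev_apply {F L : Type*} [Field F] [LieRing L] [LieAlgebra F L]
    (h : LieSubalgebra F L) (x : h) (κ : rl h) : ev h x κ = κ.1 x := rfl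

lemma exists_ev_inj : ∃ x : h, Function.Injective (ev h x) := by
  have := rl_finite h
  have := rl_free h
  let b := Module.finBasis ℤ (rl h)
  set r := Module.finrank ℤ (rl h) with hr
  have hr' : r = Module.finrank F h := finrank_rl h
  let v : Fin r → Module.Dual F h := fun i => (b i).1
  have hspan : ⊤ ≤ Submodule.span F (Set.range v) := by
    rw [← span_rts h]
    refine Submodule.span_le.2 fun κ hκ => ?_
    have hk : κ ∈ rl h := Submodule.subset_span hκ
    have h1 := b.sum_repr ⟨κ, hk⟩
    have h2 : κ = ∑ i, (b.repr ⟨κ, hk⟩ i) • v i := by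
      have := congrArg (rl h).subtype h1
      rw [map_sum] at this
      simpa using this.symm
    rw [h2]
    refine Submodule.sum_mem _ fun i _ => ?_
    exact Submodule.smul_of_tower_mem _ _ (Submodule.subset_span ⟨i, rfl⟩)
  have hcard : Fintype.card (Fin r) = Module.finrank F (Module.Dual F h) := by
    rw [Subspace.dual_finrank_eq, Fintype.card_fin, hr']
  have hli := linearIndependent_of_top_le_span_of_card_eq_finrank hspan hcard
  let B := Module.Basis.mk hli hspan
  obtain ⟨c, hc⟩ := exists_indep F r
  let φ : Module.Dual F (Module.Dual F h) := B.constr F c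
  obtain ⟨x, hx⟩ := (Module.evalEquiv F h).surjective φ
  refine ⟨x, ?_⟩
  have hxv : ∀ i, ev h x (b i) = c i := by
    intro i
    have h1 : φ (v i) = c i := by
      have : v i = B i := by simp [B]
      rw [this]
      exact B.constr_basis F c i
    rw [← h1, ← hx]
    rfl
  rw [injective_iff_map_eq_zero]
  intro a ha
  rw [← b.sum_repr a, map_sum] at ha
  simp only [map_smul, hxv] at ha
  have h6 := Fintype.linearIndependent_iff.1 hc _ ha
  rw [← b.sum_repr a]
  exact Finset.sum_eq_zero fun i _ => by rw [h6 i, zero_smul]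
end gen
end E8L

namespace E8L
set_option linter.unusedSectionVars false
set_option linter.unusedVariables false
open LieAlgebra TensorProduct

section bc
attribute [local instance] LieRing.ofAssociativeRing
variable {F L : Type*} [Field F] [LieRing L] [LieAlgebra F L] [Module.Finite F L]
  {ι : Type*} [Fintype ι] [DecidableEq ι] (b : Module.Basis ι F L)
  (K : Type*) [Field K] [Algebra F K]

lemma natTrailingDegree_map_inj {R S : Type*} [CommRing R] [CommRing S] (f : R →+* S)
    (hf : Function.Injective f) (p : Polynomial R) :
    (p.map f).natTrailingDegree = p.natTrailingDegree := by
  by_cases hp : p = 0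
  · simp [hp]
  · have hp' : p.map f ≠ 0 := (Polynomial.map_ne_zero_iff hf).2 hp
    apply le_antisymm
    · apply Polynomial.natTrailingDegree_le_of_ne_zero
      rw [Polynomial.coeff_map, Ne, map_eq_zero_iff f hf]
      simpa using hp
    · apply Polynomial.natTrailingDegree_le_of_ne_zero
      have : (p.map f).coeff (p.map f).natTrailingDegree ≠ 0 :=
        Polynomial.trailingCoeff_nonzero_iff_nonzero.2 hp'
      rw [Polynomial.coeff_map] at this
      exact fun h => this (by rw [h, map_zero])

lemma ad_bc : (LieAlgebra.ad K (K ⊗[F] L)).toLinearMap =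
    LinearMap.tensorProduct F K L L ∘ₗ (LieAlgebra.ad F L).toLinearMap.baseChange K := by
  ext x y
  simp [LinearMap.tensorProduct]

lemma rank_bc : LieAlgebra.rank K (K ⊗[F] L) = LieAlgebra.rank F L := by
  let b := Module.finBasis F L
  rw [LieAlgebra.rank_eq_natTrailingDegree K (K ⊗[F] L) (Algebra.TensorProduct.basis K b),
    LieAlgebra.rank_eq_natTrailingDegree F L b, ad_bc, LinearMap.polyCharpoly_baseChange]
  exact natTrailingDegree_map_inj _ (MvPolynomial.map_injective _ (algebraMap F K).injective) _

/-- the element with given coordinates -/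
noncomputable def elt (y : ι → K) : K ⊗[F] L :=
  (Algebra.TensorProduct.basis K b).repr.symm (Finsupp.equivFunOnFinite.symm y)

lemma charpoly_elt (y : ι → K) : LinearMap.charpoly (LieAlgebra.ad K (K ⊗[F] L) (elt b K y)) =
    (LinearMap.polyCharpoly (LieAlgebra.ad F L).toLinearMap b).map
      (MvPolynomial.aeval y : MvPolynomial ι F →ₐ[F] K).toRingHom := by
  rw [LinearMap.polyCharpoly, LinearMap.polyCharpolyAux_map_aeval]
  congr 1
  have := congrArg (fun f => f (elt b K y)) (ad_bc (F := F) (L := L) K)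
  exact this

lemma regular_elt (y : ι → K) (hy : Function.Injective (MvPolynomial.aeval y : MvPolynomial ι F →ₐ[F] K)) :
    LieAlgebra.IsRegular K (elt b K y) := by
  rw [LieAlgebra.isRegular_iff_natTrailingDegree_charpoly_eq_rank, charpoly_elt, rank_bc,
    LieAlgebra.rank_eq_natTrailingDegree F L b]
  exact natTrailingDegree_map_inj _ hy _

lemma killing_bc [LieAlgebra.IsKilling F L] : LieAlgebra.IsKilling K (K ⊗[F] L) := by
  have h1 : (killingForm F L).Nondegenerate := LieAlgebra.IsKilling.killingForm_nondegenerate F L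
  have h2 : ∀ z : K ⊗[F] L, (∀ w, killingForm K (K ⊗[F] L) z w = 0) → z = 0 := by
    intro z hz
    let b := Module.finBasis F L
    let d := LinearMap.BilinForm.dualBasis (killingForm F L) h1 b
    let B := Algebra.TensorProduct.basis K b
    have h3 : ∀ j, B.repr z j = 0 := by
      intro j
      have h4 := hz (1 ⊗ₜ d j)
      rw [killingForm, LieModule.traceForm_baseChange, ← B.sum_repr z, map_sum,
        LinearMap.sum_apply, Finset.sum_eq_single j] at h4
      · rw [map_smul] at h4
        simp only [B, Algebra.TensorProduct.basis_apply, LinearMap.smul_apply,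
          LinearMap.BilinForm.baseChange_tmul] at h4
        have h5 : (killingForm F L) (b j) (d j) = 1 := by
          rw [LieModule.traceForm_comm]
          have := LinearMap.BilinForm.apply_dualBasis_left (B := killingForm F L) (hB := h1)
            b j j
          simpa using this
        rw [killingForm] at h5
        rw [h5] at h4
        simpa using h4
      · intro i _ hij
        rw [map_smul]
        simp only [B, Algebra.TensorProduct.basis_apply, LinearMap.smul_apply,
          LinearMap.BilinForm.baseChange_tmul]
        have h5 : (killingForm F L) (b i) (d j) = 0 := by
          rw [LieModule.traceForm_comm]
          have := LinearMap.BilinForm.apply_dualBasis_left (B := killingForm F L) (hB := h1)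
            b j i
          rw [if_neg hij] at this
          exact this
        rw [killingForm] at h5
        rw [h5]
        simp
      · intro hj; exact absurd (Finset.mem_univ _) hj
    exact B.ext_elem_iff.2 (by simpa using h3)
  constructor
  ext z
  simp only [LieIdeal.mem_killingCompl, LieSubmodule.mem_bot]
  constructor
  · intro hz
    refine h2 z fun w => ?_
    rw [LieModule.traceForm_comm]
    exact hz w trivial
  · rintro rfl w _
    simp
end bc

lemma cartan_engel {K L : Type*} [Field K] [Infinite K] [LieRing L] [LieAlgebra K L]
    [Module.Finite K L] (x : L) (hx : LieAlgebra.IsRegular K x) :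
    (LieSubalgebra.engel K x).IsCartanSubalgebra := by
  have h : (Module.finrank K L : Cardinal) ≤ Cardinal.mk K := 
    Cardinal.natCast_le_aleph0.trans <| Cardinal.infinite_iff.mp ‹Infinite K›
  refine ⟨?_, LieSubalgebra.normalizer_engel _ _⟩
  apply LieSubalgebra.isNilpotent_of_forall_le_engel
  intro y hy
  set Ex : {LieSubalgebra.engel K z | z ∈ LieSubalgebra.engel K x} :=
    ⟨LieSubalgebra.engel K x, x, LieSubalgebra.self_mem_engel _ _, rfl⟩
  suffices IsBot Ex from @this ⟨LieSubalgebra.engel K y, y, hy, rfl⟩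
  apply engel_isBot_of_isMin h (LieSubalgebra.engel K x) Ex le_rfl
  rintro ⟨_, y, hy, rfl⟩ hyx
  suffices Module.finrank K (LieSubalgebra.engel K x) ≤ Module.finrank K (LieSubalgebra.engel K y) by
    suffices LieSubalgebra.engel K y = LieSubalgebra.engel K x from this.ge
    apply LieSubalgebra.toSubmodule_injective
    exact Submodule.eq_of_le_of_finrank_le hyx this
  rw [(isRegular_iff_finrank_engel_eq_rank K x).mp hx]
  apply rank_le_finrank_engel
end E8L

namespace E8L
set_option linter.unusedSectionVars false
set_option linter.unusedVariables false
open LieAlgebra TensorProduct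

section spec
variable {F R S : Type*} [Field F] [IsAlgClosed F] [CommRing R] [CommRing S]
  [Algebra F R] [Algebra R S] [Algebra.IsIntegral R S] [FaithfulSMul R S] (ε : R →ₐ[F] F)

lemma exists_spec : ∃ ψ : S →+* F, ∀ r : R, ψ (algebraMap R S r) = ε r := by
  have hprime : (RingHom.ker ε.toRingHom).IsPrime := RingHom.ker_isPrime _
  obtain ⟨Q, -, hQ, hQ'⟩ := Ideal.exists_ideal_over_prime_of_isIntegral
    (RingHom.ker ε.toRingHom) (⊥ : Ideal S) (by
      intro r hr
      have : algebraMap R S r = 0 := by simpa using hr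
      have h2 : r = 0 := (FaithfulSMul.algebraMap_injective R S) (by rw [this, map_zero])
      rw [h2]; exact zero_mem _)
  let f : F →+* S ⧸ Q := (Ideal.Quotient.mk Q).comp ((algebraMap R S).comp (algebraMap F R))
  have hf : ∀ r, f (ε r) = Ideal.Quotient.mk Q (algebraMap R S r) := by
    intro r
    show Ideal.Quotient.mk Q (algebraMap R S (algebraMap F R (ε r))) = _
    rw [Ideal.Quotient.eq, ← map_sub]
    have : algebraMap F R (ε r) - r ∈ RingHom.ker ε.toRingHom := by
      rw [RingHom.mem_ker]
      show ε _ = 0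
      rw [map_sub, AlgHom.commutes]
      simp
    rw [← hQ'] at this
    exact this
  have hintg : f.IsIntegral := by
    intro x
    obtain ⟨s, rfl⟩ := Ideal.Quotient.mk_surjective x
    obtain ⟨p, hp, hps⟩ := Algebra.IsIntegral.isIntegral (R := R) s
    refine ⟨p.map ε.toRingHom, hp.map _, ?_⟩
    rw [Polynomial.eval₂_map]
    have h1 : f.comp ε.toRingHom = (Ideal.Quotient.mk Q).comp (algebraMap R S) := by
      ext r; exact hf r
    rw [h1, ← Polynomial.hom_eval₂, hps, map_zero]
  have hbij := IsAlgClosed.ringHom_bijective_of_isIntegral f hintg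
  let e := RingEquiv.ofBijective f hbij
  refine ⟨e.symm.toRingHom.comp (Ideal.Quotient.mk Q), fun r => ?_⟩
  show e.symm (Ideal.Quotient.mk Q (algebraMap R S r)) = ε r
  rw [← hf r]
  exact e.symm_apply_apply _

end spec

section spec2
variable {F R K : Type*} [Field F] [IsAlgClosed F] [CommRing R] [IsDomain R] [Field K] [IsAlgClosed K]
  [Algebra F R] [Algebra R K] [FaithfulSMul R K]

lemma spec_roots (ε : R →ₐ[F] F) : ∃ ψ : integralClosure R K →+* F, ∀ P : Polynomial R, P.Monic →
    (∀ a : integralClosure R K, (P.map (algebraMap R K)).IsRoot a → (P.map ε.toRingHom).IsRoot (ψ a)) ∧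
    (∀ c, (P.map ε.toRingHom).IsRoot c → ∃ a : integralClosure R K,
      (P.map (algebraMap R K)).IsRoot a ∧ ψ a = c) := by
  have : FaithfulSMul R (integralClosure R K) := by
    rw [faithfulSMul_iff_algebraMap_injective]
    intro a b hab
    exact FaithfulSMul.algebraMap_injective R K (congrArg Subtype.val hab)
  obtain ⟨ψ, hψ⟩ := exists_spec (S := integralClosure R K) ε
  have hψ' : ψ.comp (algebraMap R (integralClosure R K)) = ε.toRingHom := RingHom.ext hψ
  refine ⟨ψ, fun P hP => ⟨fun a ha => ?_, fun c hc => ?_⟩⟩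
  · rw [Polynomial.IsRoot, Polynomial.eval_map] at ha ⊢
    have h1 : P.eval₂ (algebraMap R (integralClosure R K)) a = 0 := by
      apply Subtype.val_injective
      show (integralClosure R K).val.toRingHom _ = 0
      rw [Polynomial.hom_eval₂]
      exact ha
    rw [← hψ', ← Polynomial.hom_eval₂, h1, map_zero]
  · -- factor `P` over the integral closure
    have hsp : (P.map (algebraMap R K)).Splits := IsAlgClosed.splits _
    have hm : (P.map (algebraMap R K)).Monic := hP.map _
    have hintg : ∀ a ∈ (P.map (algebraMap R K)).roots, a ∈ integralClosure R K := by
      intro a ha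
      refine ⟨P, hP, ?_⟩
      rw [← Polynomial.eval_map]
      exact (Polynomial.mem_roots hm.ne_zero).1 ha
    let s : Multiset (integralClosure R K) := (P.map (algebraMap R K)).roots.attach.map
      fun a => ⟨a.1, hintg a.1 a.2⟩
    have hs : s.map Subtype.val = (P.map (algebraMap R K)).roots := by
      simp only [s, Multiset.map_map, Function.comp_def]
      exact Multiset.attach_map_val _
    have hfac : P.map (algebraMap R (integralClosure R K)) =
        (s.map fun a => Polynomial.X - Polynomial.C a).prod := by
      apply Polynomial.map_injective (integralClosure R K).val.toRingHom Subtype.val_injective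
      rw [Polynomial.map_map, Polynomial.map_multiset_prod, Multiset.map_map]
      have h1 : (integralClosure R K).val.toRingHom.comp (algebraMap R (integralClosure R K)) =
        algebraMap R K := rfl
      rw [h1]
      have h2 := hsp.eq_prod_roots_of_monic hm
      rw [h2, ← hs, Multiset.map_map]
      congr 1
      apply Multiset.map_congr rfl
      intro a _
      simp
    have h3 : P.map ε.toRingHom = (s.map fun a => Polynomial.X - Polynomial.C (ψ a)).prod := by
      rw [← hψ', ← Polynomial.map_map, hfac, Polynomial.map_multiset_prod, Multiset.map_map]
      congr 1
      apply Multiset.map_congr rfl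
      intro a _
      simp
    rw [h3, Polynomial.IsRoot, Polynomial.eval_multiset_prod, Multiset.prod_eq_zero_iff] at hc
    rw [Multiset.map_map, Multiset.mem_map] at hc
    obtain ⟨a, ha, hac⟩ := hc
    refine ⟨a, ?_, ?_⟩
    · rw [← Polynomial.mem_roots hm.ne_zero, ← hs]
      exact Multiset.mem_map_of_mem _ ha
    · simp only [Function.comp_apply, Polynomial.eval_sub, Polynomial.eval_X,
        Polynomial.eval_C] at hac
      exact (sub_eq_zero.1 hac).symm
end spec2
end E8L

namespace E8L
set_option linter.unusedSectionVars false
set_option linter.unusedVariables false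
open LieAlgebra TensorProduct

/-- root lattice isomorphism -/
def RIso {F L K M : Type*} [Field F] [LieRing L] [LieAlgebra F L] [Field K] [LieRing M]
    [LieAlgebra K M] (C : LieSubalgebra K M) (h : LieSubalgebra F L) : Prop :=
  ∃ Φ : rl C ≃ₗ[ℤ] rl h, ∀ κ : rl C, κ.1 ∈ rts C ↔ (Φ κ).1 ∈ rts h

section tr
attribute [local instance] LieRing.ofAssociativeRing
variable {F L : Type*} [Field F] [CharZero F] [IsAlgClosed F] [LieRing L] [LieAlgebra F L]
  [Module.Finite F L] [LieAlgebra.IsKilling F L]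
  {ι : Type*} [Fintype ι] [DecidableEq ι] (b : Module.Basis ι F L)
  {K : Type*} [Field K] [CharZero K] [IsAlgClosed K] [Algebra F K] [Algebra (MvPolynomial ι F) K]
  [IsScalarTower F (MvPolynomial ι F) K] [FaithfulSMul (MvPolynomial ι F) K]
  [LieAlgebra.IsKilling K (K ⊗[F] L)]

/-- generic element -/
noncomputable def gX : K ⊗[F] L := elt b K (fun i => algebraMap (MvPolynomial ι F) K (MvPolynomial.X i))

lemma aeval_gX : (MvPolynomial.aeval (fun i => algebraMap (MvPolynomial ι F) K (MvPolynomial.X i)) :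
    MvPolynomial ι F →ₐ[F] K).toRingHom = algebraMap (MvPolynomial ι F) K := by
  have : (MvPolynomial.aeval (fun i => algebraMap (MvPolynomial ι F) K (MvPolynomial.X i)) :
    MvPolynomial ι F →ₐ[F] K) = IsScalarTower.toAlgHom F (MvPolynomial ι F) K := by
    apply MvPolynomial.algHom_ext
    intro i
    simp
  rw [this]
  rfl

lemma charpoly_gX : LinearMap.charpoly (LieAlgebra.ad K (K ⊗[F] L) (gX b)) =
    (LinearMap.polyCharpoly (LieAlgebra.ad F L).toLinearMap b).map
      (algebraMap (MvPolynomial ι F) K) := by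
  rw [gX, charpoly_elt, aeval_gX]

lemma regular_gX : LieAlgebra.IsRegular K (gX b : K ⊗[F] L) := by
  apply regular_elt
  have := FaithfulSMul.algebraMap_injective (MvPolynomial ι F) K
  rw [← aeval_gX] at this
  exact this

lemma transfer (C : LieSubalgebra K (K ⊗[F] L)) [C.IsCartanSubalgebra]
    (hC : LieSubalgebra.engel K (gX b : K ⊗[F] L) = C) (h : LieSubalgebra F L)
    [h.IsCartanSubalgebra] : RIso C h ∧ Module.finrank F h = Module.finrank K C := by
  obtain ⟨x, hx⟩ := exists_ev_inj h
  have hX : (gX b : K ⊗[F] L) ∈ C := hC ▸ LieSubalgebra.self_mem_engel K _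
  let P := LinearMap.polyCharpoly (LieAlgebra.ad F L).toLinearMap b
  have hP : P.Monic := LinearMap.polyCharpoly_monic _ _
  let ε : MvPolynomial ι F →ₐ[F] F := MvPolynomial.aeval (b.repr (x : L))
  have hε : P.map ε.toRingHom = LinearMap.charpoly (LieAlgebra.ad F L (x : L)) := by
    have := LinearMap.polyCharpoly_map_eq_charpoly (LieAlgebra.ad F L).toLinearMap b (x : L)
    exact this
  obtain ⟨ψ, hψ⟩ := spec_roots (K := K) ε
  obtain ⟨hψ1, hψ2⟩ := hψ P hP
  have hPX := charpoly_gX (K := K) b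
  have hval : ∀ κ : Module.Dual K C, κ ∈ rts C →
      (P.map (algebraMap (MvPolynomial ι F) K)).IsRoot (κ ⟨gX b, hX⟩) := by
    intro κ hκ
    have := root_of_rts C hκ ⟨gX b, hX⟩
    rw [← hPX]
    exact this
  have hintg : ∀ κ : rl C, ev C ⟨gX b, hX⟩ κ ∈ integralClosure (MvPolynomial ι F) K := by
    rintro ⟨κ, hκ⟩
    show κ ⟨gX b, hX⟩ ∈ _
    induction hκ using Submodule.span_induction with
    | mem κ hκ =>
      refine ⟨P, hP, ?_⟩
      rw [← Polynomial.eval_map]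
      exact hval κ hκ
    | zero => simp
    | add a c _ _ ha hc => exact add_mem ha hc
    | smul n a _ ha => 
      rw [LinearMap.smul_apply]
      exact zsmul_mem ha n
  let g : rl C →ₗ[ℤ] F := AddMonoidHom.toIntLinearMap
    { toFun := fun κ => ψ ⟨ev C ⟨gX b, hX⟩ κ, hintg κ⟩
      map_zero' := by
        rw [← map_zero ψ]; congr 1
      map_add' := fun a c => by
        rw [← map_add ψ]; congr 1 }
  have hg : ∀ κ, g κ = ψ ⟨ev C ⟨gX b, hX⟩ κ, hintg κ⟩ := fun _ => rfl
  have hgroot : ∀ κ : rl C, κ.1 ∈ rts C → g κ = 0 ∨ ∃ l ∈ rts h, l x = g κ := by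
    intro κ hκ
    have := hψ1 ⟨ev C ⟨gX b, hX⟩ κ, hintg κ⟩ (hval κ.1 hκ)
    rw [hε] at this
    exact rts_of_root h x this
  have hne : ∀ l ∈ rts h, l x ≠ 0 := by
    intro l hl h0
    have h1 : ev h x ⟨l, Submodule.subset_span hl⟩ = ev h x 0 := by
      rw [map_zero]; exact h0
    have := hx h1
    exact hl.1 (congrArg Subtype.val this)
  have hlift : ∀ l ∈ rts h, ∃ κ : rl C, κ.1 ∈ rts C ∧ g κ = l x := by
    intro l hl
    have h1 := root_of_rts h hl x
    rw [← hε] at h1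
    obtain ⟨a, ha, hac⟩ := hψ2 _ h1
    rw [← hPX] at ha
    rcases rts_of_root C ⟨gX b, hX⟩ ha with h0 | ⟨κ, hκ, hκa⟩
    · exfalso
      apply hne l hl
      rw [← hac]
      have : a = 0 := Subtype.ext h0
      rw [this, map_zero]
    · refine ⟨⟨κ, Submodule.subset_span hκ⟩, hκ, ?_⟩
      rw [hg, ← hac]
      congr 1
      exact Subtype.ext hκa
  have hrange1 : ∀ κ : rl C, g κ ∈ LinearMap.range (ev h x) := by
    rintro ⟨κ, hκ⟩
    have h1 : (⊤ : Submodule ℤ (rl C)) ≤ (LinearMap.range (ev h x)).comap g := by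
      have h2 : Submodule.span ℤ {κ : rl C | κ.1 ∈ rts C} = ⊤ := Submodule.span_span_coe_preimage
      rw [← h2, Submodule.span_le]
      intro κ hκ
      rcases hgroot κ hκ with h0 | ⟨l, hl, hlx⟩
      · have : g κ ∈ LinearMap.range (ev h x) := by rw [h0]; exact zero_mem _
        exact this
      · exact ⟨⟨l, Submodule.subset_span hl⟩, hlx⟩
    exact h1 trivial
  let Φ : rl C →ₗ[ℤ] rl h := (LinearEquiv.ofInjective (ev h x) hx).symm.toLinearMap ∘ₗ
    g.codRestrict _ hrange1
  have hΦ : ∀ κ, (Φ κ).1 x = g κ := by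
    intro κ
    have := congrArg Subtype.val
      ((LinearEquiv.ofInjective (ev h x) hx).apply_symm_apply ⟨g κ, hrange1 κ⟩)
    exact this
  have hsurj : Function.Surjective Φ := by
    rw [← LinearMap.range_eq_top, eq_top_iff]
    have h2 : Submodule.span ℤ {κ : rl h | κ.1 ∈ rts h} = ⊤ := Submodule.span_span_coe_preimage
    rw [← h2, Submodule.span_le]
    intro l hl
    obtain ⟨κ, _, hk⟩ := hlift l.1 hl
    refine ⟨κ, hx ?_⟩
    rw [ev_apply, ev_apply, hΦ, hk]
  have := rl_finite C
  have := rl_free C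
  have := rl_finite h
  have := rl_free h
  have hd1 : Module.finrank ℤ (rl h) ≤ Module.finrank ℤ (rl C) :=
    LinearMap.finrank_le_finrank_of_surjective hsurj
  have hd2 : Module.finrank K C = LieAlgebra.rank F L := by
    rw [← rank_bc (F := F) (L := L) K, ← hC]
    exact (isRegular_iff_finrank_engel_eq_rank K _).1 (regular_gX b)
  have hd3 : LieAlgebra.rank F L ≤ Module.finrank F h := by
    have h1 := engel_eq h x hne
    have h2 := LieAlgebra.rank_le_finrank_engel F (x : L)
    rwa [h1] at h2
  rw [finrank_rl, finrank_rl] at hd1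
  have hd : Module.finrank F h = Module.finrank K C := by omega
  have hd' : Module.finrank ℤ (rl h) = Module.finrank ℤ (rl C) := by rw [finrank_rl, finrank_rl, hd]
  refine ⟨?_, hd⟩
  let e : rl h ≃ₗ[ℤ] rl C := LinearEquiv.ofFinrankEq _ _ hd'
  have hinj : Function.Injective Φ := by
    have h1 : Function.Surjective (e.toLinearMap ∘ₗ Φ) := e.surjective.comp hsurj
    have h2 := OrzechProperty.injective_of_surjective_endomorphism _ h1
    exact Function.Injective.of_comp (f := e) h2
  refine ⟨LinearEquiv.ofBijective Φ ⟨hinj, hsurj⟩, fun κ => ?_⟩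
  show _ ↔ (Φ κ).1 ∈ rts h
  constructor
  · intro hκ
    rcases hgroot κ hκ with h0 | ⟨l, hl, hlx⟩
    · exfalso
      have h1 : Φ κ = 0 := hx (by rw [ev_apply, hΦ, h0, map_zero])
      have h2 : κ = 0 := hinj (by rw [h1, map_zero])
      exact hκ.1 (congrArg Subtype.val h2)
    · have h1 : Φ κ = ⟨l, Submodule.subset_span hl⟩ := hx (by rw [ev_apply, hΦ, ← hlx]; rfl)
      rw [h1]; exact hl
  · intro hl
    obtain ⟨κ', hκ', hk⟩ := hlift _ hl
    have h1 : Φ κ' = Φ κ := hx (by rw [ev_apply, hΦ, hk]; rfl)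
    rw [← hinj h1]; exact hκ'
end tr

section final
variable {F L : Type*} [Field F] [CharZero F] [IsAlgClosed F] [LieRing L] [LieAlgebra F L]
  [Module.Finite F L] [LieAlgebra.IsKilling F L]

theorem transfer_cartan (H h : LieSubalgebra F L) [H.IsCartanSubalgebra] [h.IsCartanSubalgebra] :
    RIso H h ∧ Module.finrank F h = Module.finrank F H := by
  let b := Module.finBasis F L
  let R := MvPolynomial (Fin (Module.finrank F L)) F
  let K := AlgebraicClosure (FractionRing R)
  have : CharZero K := charZero_of_injective_algebraMap (algebraMap F K).injective
  have : FaithfulSMul R K := by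
    rw [faithfulSMul_iff_algebraMap_injective, IsScalarTower.algebraMap_eq R (FractionRing R) K]
    exact (algebraMap (FractionRing R) K).injective.comp (IsFractionRing.injective R _)
  have := killing_bc (F := F) (L := L) K
  have hreg := regular_gX (K := K) b
  have := cartan_engel _ hreg
  obtain ⟨⟨Φ1, h1⟩, d1⟩ := transfer (K := K) b _ rfl H
  obtain ⟨⟨Φ2, h2⟩, d2⟩ := transfer (K := K) b _ rfl h
  refine ⟨⟨Φ1.symm.trans Φ2, fun κ => ?_⟩, by rw [d1, d2]⟩
  rw [LinearEquiv.trans_apply, ← h2, h1, LinearEquiv.apply_symm_apply]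

theorem transfer_base (H h : LieSubalgebra F L) [H.IsCartanSubalgebra] [h.IsCartanSubalgebra]
    (α : Fin 8 → Module.Dual F H) (hα : IsE8Base H α) : ∃ l, IsE8Base h l := by
  obtain ⟨⟨Φ, hΦ⟩, -⟩ := transfer_cartan H h
  have hmem : ∀ i, α i ∈ rts H := by
    intro i
    rw [hα]
    refine ⟨Pi.single i 1, q_single i, ?_⟩
    rw [Finset.sum_eq_single i]
    · simp
    · intro j _ hj; simp [hj]
    · simp
  let a : Fin 8 → rl H := fun i => ⟨α i, Submodule.subset_span (hmem i)⟩
  refine ⟨fun i => (Φ (a i)).1, fun κ => ?_⟩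
  have key : ∀ n : Fin 8 → ℤ, ∑ i, n i • (Φ (a i)).1 = (Φ (∑ i, n i • a i)).1 := by
    intro n
    have h1 : Φ.toLinearMap (∑ i, n i • a i) = ∑ i, n i • Φ.toLinearMap (a i) := by
      simp only [map_sum, map_smul]
    have h2 := congrArg (rl h).subtype h1
    have h3 : (rl h).subtype (∑ i, n i • Φ.toLinearMap (a i)) = ∑ i, n i • (Φ (a i)).1 := by
      simp only [map_sum, map_smul]
      rfl
    rw [← h3, ← h2]
    rfl
  have key2 : ∀ n : Fin 8 → ℤ, (∑ i, n i • a i).1 = ∑ i, n i • α i := by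
    intro n
    simp [a]
  constructor
  · intro hκ
    have h1 : (Φ.symm ⟨κ, Submodule.subset_span hκ⟩).1 ∈ rts H := by
      rw [hΦ, LinearEquiv.apply_symm_apply]; exact hκ
    obtain ⟨n, hn, hn'⟩ := (hα _).1 h1
    refine ⟨n, hn, ?_⟩
    rw [key]
    have h2 : Φ.symm ⟨κ, Submodule.subset_span hκ⟩ = ∑ i, n i • a i := 
      Subtype.ext (by rw [hn', key2])
    rw [← h2, LinearEquiv.apply_symm_apply]
  · rintro ⟨n, hn, rfl⟩
    rw [key, ← hΦ, key2, hα]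
    exact ⟨n, hn, rfl⟩
end final
end E8L

namespace E8L
set_option linter.unusedSectionVars false
set_option linter.unusedVariables false
open LieAlgebra

section basics
variable {F L : Type*} [Field F] [LieRing L] [LieAlgebra F L] {h : LieSubalgebra F L}
  {l : Fin 8 → Module.Dual F h} (hl : IsE8Base h l)

lemma sum_single (l : Fin 8 → Module.Dual F h) (i : Fin 8) :
    ∑ j, (Pi.single i 1 : Fin 8 → ℤ) j • l j = l i := by
  rw [Finset.sum_eq_single i]
  · simp
  · intro j _ hj; simp [hj]
  · simp

include hl in
lemma base_mem (i : Fin 8) : l i ∈ rts h :=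
  (hl _).2 ⟨Pi.single i 1, q_single i, (sum_single l i).symm⟩

/-- the reflected base -/
def refl (l : Fin 8 → Module.Dual F h) (n : Fin 8 → ℤ) : Fin 8 → Module.Dual F h :=
  fun j => l j - pr n j • ∑ i, n i • l i

lemma refl_sum (l : Fin 8 → Module.Dual F h) (n k : Fin 8 → ℤ) :
    ∑ j, k j • refl l n j = ∑ j, (k - bil k n • n) j • l j := by
  simp only [refl, smul_sub, smul_smul, Finset.sum_sub_distrib, Pi.sub_apply, sub_smul,
    Pi.smul_apply, smul_eq_mul]
  congr 1
  rw [← Finset.sum_smul, bil_comm, bil, Finset.smul_sum]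
  simp only [smul_smul]

include hl in
lemma base_refl {n : Fin 8 → ℤ} (hn : q n = 2) : IsE8Base h (refl l n) := by
  intro κ
  rw [hl κ]
  constructor
  · rintro ⟨k, hk, rfl⟩
    refine ⟨k - bil k n • n, by rw [q_reflect hn, hk], ?_⟩
    rw [refl_sum]
    congr 1
    funext j
    congr 1
    have h1 : bil (k - bil k n • n) n = - bil k n := by
      rw [bil_comm, bil]
      have : ∀ i, (k - bil k n • n) i * pr n i = k i * pr n i - bil k n * (n i * pr n i) := by
        intro i; simp; ring
      simp only [this, Finset.sum_sub_distrib, ← Finset.mul_sum]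
      have e1 : ∑ i, k i * pr n i = bil k n := by rw [bil_comm]; rfl
      have e2 : ∑ i, n i * pr n i = 2 := by rw [← hn, ← bil_self]; rfl
      rw [e1, e2]; ring
    rw [h1]
    simp
  · rintro ⟨k, hk, rfl⟩
    exact ⟨_, by rw [q_reflect hn, hk], refl_sum l n k⟩

lemma int_indep [CharZero F] (hli : LinearIndependent F l) {n k : Fin 8 → ℤ}
    (hnk : ∑ i, n i • l i = ∑ i, k i • l i) : n = k := by
  have h1 : LinearIndependent ℤ l := hli.restrict_scalars (R := ℤ) (by
    intro a b hab
    simpa using hab)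
  have h2 := Fintype.linearIndependent_iff.1 h1 (n - k) (by
    simp only [Pi.sub_apply, sub_smul, Finset.sum_sub_distrib, hnk, sub_self])
  funext i
  have := h2 i
  simpa [sub_eq_zero] using this
end basics

section kil
variable {F L : Type*} [Field F] [CharZero F] [IsAlgClosed F] [LieRing L] [LieAlgebra F L]
  [Module.Finite F L] [LieAlgebra.IsKilling F L] {h : LieSubalgebra F L} [h.IsCartanSubalgebra]
  (hd : Module.finrank F h = 8)
  {l : Fin 8 → Module.Dual F h} (hl : IsE8Base h l)

include hl in
lemma base_span : ⊤ ≤ Submodule.span F (Set.range l) := by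
  rw [← span_rts h]
  refine Submodule.span_le.2 fun κ hκ => ?_
  obtain ⟨n, _, rfl⟩ := (hl κ).1 hκ
  refine Submodule.sum_mem _ fun i _ => ?_
  exact Submodule.smul_of_tower_mem _ _ (Submodule.subset_span ⟨i, rfl⟩)

include hl hd in
lemma base_indep : LinearIndependent F l :=
  linearIndependent_of_top_le_span_of_card_eq_finrank (base_span hl) (by
    rw [Subspace.dual_finrank_eq, hd, Fintype.card_fin])

/-- every choice of values is realised -/
lemma base_values (hd : Module.finrank F h = 8) (hl : IsE8Base h l) (c : Fin 8 → F) :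
    ∃ x : h, ∀ i, l i x = c i := by
  let B := Module.Basis.mk (base_indep hd hl) (base_span hl)
  obtain ⟨x, hx⟩ := (Module.evalEquiv F h).surjective (B.constr F c)
  refine ⟨x, fun i => ?_⟩
  have h1 : B.constr F c (l i) = c i := by
    have : l i = B i := by simp [B]
    rw [this]
    exact B.constr_basis F c i
  rw [← h1, ← hx]
  rfl

include hl in
lemma base_sep {x : h} (hx : ∀ i, l i x = 0) : x = 0 := by
  rw [← Module.forall_dual_apply_eq_zero_iff F]
  intro f
  have hf : f ∈ Submodule.span F (Set.range l) := base_span hl trivial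
  induction hf using Submodule.span_induction with
  | mem f hf => obtain ⟨i, rfl⟩ := hf; exact hx i
  | zero => rfl
  | add a b _ _ ha hb => rw [LinearMap.add_apply, ha, hb, add_zero]
  | smul c a _ ha => rw [LinearMap.smul_apply, ha, smul_zero]

/-- move to the positive chamber -/
lemma chamber (v : Module.Dual F h →+ ℚ) (hv : ∀ κ ∈ rts h, v κ ≠ 0) (hl : IsE8Base h l) :
    ∃ l' : Fin 8 → Module.Dual F h, IsE8Base h l' ∧ ∀ i, 0 < v (l' i) := by
  obtain ⟨D, hD, x, hx⟩ : ∃ D : ℚ, 0 < D ∧ ∃ x : Fin 8 → ℤ, ∀ i, v (l i) * D = x i := by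
    refine ⟨∏ i, ((v (l i)).den : ℚ), Finset.prod_pos fun i _ => by
      exact_mod_cast (v (l i)).den_pos, fun i => (v (l i)).num * ∏ j ∈ Finset.univ.erase i,
        ((v (l j)).den : ℤ), fun i => ?_⟩
    rw [← Finset.mul_prod_erase _ _ (Finset.mem_univ i), ← mul_assoc, Rat.mul_den_eq_num]
    push_cast
    rfl
  have key := chamber_aux (fun x => ∀ l : Fin 8 → Module.Dual F h, IsE8Base h l →
    (∀ i, v (l i) * D = x i) → ∃ l' : Fin 8 → Module.Dual F h, IsE8Base h l' ∧ ∀ i, 0 < v (l' i))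
    ?_ ?_ x
  · exact key l hl hx
  · intro x i hi ih l hl hx
    refine ih (refl l (Pi.single i 1)) (base_refl hl (q_single i)) ?_
    intro j
    rw [refl, sum_single, map_sub, map_zsmul, pr_single, sub_mul, hx, zsmul_eq_mul, mul_assoc, hx]
    push_cast
    ring
  · intro x hx0 l hl hx
    refine ⟨l, hl, fun i => ?_⟩
    have h1 : 0 ≤ v (l i) * D := by rw [hx]; exact_mod_cast hx0 i
    have h2 : 0 ≤ v (l i) := nonneg_of_mul_nonneg_left h1 hD
    exact lt_of_le_of_ne h2 (hv _ (base_mem hl i)).symm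
end kil
end E8L

namespace E8L
set_option linter.unusedSectionVars false
set_option linter.unusedVariables false
open LieAlgebra

section perm
variable {F L : Type*} [Field F] [LieRing L] [LieAlgebra F L]

lemma rts_comp {h : LieSubalgebra F L} (T T' : Module.End F L)
    (hT' : ∀ x y, T' ⁅x, y⁆ = ⁅T' x, T' y⁆) (h1 : ∀ x, T (T' x) = x) (h2 : ∀ x, T' (T x) = x)
    (hst : ∀ x ∈ h.toSubmodule, T x ∈ h.toSubmodule)
    (hst' : ∀ x ∈ h.toSubmodule, T' x ∈ h.toSubmodule) {κ : Module.Dual F h}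
    (hκ : κ ∈ rts h) : κ ∘ₗ (T.restrict hst : h →ₗ[F] h) ∈ rts h := by
  obtain ⟨h0, v, hv0, hv⟩ := hκ
  refine ⟨?_, T' v, ?_, ?_⟩
  · intro hz
    apply h0
    ext y
    have h3 := congrArg (fun f : Module.Dual F h => f ⟨T' y, hst' y y.2⟩) hz
    have h4 : (T.restrict hst : h →ₗ[F] h) ⟨T' y, hst' y y.2⟩ = y := Subtype.ext (h1 _)
    have h5 : κ ((T.restrict hst : h →ₗ[F] h) ⟨T' y, hst' y y.2⟩) = 0 := h3
    rw [h4] at h5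
    exact h5
  · intro hz
    apply hv0
    rw [← h1 v, hz, map_zero]
  · intro y
    have h3 := hv ((T.restrict hst : h →ₗ[F] h) y)
    have h4 : (((T.restrict hst : h →ₗ[F] h) y : h) : L) = T y := rfl
    rw [h4] at h3
    have h5 := congrArg T' h3
    rw [hT', h2, map_smul] at h5
    exact h5

lemma exists_single {s : Fin 8 → ℤ} {t : Fin 8 → ℤ} (hs : ∀ j, 0 ≤ s j) (ht : ∀ j, 1 ≤ t j)
    (hst : ∑ j, s j * t j = 1) : ∃ j, s = Pi.single j 1 := by
  have h1 : ∃ j, s j ≠ 0 := by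
    by_contra hc
    push Not at hc
    simp [hc] at hst
  obtain ⟨j, hj⟩ := h1
  refine ⟨j, ?_⟩
  have hjp : 1 ≤ s j := by have := hs j; omega
  have h2 : s j * t j + ∑ k ∈ Finset.univ.erase j, s k * t k = 1 := by
    rw [← hst]; exact Finset.add_sum_erase Finset.univ (fun j => s j * t j) (Finset.mem_univ j)
  have h3 : ∀ k, 0 ≤ s k * t k := fun k => mul_nonneg (hs k) (by have := ht k; omega)
  have h4 : 0 ≤ ∑ k ∈ Finset.univ.erase j, s k * t k := Finset.sum_nonneg fun k _ => h3 k
  have h5 : 1 ≤ s j * t j := by have := ht j; nlinarith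
  have h6 : ∑ k ∈ Finset.univ.erase j, s k * t k = 0 := by omega
  have h7 : s j * t j = 1 := by omega
  have h8 : s j = 1 := by have := ht j; nlinarith
  funext k
  by_cases hk : k = j
  · subst hk; simp [h8]
  · rw [Pi.single_eq_of_ne hk]
    have h9 := (Finset.sum_eq_zero_iff_of_nonneg (fun k _ => h3 k)).1 h6 k
      (Finset.mem_erase.2 ⟨hk, Finset.mem_univ k⟩)
    have := ht k
    rcases mul_eq_zero.1 h9 with h | h
    · exact h
    · omega
end perm

section main
variable {F L : Type*} [Field F] [CharZero F] [IsAlgClosed F] [LieRing L] [LieAlgebra F L]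
  [Module.Finite F L] [LieAlgebra.IsKilling F L] {h : LieSubalgebra F L} [h.IsCartanSubalgebra]

lemma pos_of_root {l : Fin 8 → Module.Dual F h} (v : Module.Dual F h →+ ℚ) (hpos : ∀ i, 0 < v (l i))
    {n : Fin 8 → ℤ} (hn : q n = 2) (hv : 0 < v (∑ i, n i • l i)) : ∀ i, 0 ≤ n i := by
  rcases root_sign hn with h1 | h1
  · exact h1
  · exfalso
    have h2 : v (∑ i, n i • l i) ≤ 0 := by
      rw [map_sum]
      refine Finset.sum_nonpos fun i _ => ?_
      rw [map_zsmul, zsmul_eq_mul]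
      have h3 : ((n i : ℤ) : ℚ) ≤ 0 := by exact_mod_cast h1 i
      exact mul_nonpos_of_nonpos_of_nonneg h3 (hpos i).le
    linarith

theorem fix_h (T T' : Module.End F L) (hT : ∀ x y, T ⁅x, y⁆ = ⁅T x, T y⁆)
    (hT' : ∀ x y, T' ⁅x, y⁆ = ⁅T' x, T' y⁆) (h1 : ∀ x, T (T' x) = x) (h2 : ∀ x, T' (T x) = x)
    (hst : ∀ x ∈ h.toSubmodule, T x ∈ h.toSubmodule)
    (hst' : ∀ x ∈ h.toSubmodule, T' x ∈ h.toSubmodule)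
    (hcent : ∀ y : L, (∀ x ∈ h, T x = x → ⁅x, y⁆ = 0) → y ∈ h)
    (hd : Module.finrank F h = 8) (l0 : Fin 8 → Module.Dual F h) (hl0 : IsE8Base h l0) :
    ∀ x ∈ h, T x = x := by
  let τ : h →ₗ[F] h := T.restrict hst
  let τ' : h →ₗ[F] h := T'.restrict hst'
  have hτ : ∀ κ ∈ rts h, κ ∘ₗ τ ∈ rts h := fun κ hκ => rts_comp T T' hT' h1 h2 hst hst' hκ
  have hτ' : ∀ κ ∈ rts h, κ ∘ₗ τ' ∈ rts h := fun κ hκ => rts_comp T' T hT h2 h1 hst' hst hκ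
  have hττ' : ∀ x, τ (τ' x) = x := fun x => Subtype.ext (h1 _)
  have hτ'τ : ∀ x, τ' (τ x) = x := fun x => Subtype.ext (h2 _)
  -- a regular fixed element
  let t : Submodule F h := LinearMap.ker (τ - LinearMap.id)
  have ht : ∀ x, x ∈ t ↔ τ x = x := by
    intro x
    rw [LinearMap.mem_ker, LinearMap.sub_apply, LinearMap.id_apply, sub_eq_zero]
  have : Finite (rts h) := (finite_rts h).to_subtype
  obtain ⟨x0, hx0t, hx0⟩ := Module.Dual.exists_forall_mem_ne_zero_of_forall_exists t
    (fun κ : rts h => κ.1) (by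
      rintro ⟨κ, hκ⟩
      by_contra hc
      push Not at hc
      obtain ⟨h0, v, hv0, hv⟩ := hκ
      have hvh : v ∈ h := by
        apply hcent
        intro x hx hTx
        have h5 : κ ⟨x, hx⟩ = 0 := hc ⟨x, hx⟩ ((ht _).2 (Subtype.ext hTx))
        rw [hv ⟨x, hx⟩, h5, zero_smul]
      apply h0
      ext y
      have h6 : ⁅y, (⟨v, hvh⟩ : h)⁆ = 0 := trivial_lie_zero h h _ _
      have h7 : ⁅(y : L), v⁆ = 0 := congrArg Subtype.val h6
      rw [hv] at h7
      exact (smul_eq_zero.1 h7).resolve_right hv0)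
  have hx0' : τ x0 = x0 := (ht _).1 hx0t
  have hx0'' : τ' x0 = x0 := by conv_lhs => rw [← hx0', hτ'τ]
  obtain ⟨φ, hφ⟩ := Module.exists_dual_forall_apply_ne_zero (K := ℚ) (fun κ : rts h => κ.1 x0) hx0
  let v : Module.Dual F h →+ ℚ := φ.toAddMonoidHom.comp (Module.Dual.eval F h x0).toAddMonoidHom
  have hvdef : ∀ κ, v κ = φ (κ x0) := fun _ => rfl
  obtain ⟨l, hl, hpos⟩ := chamber v (fun κ hκ => hφ ⟨κ, hκ⟩) hl0
  have hli := base_indep hd hl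
  -- expansions
  have hex : ∀ i, ∃ n : Fin 8 → ℤ, q n = 2 ∧ l i ∘ₗ τ = ∑ j, n j • l j := fun i =>
    (hl _).1 (hτ _ (base_mem hl i))
  have hex' : ∀ i, ∃ n : Fin 8 → ℤ, q n = 2 ∧ l i ∘ₗ τ' = ∑ j, n j • l j := fun i =>
    (hl _).1 (hτ' _ (base_mem hl i))
  choose s hsq hs using hex
  choose r hrq hr using hex'
  have hs0 : ∀ i j, 0 ≤ s i j := by
    intro i
    apply pos_of_root v hpos (hsq i)
    rw [← hs, hvdef, LinearMap.comp_apply, hx0', ← hvdef]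
    exact hpos i
  have hr0 : ∀ i j, 0 ≤ r i j := by
    intro i
    apply pos_of_root v hpos (hrq i)
    rw [← hr, hvdef, LinearMap.comp_apply, hx0'', ← hvdef]
    exact hpos i
  have hr1 : ∀ i, 1 ≤ ∑ j, r i j := by
    intro i
    have h3 : 0 ≤ ∑ j, r i j := Finset.sum_nonneg fun j _ => hr0 i j
    by_contra hc
    have h4 : ∑ j, r i j = 0 := by omega
    have h5 := (Finset.sum_eq_zero_iff_of_nonneg (fun j _ => hr0 i j)).1 h4
    exact root_ne_zero (hrq i) (funext fun j => h5 j (Finset.mem_univ j))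
  have hcomp : ∀ i k, ∑ j, s i j * r j k = (Pi.single i 1 : Fin 8 → ℤ) k := by
    intro i
    have h3 : (fun k => ∑ j, s i j * r j k) = (Pi.single i 1 : Fin 8 → ℤ) := by
      apply int_indep hli
      rw [sum_single]
      have h4 : l i = (l i ∘ₗ τ) ∘ₗ τ' := by
        ext x
        rw [LinearMap.comp_apply, LinearMap.comp_apply, hττ']
      have h5 : (∑ j, s i j • l j) ∘ₗ τ' = ∑ j, s i j • (l j ∘ₗ τ') := by
        ext x; simp
      rw [hs, h5] at h4
      rw [h4]
      simp only [hr, Finset.smul_sum, smul_smul, Finset.sum_smul]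
      rw [Finset.sum_comm]
    exact fun k => congrFun h3 k
  have hsing : ∀ i, ∃ j, s i = Pi.single j 1 := by
    intro i
    refine exists_single (t := fun j => ∑ k, r j k) (hs0 i) hr1 ?_
    simp only [Finset.mul_sum]
    rw [Finset.sum_comm]
    simp only [hcomp]
    simp
  choose σ hσ using hsing
  have hlσ : ∀ i, l i ∘ₗ τ = l (σ i) := by
    intro i
    rw [hs, hσ, sum_single]
  have hinj : Function.Injective σ := by
    intro i j hij
    have h3 : l i ∘ₗ τ = l j ∘ₗ τ := by rw [hlσ, hlσ, hij]
    have h4 : l i = l j := by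
      ext x
      have := congrArg (fun f : Module.Dual F h => f (τ' x)) h3
      simpa [hττ'] using this
    exact hli.injective h4
  have hadj : ∀ i j, adj i j = true → adj (σ i) (σ j) = true := by
    intro i j hij
    rw [adj, decide_eq_true_iff] at hij ⊢
    have hq2 : ∀ a b : Fin 8, q (Pi.single a 1 + Pi.single b 1) = 4 + 2 * CartanMatrix.E₈ a b := by
      intro a b
      have := q_add_smul (Pi.single a 1) (Pi.single b 1) 1
      rw [one_smul, bil_single, pr_single, q_single, q_single] at this
      rw [this]; ring
    have hsum : ∀ a b : Fin 8, ∑ k, (Pi.single a 1 + Pi.single b 1 : Fin 8 → ℤ) k • l k = l a + l b := by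
      intro a b
      simp only [Pi.add_apply, add_smul, Finset.sum_add_distrib, sum_single]
    have h3 : l i + l j ∈ rts h := (hl _).2 ⟨_, by rw [hq2, hij]; norm_num, (hsum i j).symm⟩
    have h4 := hτ _ h3
    rw [LinearMap.add_comp, hlσ, hlσ] at h4
    obtain ⟨n, hn, hn'⟩ := (hl _).1 h4
    rw [← hsum] at hn'
    rw [← int_indep hli hn', hq2] at hn
    omega
  have hid := diagram_rigid σ hinj hadj
  intro x hx
  have h3 : τ ⟨x, hx⟩ - ⟨x, hx⟩ = 0 := by
    apply base_sep hl
    intro i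
    have h4 := congrArg (fun f : Module.Dual F h => f ⟨x, hx⟩) (hlσ i)
    rw [hid] at h4
    have h4 : l i (τ ⟨x, hx⟩) = l i ⟨x, hx⟩ := h4
    rw [map_sub, h4, sub_self]
  exact congrArg Subtype.val (sub_eq_zero.1 h3)
end main
end E8L

namespace E8L
set_option linter.unusedSectionVars false
set_option linter.unusedVariables false
open LieAlgebra

section defs
variable {F L : Type*} [Field F] [LieRing L] [LieAlgebra F L] {h : LieSubalgebra F L}

/-- weight vector -/
def WV (κ : Module.Dual F h) (x : L) : Prop := ∀ y : h, ⁅(y : L), x⁆ = κ y • x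

/-- `T` acts on the `κ`-weight space by the scalar `c` -/
def Act (T : Module.End F L) (κ : Module.Dual F h) (c : F) : Prop := ∀ x, WV κ x → T x = c • x

lemma WV.lie {κ μ : Module.Dual F h} {x y : L} (hx : WV κ x) (hy : WV μ y) :
    WV (κ + μ) ⁅x, y⁆ := by
  intro z
  rw [leibniz_lie, hx, hy, smul_lie, lie_smul, LinearMap.add_apply, add_smul]

lemma WV.eq_zero {κ : Module.Dual F h} {x : L} (hx : WV κ x) (h0 : κ ≠ 0) (hr : κ ∉ rts h) :
    x = 0 := by
  by_contra hc
  exact hr ⟨h0, x, hc, hx⟩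

lemma Act.pow {T : Module.End F L} {κ : Module.Dual F h} {c : F} (ha : Act T κ c) (k : ℕ)
    {x : L} (hx : WV κ x) : (T ^ k) x = c ^ k • x := by
  induction k with
  | zero => simp
  | succ k ih => rw [pow_succ', Module.End.mul_apply, ih, map_smul, ha x hx, smul_smul, pow_succ]

lemma Act.pow_eq {T : Module.End F L} {κ : Module.Dual F h} {c : F} (ha : Act T κ c) {m : ℕ}
    (hm : T ^ m = 1) (hκ : κ ∈ rts h) : c ^ m = 1 := by
  obtain ⟨_, x, hx0, hx⟩ := hκ
  have h1 := ha.pow m hx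
  rw [hm, Module.End.one_apply] at h1
  have h2 : (c ^ m - 1) • x = 0 := by rw [sub_smul, ← h1, one_smul, sub_self]
  exact sub_eq_zero.1 ((smul_eq_zero.1 h2).resolve_right hx0)

lemma Act.unique {T : Module.End F L} {κ : Module.Dual F h} {c d : F} (ha : Act T κ c)
    (hb : Act T κ d) (hκ : κ ∈ rts h) : c = d := by
  obtain ⟨_, x, hx0, hx⟩ := hκ
  have h2 : (c - d) • x = 0 := by rw [sub_smul, ← ha x hx, ← hb x hx, sub_self]
  exact sub_eq_zero.1 ((smul_eq_zero.1 h2).resolve_right hx0)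
end defs

section main
variable {F L : Type*} [Field F] [CharZero F] [IsAlgClosed F] [LieRing L] [LieAlgebra F L]
  [Module.Finite F L] [LieAlgebra.IsKilling F L] {h : LieSubalgebra F L} [h.IsCartanSubalgebra]

lemma WV.mem_rootSpace {κ : Module.Dual F h} {x : L} (hx : WV κ x) :
    x ∈ LieAlgebra.rootSpace h (κ : h → F) := by
  show x ∈ LieModule.genWeightSpace L (κ : h → F)
  rw [LieModule.mem_genWeightSpace]
  intro y
  refine ⟨1, ?_⟩
  have := hx y
  rw [pow_one, LinearMap.sub_apply, LieModule.toEnd_apply_apply]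
  show ⁅(y : L), x⁆ - κ y • x = 0
  rw [this, sub_self]

lemma WV.mem_of_zero {x : L} (hx : WV (0 : Module.Dual F h) x) : x ∈ h := by
  have h1 := hx.mem_rootSpace
  have h2 : x ∈ LieAlgebra.rootSpace h (0 : h → F) := h1
  rw [LieAlgebra.rootSpace_zero_eq] at h2
  exact h2

lemma wv_dim {κ : Module.Dual F h} (hκ : κ ∈ rts h) {x y : L} (hx : WV κ x) (hx0 : x ≠ 0)
    (hy : WV κ y) : ∃ c : F, y = c • x := by
  obtain ⟨χ, hχ, rfl⟩ := (mem_rts_iff h κ).1 hκ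
  have h1 := LieAlgebra.IsKilling.finrank_rootSpace_eq_one χ (by simpa using hχ)
  have hx' : x ∈ LieAlgebra.rootSpace h χ := hx.mem_rootSpace
  have hy' : y ∈ LieAlgebra.rootSpace h χ := hy.mem_rootSpace
  obtain ⟨c, hc⟩ := (finrank_eq_one_iff_of_nonzero'
    (⟨x, hx'⟩ : LieAlgebra.rootSpace h χ) (by
      intro h0; exact hx0 (congrArg Subtype.val h0))).1 h1 ⟨y, hy'⟩
  exact ⟨c, (congrArg Subtype.val hc).symm⟩

lemma sl2_of {κ : Module.Dual F h} (hκ : κ ∈ rts h) : ∃ (e f : L) (t : h), WV κ e ∧ WV (-κ) f ∧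
    ⁅e, f⁆ = (t : L) ∧ κ t = 2 ∧ e ≠ 0 ∧ f ≠ 0 ∧ t ≠ 0 := by
  obtain ⟨χ, hχ, rfl⟩ := (mem_rts_iff h κ).1 hκ
  obtain ⟨t, e, f, ht, he, hf⟩ :=
    LieAlgebra.IsKilling.exists_isSl2Triple_of_weight_isNonZero (α := χ) (by simpa using hχ)
  have he' : WV (LieModule.Weight.toLinear F h L χ) e := fun y =>
    LieAlgebra.IsKilling.lie_eq_smul_of_mem_rootSpace he y
  have hf' : WV (-LieModule.Weight.toLinear F h L χ) f := fun y =>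
    LieAlgebra.IsKilling.lie_eq_smul_of_mem_rootSpace hf y
  have hth : t ∈ h := by
    have h1 := he'.lie hf'
    rw [add_neg_cancel, ht.lie_e_f] at h1
    exact h1.mem_of_zero
  have he0 : e ≠ 0 := by
    rintro rfl
    exact ht.h_ne_zero (by rw [← ht.lie_e_f, zero_lie])
  have hf0 : f ≠ 0 := by
    rintro rfl
    exact ht.h_ne_zero (by rw [← ht.lie_e_f, lie_zero])
  refine ⟨e, f, ⟨t, hth⟩, he', hf', ht.lie_e_f, ?_, he0, hf0, ?_⟩
  · have h1 := he' ⟨t, hth⟩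
    have h2 := ht.lie_h_e_nsmul
    have h3 : (LieModule.Weight.toLinear F h L χ ⟨t, hth⟩ - 2) • e = 0 := by
      rw [sub_smul, ← h1, h2, two_nsmul, two_smul, sub_self]
    exact sub_eq_zero.1 ((smul_eq_zero.1 h3).resolve_right he0)
  · intro h0
    exact ht.h_ne_zero (congrArg Subtype.val h0)

/-- a linear map killing `h` and all root vectors is zero -/
lemma lin_zero {M : Type*} [AddCommGroup M] [Module F M] (f : L →ₗ[F] M)
    (hh : ∀ x ∈ h, f x = 0) (hr : ∀ κ ∈ rts h, ∀ x, WV κ x → f x = 0) : f = 0 := by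
  have h2 : (⊤ : Submodule F L) ≤ LinearMap.ker f := by
    have h3 := LieModule.iSup_genWeightSpace_eq_top' F h L
    rw [← LieSubmodule.iSup_toSubmodule_eq_top] at h3
    rw [← h3]
    refine iSup_le fun χ => ?_
    intro x hx
    rw [LinearMap.mem_ker]
    by_cases hz : χ.IsZero
    · apply hh
      have hx' : x ∈ LieModule.genWeightSpace L (χ : h → F) := hx
      rw [show (χ : h → F) = 0 from hz] at hx'
      have h4 : x ∈ LieAlgebra.rootSpace h (0 : h → F) := hx'
      rw [LieAlgebra.rootSpace_zero_eq] at h4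
      exact h4
    · exact hr (LieModule.Weight.toLinear F h L χ)
          ((mem_rts_iff h _).2 ⟨χ, by simpa using hz, rfl⟩) x
          (fun y => LieAlgebra.IsKilling.lie_eq_smul_of_mem_rootSpace hx y)
  ext x
  exact h2 trivial

variable {T : Module.End F L} (hT : ∀ x y, T ⁅x, y⁆ = ⁅T x, T y⁆) (hTh : ∀ x ∈ h, T x = x)

include hT hTh in
lemma act_wv {κ : Module.Dual F h} {x : L} (hx : WV κ x) : WV κ (T x) := by
  intro y
  have h1 := congrArg T (hx y)
  rw [hT, hTh _ y.2, map_smul] at h1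
  exact h1

include hT hTh in
lemma exists_act {κ : Module.Dual F h} (hκ : κ ∈ rts h) : ∃ c : F, Act T κ c := by
  have hκ' := hκ
  obtain ⟨_, x, hx0, hx⟩ := hκ'
  obtain ⟨c, hc⟩ := wv_dim hκ hx hx0 (act_wv hT hTh hx)
  refine ⟨c, fun y hy => ?_⟩
  obtain ⟨d, rfl⟩ := wv_dim hκ hx hx0 hy
  rw [map_smul, hc, smul_comm]

include hT hTh in
lemma act_neg {κ : Module.Dual F h} (hκ : κ ∈ rts h) (hκ' : -κ ∈ rts h) {c : F} (hc : Act T κ c) :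
    Act T (-κ) c⁻¹ := by
  obtain ⟨d, hd⟩ := exists_act hT hTh hκ'
  obtain ⟨e, f, t, he, hf, hef, -, -, -, ht0⟩ := sl2_of hκ
  have h1 := hT e f
  rw [hc e he, hd f hf, hef, hTh _ t.2, smul_lie, lie_smul, hef, smul_smul] at h1
  have h2 : (1 - c * d) • (t : L) = 0 := by rw [sub_smul, one_smul, ← h1, sub_self]
  have h3 : c * d = 1 := (sub_eq_zero.1 ((smul_eq_zero.1 h2).resolve_right
    (fun h0 => ht0 (Subtype.ext h0)))).symm
  rw [← eq_inv_of_mul_eq_one_right h3]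
  exact hd

include hT hTh in
lemma act_add {κ μ : Module.Dual F h} (hκ : κ ∈ rts h) (hμ : μ ∈ rts h) (hs : κ + μ ∈ rts h)
    (h1 : κ + (κ + μ) ≠ 0 ∧ κ + (κ + μ) ∉ rts h) (h2 : -κ + μ ≠ 0 ∧ -κ + μ ∉ rts h)
    {c d : F} (hc : Act T κ c) (hd : Act T μ d) : Act T (κ + μ) (c * d) := by
  obtain ⟨e, f, t, he, hf, hef, ht2, he0, hf0, ht0⟩ := sl2_of hκ
  have hμ' := hμ
  obtain ⟨_, v, hv0, hv⟩ := hμ'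
  have hv : WV μ v := hv
  have hs' := hs
  obtain ⟨_, w, hw0, hw⟩ := hs'
  have hw : WV (κ + μ) w := hw
  have hne : ⁅e, v⁆ ≠ 0 := by
    intro h0
    have a1 : ⁅e, w⁆ = 0 := (he.lie hw).eq_zero h1.1 h1.2
    have a2 : ⁅f, v⁆ = 0 := (hf.lie hv).eq_zero h2.1 h2.2
    have a3 : WV μ ⁅f, w⁆ := by
      have := hf.lie hw
      rwa [neg_add_cancel_left] at this
    obtain ⟨r, hr⟩ := wv_dim hμ hv hv0 a3
    have a4 : (κ + μ) t • w = 0 := by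
      rw [← hw t, ← hef, lie_lie, a1, lie_zero, sub_zero, hr, lie_smul, h0, smul_zero]
    have a5 : μ t • v = 0 := by
      rw [← hv t, ← hef, lie_lie, a2, h0, lie_zero, lie_zero, sub_zero]
    have a6 := (smul_eq_zero.1 a4).resolve_right hw0
    have a7 := (smul_eq_zero.1 a5).resolve_right hv0
    rw [LinearMap.add_apply, a7, ht2, add_zero] at a6
    exact two_ne_zero a6
  intro x hx
  obtain ⟨r, rfl⟩ := wv_dim hs (he.lie hv) hne hx
  rw [map_smul, hT, hc e he, hd v hv, smul_lie, lie_smul, smul_smul c d, smul_comm]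

end main
end E8L

namespace E8L
set_option linter.unusedSectionVars false
set_option linter.unusedVariables false
open LieAlgebra

/-- arithmetic of roots at an alcove point -/
lemma alcove_roots {m : ℤ} (hm : 1 ≤ m) {x : Fin 8 → ℤ} (hx : ∀ i, 0 ≤ x i)
    (hs : ∑ i, mvec i * x i ≤ m) {n : Fin 8 → ℤ} (hn : q n = 2) (hdvd : m ∣ ∑ i, n i * x i) :
    (∀ i, x i ≠ 0 → n i = 0) ∨ (∑ i, mvec i * x i = m ∧
      ∃ s : ℤ, ∀ i, x i ≠ 0 → n i = s * mvec i) := by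
  have key : ∀ n : Fin 8 → ℤ, q n = 2 → 0 ≤ n → m ∣ ∑ i, n i * x i →
      (∀ i, x i ≠ 0 → n i = 0) ∨ (∑ i, mvec i * x i = m ∧ ∀ i, x i ≠ 0 → n i = mvec i) := by
    intro n hn h0 hdvd
    have h1 : ∀ i, 0 ≤ n i * x i := fun i => mul_nonneg (h0 i) (hx i)
    have h2 : ∀ i, 0 ≤ (mvec i - n i) * x i := fun i =>
      mul_nonneg (sub_nonneg.2 (root_le hn i)) (hx i)
    have h3 : 0 ≤ ∑ i, n i * x i := Finset.sum_nonneg fun i _ => h1 i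
    have h4 : ∑ i, (mvec i - n i) * x i = ∑ i, mvec i * x i - ∑ i, n i * x i := by
      simp only [sub_mul, Finset.sum_sub_distrib]
    have h5 : 0 ≤ ∑ i, (mvec i - n i) * x i := Finset.sum_nonneg fun i _ => h2 i
    by_cases hz : ∑ i, n i * x i = 0
    · left
      intro i hi
      have := (Finset.sum_eq_zero_iff_of_nonneg (fun i _ => h1 i)).1 hz i (Finset.mem_univ i)
      exact (mul_eq_zero.1 this).resolve_right hi
    · right
      have h6 : m ≤ ∑ i, n i * x i := Int.le_of_dvd (by omega) hdvd
      refine ⟨by omega, fun i hi => ?_⟩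
      have := (Finset.sum_eq_zero_iff_of_nonneg (fun i _ => h2 i)).1 (by omega) i
        (Finset.mem_univ i)
      have := (mul_eq_zero.1 this).resolve_right hi
      omega
  rcases root_sign hn with h0 | h0
  · rcases key n hn h0 hdvd with h | ⟨h, h'⟩
    · exact Or.inl h
    · exact Or.inr ⟨h, 1, fun i hi => by rw [one_mul]; exact h' i hi⟩
  · rcases key (-n) (by rw [q_neg, hn]) (by simpa using h0) (by
      simpa [Finset.sum_neg_distrib] using hdvd) with h | ⟨h, h'⟩
    · exact Or.inl fun i hi => by simpa using h i hi
    · refine Or.inr ⟨h, -1, fun i hi => ?_⟩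
      have := h' i hi
      rw [Pi.neg_apply] at this
      omega

section main
variable {F L : Type*} [Field F] [CharZero F] [IsAlgClosed F] [LieRing L] [LieAlgebra F L]
  [Module.Finite F L] [LieAlgebra.IsKilling F L] {h : LieSubalgebra F L} [h.IsCartanSubalgebra]
  {T : Module.End F L} (hT : ∀ x y, T ⁅x, y⁆ = ⁅T x, T y⁆) (hTh : ∀ x ∈ h, T x = x)
  (hd : Module.finrank F h = 8)

lemma mem_rts_sum (hd : Module.finrank F h = 8) {l : Fin 8 → Module.Dual F h} (hl : IsE8Base h l)
    (n : Fin 8 → ℤ) : ∑ i, n i • l i ∈ rts h ↔ q n = 2 := by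
  constructor
  · intro hn
    obtain ⟨k, hk, hk'⟩ := (hl _).1 hn
    rw [int_indep (base_indep hd hl) hk', hk]
  · intro hn
    exact (hl _).2 ⟨n, hn, rfl⟩

lemma sum_ne_zero (hd : Module.finrank F h = 8) {l : Fin 8 → Module.Dual F h} (hl : IsE8Base h l)
    {n : Fin 8 → ℤ} (hn : q n ≠ 0) : ∑ i, n i • l i ≠ 0 := by
  intro h0
  have h1 : n = 0 := int_indep (base_indep hd hl) (k := 0) (by rw [h0]; simp)
  rw [h1, q_zero] at hn
  exact hn rfl

include hT hTh hd in
lemma act_base {l : Fin 8 → Module.Dual F h} (hl : IsE8Base h l) {ζ : F} (hζ : ζ ≠ 0)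
    {x : Fin 8 → ℤ} (hx : ∀ i, Act T (l i) (ζ ^ x i)) {n : Fin 8 → ℤ} (hn : q n = 2) :
    Act T (∑ i, n i • l i) (ζ ^ (∑ i, n i * x i)) := by
  have hsadd : ∀ a b : Fin 8 → ℤ, ∑ i, (a + b) i • l i = ∑ i, a i • l i + ∑ i, b i • l i := by
    intro a b; simp only [Pi.add_apply, add_smul, Finset.sum_add_distrib]
  have hsneg : ∀ a : Fin 8 → ℤ, ∑ i, (-a) i • l i = -∑ i, a i • l i := by
    intro a; simp only [Pi.neg_apply, neg_smul, Finset.sum_neg_distrib]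
  have hxs : ∀ j, ∑ i, (Pi.single j 1 : Fin 8 → ℤ) i * x i = x j := by
    intro j
    rw [Finset.sum_eq_single j]
    · simp
    · intro i _ hi; simp [hi]
    · simp
  have key : ∀ (N : ℕ) (n : Fin 8 → ℤ), q n = 2 → 0 ≤ n → ∑ i, n i ≤ N →
      Act T (∑ i, n i • l i) (ζ ^ (∑ i, n i * x i)) := by
    intro N
    induction N with
    | zero =>
      intro n hn h0 hN
      exfalso
      have h3 : ∑ i, n i = 0 := le_antisymm (by simpa using hN) (Finset.sum_nonneg fun i _ => h0 i)
      have h5 := (Finset.sum_eq_zero_iff_of_nonneg (fun j _ => h0 j)).1 h3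
      exact root_ne_zero hn (funext fun j => h5 j (Finset.mem_univ j))
    | succ N ih =>
      intro n hn h0 hN
      by_cases hs : ∃ i, n = Pi.single i 1
      · obtain ⟨i, rfl⟩ := hs
        rw [sum_single, hxs]
        exact hx i
      · push Not at hs
        obtain ⟨i, hi1, hi2, hi3⟩ := root_sub hn h0 hs
        set k := n - Pi.single i 1 with hk
        have hnk : n = Pi.single i 1 + k := by rw [hk]; abel
        have hsum1 : ∑ j, (Pi.single i 1 : Fin 8 → ℤ) j = 1 := by simp
        have hNk : ∑ j, k j ≤ N := by
          rw [hnk] at hN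
          simp only [Pi.add_apply, Finset.sum_add_distrib, hsum1] at hN
          push_cast at hN
          omega
        have hb : pr k i = -1 := by
          rw [hk, pr_sub, hi3, pr_single, E_diag]; norm_num
        have q1 : q (Pi.single i 1 + (Pi.single i 1 + k)) = 6 := by
          have := q_add_smul k (Pi.single i 1) 2
          rw [bil_single, q_single, hi1, hb] at this
          rw [show (Pi.single i 1 + (Pi.single i 1 + k) : Fin 8 → ℤ)
            = k + (2 : ℤ) • (Pi.single i 1 : Fin 8 → ℤ) by rw [two_smul]; abel, this]
          norm_num
        have q2 : q (-Pi.single i 1 + k) = 6 := by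
          have := q_add_smul k (Pi.single i 1) (-1)
          rw [bil_single, q_single, hi1, hb] at this
          rw [show (-Pi.single i 1 + k : Fin 8 → ℤ)
            = k + (-1 : ℤ) • (Pi.single i 1 : Fin 8 → ℤ) by rw [neg_one_smul]; abel, this]
          norm_num
        have hak := ih k hi1 hi2 hNk
        have := act_add hT hTh (κ := l i) (μ := ∑ j, k j • l j) (base_mem hl i)
          ((mem_rts_sum hd hl k).2 hi1)
          (by rw [← sum_single l i, ← hsadd, ← hnk]; exact (mem_rts_sum hd hl n).2 hn)
          (by
            rw [← sum_single l i, ← hsadd, ← hsadd, mem_rts_sum hd hl, q1]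
            exact ⟨sum_ne_zero hd hl (by rw [q1]; norm_num), by norm_num⟩)
          (by
            rw [← sum_single l i, ← hsneg, ← hsadd, mem_rts_sum hd hl, q2]
            exact ⟨sum_ne_zero hd hl (by rw [q2]; norm_num), by norm_num⟩)
          (hx i) hak
        rw [← zpow_add₀ hζ] at this
        have e1 : ∑ j, n j • l j = l i + ∑ j, k j • l j := by
          rw [hnk, hsadd, sum_single]
        have e2 : ∑ j, n j * x j = x i + ∑ j, k j * x j := by
          rw [hnk]
          simp only [Pi.add_apply, add_mul, Finset.sum_add_distrib, hxs]
        rw [e1, e2]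
        exact this
  rcases root_sign hn with h0 | h0
  · exact key (∑ i, n i).toNat n hn h0 (Int.self_le_toNat _)
  · have hn' : q (-n) = 2 := by rw [q_neg, hn]
    have h1 := key (∑ i, (-n) i).toNat (-n) hn' (by simpa using h0) (Int.self_le_toNat _)
    have h2 := act_neg hT hTh ((mem_rts_sum hd hl (-n)).2 hn') (by
      rw [← hsneg, neg_neg]; exact (mem_rts_sum hd hl n).2 hn) h1
    rw [← hsneg, neg_neg, ← zpow_neg] at h2
    have e2 : -∑ j, (-n) j * x j = ∑ j, n j * x j := by
      simp [Finset.sum_neg_distrib]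
    rw [e2] at h2
    exact h2

/-- elements of `h` killed by all roots with trivial eigenvalue are central in the fixed algebra -/
lemma central_of {m : ℕ} (hm : 1 ≤ m) (hTm : T ^ m = 1) (hT : ∀ x y, T ⁅x, y⁆ = ⁅T x, T y⁆)
    (hTh : ∀ x ∈ h, T x = x) (v : h) (hv : ∀ κ ∈ rts h, Act T κ 1 → κ v = 0) (y : L)
    (hy : T y = y) : ⁅(v : L), y⁆ = 0 := by
  have h0 : (LieAlgebra.ad F L (v : L)) ∘ₗ (∑ k ∈ Finset.range m, T ^ k) = 0 := by
    refine lin_zero (h := h) _ ?_ ?_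
    · intro x hx
      have h1 : ∀ k, (T ^ k) x = x := by
        intro k
        induction k with
        | zero => simp
        | succ k ih => rw [pow_succ, Module.End.mul_apply, hTh x hx, ih]
      have h2 : ⁅(v : L), x⁆ = 0 := congrArg Subtype.val (trivial_lie_zero h h v ⟨x, hx⟩)
      rw [LinearMap.comp_apply, LinearMap.sum_apply]
      simp [h1, h2]
    · intro κ hκ x hx
      obtain ⟨c, hc⟩ := exists_act hT hTh hκ
      rw [LinearMap.comp_apply, LinearMap.sum_apply]
      simp only [hc.pow _ hx]
      rw [← Finset.sum_smul, map_smul, LieAlgebra.ad_apply, hx v]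
      by_cases h1 : c = 1
      · subst h1
        rw [hv κ hκ hc, zero_smul, smul_zero]
      · have h2 := mul_geom_sum c m
        rw [hc.pow_eq hTm hκ, sub_self] at h2
        rw [(mul_eq_zero.1 h2).resolve_left (sub_ne_zero.2 h1), zero_smul]
  have h1 := congrArg (fun f : L →ₗ[F] L => f y) h0
  have h2 : ∀ k, (T ^ k) y = y := by
    intro k
    induction k with
    | zero => simp
    | succ k ih => rw [pow_succ, Module.End.mul_apply, hy, ih]
  have h3 : m • ⁅(v : L), y⁆ = 0 := by
    simpa [h2] using h1
  rw [← Nat.cast_smul_eq_nsmul F] at h3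
  exact (smul_eq_zero.1 h3).resolve_left (by exact_mod_cast (by omega : m ≠ 0))

theorem order_le {m : ℕ} (hm : 1 ≤ m) (hTm : T ^ m = 1) (hT : ∀ x y, T ⁅x, y⁆ = ⁅T x, T y⁆)
    (hTh : ∀ x ∈ h, T x = x) (hord : ∀ k : ℕ, 0 < k → T ^ k = 1 → m ≤ k)
    (hcen : ∀ v ∈ h, (∀ y, T y = y → ⁅v, y⁆ = 0) → v = 0)
    (hd : Module.finrank F h = 8) (l0 : Fin 8 → Module.Dual F h) (hl0 : IsE8Base h l0) :
    m ≤ 6 := by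
  have : NeZero m := ⟨by omega⟩
  obtain ⟨ζ, hζ⟩ := HasEnoughRootsOfUnity.exists_primitiveRoot F m
  have hζ0 : ζ ≠ 0 := hζ.ne_zero (by omega)
  have hζm : ζ ^ (m : ℤ) = 1 := by rw [zpow_natCast, hζ.pow_eq_one]
  have hx0 : ∀ i, ∃ x : ℤ, Act T (l0 i) (ζ ^ x) := by
    intro i
    obtain ⟨c, hc⟩ := exists_act hT hTh (base_mem hl0 i)
    obtain ⟨k, -, hk⟩ := hζ.eq_pow_of_pow_eq_one (hc.pow_eq hTm (base_mem hl0 i))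
    exact ⟨k, by rw [zpow_natCast, hk]; exact hc⟩
  choose x0 hx0 using hx0
  have hrefl : ∀ (l : Fin 8 → Module.Dual F h), IsE8Base h l → ∀ x : Fin 8 → ℤ,
      (∀ i, Act T (l i) (ζ ^ x i)) → ∀ n : Fin 8 → ℤ, q n = 2 → ∀ j,
      Act T (refl l n j) (ζ ^ (x j - (∑ i, n i * x i) * pr n j)) := by
    intro l hl x hx n hn j
    have h1 := act_base hT hTh hd hl hζ0 hx
      (n := Pi.single j 1 - bil (Pi.single j 1) n • n) (by rw [q_reflect hn, q_single])
    rw [← refl_sum, sum_single] at h1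
    convert h1 using 2
    rw [bil_comm, bil_single]
    simp only [Pi.sub_apply, sub_mul, Finset.sum_sub_distrib, Pi.smul_apply, smul_eq_mul, mul_assoc,
      ← Finset.mul_sum]
    have h2 : ∑ i, (Pi.single j 1 : Fin 8 → ℤ) i * x i = x j := by
      rw [Finset.sum_eq_single j]
      · simp
      · intro i _ hi; simp [hi]
      · simp
    rw [h2]; ring
  refine alcove_aux (m : ℤ) (by exact_mod_cast hm) (fun x => ∀ l : Fin 8 → Module.Dual F h,
    IsE8Base h l → (∀ i, Act T (l i) (ζ ^ x i)) → m ≤ 6) ?_ ?_ ?_ x0 l0 hl0 hx0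
  · intro x i hi ih l hl hx
    refine ih (refl l (Pi.single i 1)) (base_refl hl (q_single i)) fun j => ?_
    have h1 := hrefl l hl x hx _ (q_single i) j
    rw [pr_single, Finset.sum_eq_single i] at h1
    · simpa using h1
    · intro k _ hk; simp [hk]
    · simp
  · intro x hxm ih l hl hx
    refine ih (refl l mvec) (base_refl hl q_mvec) fun j => ?_
    have h1 := hrefl l hl x hx _ q_mvec j
    have h2 : ζ ^ (x j - ((∑ i, mvec i * x i) - m) * pr mvec j)
        = ζ ^ (x j - (∑ i, mvec i * x i) * pr mvec j) := by
      rw [show x j - ((∑ i, mvec i * x i) - m) * pr mvec j =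
        (x j - (∑ i, mvec i * x i) * pr mvec j) + m * pr mvec j by ring, zpow_add₀ hζ0,
        zpow_mul, hζm, one_zpow, mul_one]
    rw [h2]
    exact h1
  · intro x hx hsum l hl hact
    have hall : ∀ n : Fin 8 → ℤ, q n = 2 → Act T (∑ i, n i • l i) (ζ ^ (∑ i, n i * x i)) :=
      fun n hn => act_base hT hTh hd hl hζ0 hact hn
    -- powers of `T`
    have hpow : ∀ k : ℕ, 0 < k → (∀ n : Fin 8 → ℤ, q n = 2 → (m : ℤ) ∣ (∑ i, n i * x i) * k) →
        m ≤ k := by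
      intro k hk hdvd
      apply hord k hk
      rw [← sub_eq_zero]
      refine lin_zero (h := h) _ ?_ ?_
      · intro y hy
        have h1 : (T ^ k) y = y := by
          clear hdvd hk
          induction k with
          | zero => simp
          | succ k ih => rw [pow_succ, Module.End.mul_apply, hTh y hy, ih]
        rw [LinearMap.sub_apply, h1, Module.End.one_apply, sub_self]
      · intro κ hκ y hy
        obtain ⟨n, hn, rfl⟩ := (hl κ).1 hκ
        rw [LinearMap.sub_apply, (hall n hn).pow k hy, ← zpow_natCast, ← zpow_mul,
          (hζ.zpow_eq_one_iff_dvd _).2 (hdvd n hn), one_smul, Module.End.one_apply, sub_self]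
    -- central elements
    have hcent : ∀ c : Fin 8 → ℤ, c ≠ 0 → (∀ n : Fin 8 → ℤ, q n = 2 →
        (m : ℤ) ∣ ∑ i, n i * x i → ∑ i, n i * c i = 0) → False := by
      intro c hc hn
      obtain ⟨v, hv⟩ := base_values hd hl (fun i => (c i : F))
      have h1 : (v : L) = 0 := by
        apply hcen v v.2
        refine central_of hm hTm hT hTh v ?_
        intro κ hκ hact1
        obtain ⟨n, hq, rfl⟩ := (hl κ).1 hκ
        have h2 := (hall n hq).unique hact1 hκ
        have h3 := hn n hq ((hζ.zpow_eq_one_iff_dvd _).1 h2)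
        rw [LinearMap.sum_apply]
        have h4 : ∀ i, (n i • l i) v = ((n i * c i : ℤ) : F) := by
          intro i
          rw [LinearMap.smul_apply, hv, zsmul_eq_mul]
          push_cast; rfl
        simp only [h4]
        rw [← Int.cast_sum, h3, Int.cast_zero]
      apply hc
      funext i
      have h2 := hv i
      rw [show v = 0 from Subtype.ext h1, map_zero] at h2
      exact_mod_cast h2.symm
    have hm' : (1 : ℤ) ≤ m := by exact_mod_cast hm
    by_cases hz : ∀ i, x i = 0
    · have := hpow 1 one_pos (fun n hn => by simp [hz])
      omega
    push Not at hz
    obtain ⟨j, hj⟩ := hz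
    by_cases h2 : ∃ k, k ≠ j ∧ x k ≠ 0
    · exfalso
      obtain ⟨k, hkj, hk⟩ := h2
      have hsumc : ∀ n : Fin 8 → ℤ, ∑ i, n i * (Pi.single j (mvec k) - Pi.single k (mvec j) :
          Fin 8 → ℤ) i = n j * mvec k - n k * mvec j := by
        intro n
        simp only [Pi.sub_apply, mul_sub, Finset.sum_sub_distrib]
        rw [Finset.sum_eq_single j, Finset.sum_eq_single k]
        · simp
        · intro i _ hi; simp [hi]
        · simp
        · intro i _ hi; simp [hi]
        · simp
      refine hcent (Pi.single j (mvec k) - Pi.single k (mvec j)) ?_ ?_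
      · intro h0
        have := congrFun h0 j
        simp [hkj.symm] at this
        have := mvec_pos k
        omega
      · intro n hn hdvd
        rw [hsumc]
        rcases alcove_roots hm' hx hsum hn hdvd with h3 | ⟨-, s, h3⟩
        · rw [h3 j hj, h3 k hk]; ring
        · rw [h3 j hj, h3 k hk]; ring
    · push Not at h2
      have hsj : ∀ n : Fin 8 → ℤ, ∑ i, n i * x i = n j * x j := by
        intro n
        rw [Finset.sum_eq_single j]
        · intro i _ hi; rw [h2 i hi, mul_zero]
        · simp
      by_cases hmj : ∑ i, mvec i * x i = m
      · have h3 := mvec_pos j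
        have h4 := hpow (mvec j).toNat (by omega) (fun n hn => by
          rw [hsj, Int.toNat_of_nonneg h3.le, mul_assoc, mul_comm (x j), ← hsj, hmj]
          exact Dvd.intro_left _ rfl)
        have := mvec_le j
        omega
      · exfalso
        refine hcent (Pi.single j 1) ?_ ?_
        · intro h0
          have := congrFun h0 j
          simp at this
        · intro n hn hdvd
          rcases alcove_roots hm' hx hsum hn hdvd with h3 | ⟨h3, -⟩
          · rw [Finset.sum_eq_single j]
            · simp [h3 j hj]
            · intro i _ hi; simp [hi]
            · simp
          · exact absurd h3 hmj
end main
end E8L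

namespace E8L
set_option linter.unusedSectionVars false
set_option linter.unusedVariables false
open LieAlgebra

theorem abstract_main {F L : Type*} [Field F] [CharZero F] [IsAlgClosed F] [LieRing L]
    [LieAlgebra F L] {hh e f : Fin 8 → L} (S : Serre F hh e f)
    (T : Module.End F L) (hT : ∀ x y, T ⁅x, y⁆ = ⁅T x, T y⁆) {m : ℕ} (hm : 1 ≤ m)
    (hTm : T ^ m = 1) (hord : ∀ k : ℕ, 0 < k → T ^ k = 1 → m ≤ k)
    (g0 : LieSubalgebra F L) (hg : ∀ x, x ∈ g0 ↔ T x = x) [LieAlgebra.IsSemisimple F g0] :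
    m ≤ 6 := by
  rcases subsingleton_or_nontrivial L with hsub | hnt
  · have h1 : T ^ 1 = 1 := by ext x; exact Subsingleton.elim _ _
    have := hord 1 one_pos h1
    omega
  obtain ⟨hfin, hkil, H, hH, ⟨α, hα, -⟩, hHd⟩ := S.main
  have : NeZero m := ⟨by omega⟩
  have hg0 : LieAlgebra.IsKilling F g0 := inferInstance
  obtain ⟨h, hc, hst, hcent⟩ := exists_stable T hT hTm g0 hg
  obtain ⟨l0, hl0⟩ := transfer_base H h α hα
  have hd : Module.finrank F h = 8 := (transfer_cartan H h).2.trans hHd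
  have hst' : ∀ k : ℕ, ∀ x ∈ h, (T ^ k) x ∈ h := by
    intro k
    induction k with
    | zero => intro x hx; simpa using hx
    | succ k ih => intro x hx; rw [pow_succ, Module.End.mul_apply]; exact ih _ (hst x hx)
  have hTk : ∀ k : ℕ, ∀ x y, (T ^ k) ⁅x, y⁆ = ⁅(T ^ k) x, (T ^ k) y⁆ := by
    intro k
    induction k with
    | zero => intro x y; simp
    | succ k ih => intro x y; rw [pow_succ, Module.End.mul_apply, hT, ih]; rfl
  have hm1 : m - 1 + 1 = m := by omega
  have h1 : T * T ^ (m - 1) = 1 := by rw [← pow_succ', hm1, hTm]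
  have h2 : T ^ (m - 1) * T = 1 := by rw [← pow_succ, hm1, hTm]
  have hTh := fix_h (h := h) T (T ^ (m - 1)) hT (hTk _)
    (fun x => congrArg (fun g : Module.End F L => g x) h1)
    (fun x => congrArg (fun g : Module.End F L => g x) h2)
    hst (hst' _) hcent hd l0 hl0
  refine order_le hm hTm hT hTh hord ?_ hd l0 hl0
  intro v hv hvy
  have hvg : v ∈ g0 := (hg v).2 (hTh v hv)
  have h3 : (⟨v, hvg⟩ : g0) ∈ LieAlgebra.center F g0 := by
    rw [LieModule.mem_maxTrivSubmodule]
    intro y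
    apply Subtype.ext
    have := hvy y ((hg _).1 y.2)
    show ⁅(y : L), v⁆ = 0
    rw [← lie_skew, this, neg_zero]
  rw [LieAlgebra.center_eq_bot] at h3
  exact congrArg Subtype.val ((LieSubmodule.mem_bot _).1 h3)
end E8L


theorem stmt3 (F : Type) [Field F] [IsAlgClosed F] [CharZero F]
    (θ : ↥(lieAut F (LieAlgebra.e₈ F))) (hfin : orderOf θ ≠ 0)
    (hss : LieAlgebra.IsSemisimple F ↥(fixedSubalgebra θ)) :
    orderOf θ ≤ 6 := by
  obtain ⟨hh, e, f, S⟩ := E8L.serre_e8 F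
  have hpow : ∀ (k : ℕ) (x : LieAlgebra.e₈ F),
      (((θ : LieAlgebra.e₈ F ≃ₗ[F] LieAlgebra.e₈ F).toLinearMap : Module.End F (LieAlgebra.e₈ F)) ^ k) x
        = ((θ ^ k : ↥(lieAut F (LieAlgebra.e₈ F))) : LieAlgebra.e₈ F ≃ₗ[F] LieAlgebra.e₈ F) x := by
    intro k
    induction k with
    | zero => intro x; rfl
    | succ k ih =>
      intro x
      rw [pow_succ, pow_succ, Module.End.mul_apply, ih]
      rfl
  refine E8L.abstract_main S
    ((θ : LieAlgebra.e₈ F ≃ₗ[F] LieAlgebra.e₈ F).toLinearMap : Module.End F (LieAlgebra.e₈ F))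
    (fun x y => θ.2 x y) (m := orderOf θ) (by omega) ?_ ?_ (fixedSubalgebra θ) (fun x => Iff.rfl)
  · apply LinearMap.ext
    intro x
    rw [hpow, pow_orderOf_eq_one]
    rfl
  · intro k hk hT
    apply orderOf_le_of_pow_eq_one hk
    apply Subtype.ext
    apply LinearEquiv.ext
    intro x
    rw [← hpow, hT]
    rfl
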